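/- Let n ≥ 1 and let f : [0,∞) → ℝ be continuous with f(s) > 0 for all s > 0. Assume: (A) either n = 1, or there exists p with 1 < p < n(n+2)/(n−1)² such that s ↦ f(s)/s^p is nonincreasing on (0,∞); and (B) either (B1) f has regular variation at 0 with some index m₀ > 1 and regular variation at ∞ with some index m₁ > 1, or (B2) there exist q > 1, σ > 0 and s₀, s₁ > 0 such that f is nondecreasing on [s₀,∞), f(s) ≥ s^q for all s ≥ s₀, and s ↦ f(s)/s^σ is nondecreasing on (0,s₁]. Then the only nonnegative classical solution u : ℝⁿ × ℝ → ℝ of u_t − Δu = f(u) on ℝⁿ × ℝ (i.e. u, ∂_t u and the spatial partial derivatives of u up to order two exist and are continuous, and the equation holds pointwise) is u ≡ 0; in particular, if f(0) > 0 there is no such solution at all. -/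

import Mathlib

open Set Filter

/-- A classical solution of `u_t - Δu = f(u)` on all of `ℝⁿ × ℝ`: `u`, `∂_t u`
and the (pure) spatial partial derivatives of `u` up to order two exist and are
continuous, and the equation holds pointwise. -/
def IsEntireParabolicSol {n : ℕ} (f : ℝ → ℝ)
    (u : (Fin n → ℝ) → ℝ → ℝ) : Prop :=
  Continuous (fun p : (Fin n → ℝ) × ℝ => u p.1 p.2) ∧
  (∀ (x : Fin n → ℝ) (t : ℝ), DifferentiableAt ℝ (u x) t) ∧
  Continuous (fun p : (Fin n → ℝ) × ℝ => deriv (u p.1) p.2) ∧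
  (∀ (x : Fin n → ℝ) (t : ℝ) (i : Fin n),
    DifferentiableAt ℝ (fun s : ℝ => u (Function.update x i s) t) (x i)) ∧
  (∀ i : Fin n, Continuous (fun p : (Fin n → ℝ) × ℝ =>
    deriv (fun s : ℝ => u (Function.update p.1 i s) p.2) (p.1 i))) ∧
  (∀ (x : Fin n → ℝ) (t : ℝ) (i : Fin n),
    DifferentiableAt ℝ (deriv (fun s : ℝ => u (Function.update x i s) t)) (x i)) ∧
  (∀ i : Fin n, Continuous (fun p : (Fin n → ℝ) × ℝ =>
    deriv (deriv (fun s : ℝ => u (Function.update p.1 i s) p.2)) (p.1 i))) ∧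
  (∀ (x : Fin n → ℝ) (t : ℝ),
    deriv (u x) t -
      ∑ i : Fin n, deriv (deriv (fun s : ℝ => u (Function.update x i s) t)) (x i)
      = f (u x t))

namespace LV
noncomputable section
open MeasureTheory Topology

/-- The second function is the partial derivative of the first in direction i. -/
def PD {n : ℕ} (i : Fin n) (v v' : (Fin n → ℝ) → ℝ) : Prop :=
  ∀ x, HasDerivAt (fun s : ℝ => v (Function.update x i s)) (v' x) (x i)

theorem PD.mul {n : ℕ} {i : Fin n} {v v' w w' : (Fin n → ℝ) → ℝ} (hv : PD i v v') (hw : PD i w w') :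
    PD i (fun x => v x * w x) (fun x => v' x * w x + v x * w' x) := by
  intro x
  have := (hv x).mul (hw x)
  simp only [Function.update_eq_self] at this
  exact this

theorem PD.add {n : ℕ} {i : Fin n} {v v' w w' : (Fin n → ℝ) → ℝ} (hv : PD i v v') (hw : PD i w w') :
    PD i (fun x => v x + w x) (fun x => v' x + w' x) := fun x => (hv x).add (hw x)

theorem PD.sub {n : ℕ} {i : Fin n} {v v' w w' : (Fin n → ℝ) → ℝ} (hv : PD i v v') (hw : PD i w w') :
    PD i (fun x => v x - w x) (fun x => v' x - w' x) := fun x => (hv x).sub (hw x)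

theorem PD.const_mul {n : ℕ} {i : Fin n} {v v' : (Fin n → ℝ) → ℝ} (c : ℝ) (hv : PD i v v') :
    PD i (fun x => c * v x) (fun x => c * v' x) := fun x => (hv x).const_mul c

theorem PD.add_const {n : ℕ} {i : Fin n} {v v' : (Fin n → ℝ) → ℝ} (c : ℝ) (hv : PD i v v') :
    PD i (fun x => v x + c) v' := fun x => (hv x).add_const c

theorem PD.comp {n : ℕ} {i : Fin n} {v v' : (Fin n → ℝ) → ℝ} {g g' : ℝ → ℝ} (hv : PD i v v')
    (hg : ∀ x, HasDerivAt g (g' (v x)) (v x)) :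
    PD i (fun x => g (v x)) (fun x => g' (v x) * v' x) := by
  intro x
  have h1 := hg x
  have h2 := hv x
  have h3 : v (Function.update x i (x i)) = v x := by rw [Function.update_eq_self]
  rw [← h3] at h1
  have := HasDerivAt.comp (x i) h1 h2
  rw [h3] at this
  exact this

theorem PD.sum {n : ℕ} {i : Fin n} {ι : Type*} (s : Finset ι) {v v' : ι → (Fin n → ℝ) → ℝ}
    (hv : ∀ j ∈ s, PD i (v j) (v' j)) :
    PD i (fun x => ∑ j ∈ s, v j x) (fun x => ∑ j ∈ s, v' j x) := by
  intro x
  exact HasDerivAt.fun_sum fun j hj => hv j hj x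

theorem PD.congr {n : ℕ} {i : Fin n} {v v' w' : (Fin n → ℝ) → ℝ} (hv : PD i v v')
    (h : ∀ x, v' x = w' x) : PD i v w' := by
  intro x; rw [← h x]; exact hv x

/-- Partial derivative of a smooth function. -/
def d {n : ℕ} (i : Fin n) (v : (Fin n → ℝ) → ℝ) : (Fin n → ℝ) → ℝ :=
  fun x => fderiv ℝ v x (Pi.single i 1)

theorem PD_d {n : ℕ} (i : Fin n) {v : (Fin n → ℝ) → ℝ} (hv : Differentiable ℝ v) :
    PD i v (d i v) := by
  intro x
  have h1 : HasFDerivAt v (fderiv ℝ v (Function.update x i (x i))) (Function.update x i (x i)) :=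
    (hv _).hasFDerivAt
  have h2 := hasDerivAt_update x i (x i)
  have := h1.comp_hasDerivAt (x i) h2
  rw [Function.update_eq_self] at this
  exact this

theorem PD.unique {n : ℕ} {i : Fin n} {v v' w' : (Fin n → ℝ) → ℝ} (hv : PD i v v')
    (hw : PD i v w') : v' = w' := by
  funext x
  exact (hv x).unique (hw x)

theorem PD.hasLineDerivAt {n : ℕ} {i : Fin n} {v v' : (Fin n → ℝ) → ℝ} (hv : PD i v v') (x : Fin n → ℝ) :
    HasLineDerivAt ℝ v (v' x) x (Pi.single i 1) := by
  unfold HasLineDerivAt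
  have h := hv x
  have h0 : HasDerivAt (fun t : ℝ => x i + t) 1 0 := by
    simpa using (hasDerivAt_id (0:ℝ)).const_add (x i)
  have h' : HasDerivAt (fun s : ℝ => v (Function.update x i s)) (v' x) (x i + 0) := by simpa using h
  have := HasDerivAt.comp (0:ℝ) h' h0
  rw [mul_one] at this
  refine this.congr_of_eventuallyEq (Eventually.of_forall fun t => ?_)
  simp only [Function.comp]
  congr 1
  funext j
  by_cases hj : j = i
  · subst hj; simp
  · simp [hj]

theorem contDiff_d {n : ℕ} (i : Fin n) {v : (Fin n → ℝ) → ℝ} (hv : ContDiff ℝ ((⊤ : ℕ∞) : WithTop ℕ∞) v) :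
    ContDiff ℝ ((⊤ : ℕ∞) : WithTop ℕ∞) (d i v) := by
  unfold d
  exact (hv.fderiv_right (m := ((⊤ : ℕ∞) : WithTop ℕ∞)) (by simp)).clm_apply contDiff_const

theorem d_comm {n : ℕ} (i j : Fin n) {v : (Fin n → ℝ) → ℝ} (hv : ContDiff ℝ ((⊤ : ℕ∞) : WithTop ℕ∞) v) :
    d i (d j v) = d j (d i v) := by
  funext x
  have hs : IsSymmSndFDerivAt ℝ v x := by
    apply ContDiffAt.isSymmSndFDerivAt (n := ((⊤ : ℕ∞) : WithTop ℕ∞)) hv.contDiffAt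
    simp
    exact WithTop.coe_le_coe.mpr le_top
  have hd : DifferentiableAt ℝ (fderiv ℝ v) x :=
    ((hv.fderiv_right (m := ((⊤ : ℕ∞) : WithTop ℕ∞)) (by simp)).differentiable (by simp)) x
  have key : ∀ k l : Fin n, d k (d l v) x = fderiv ℝ (fderiv ℝ v) x (Pi.single k 1) (Pi.single l 1) := by
    intro k l
    unfold d
    rw [fderiv_clm_apply hd (by fun_prop)]
    simp
  rw [key, key]
  exact hs _ _

theorem PD.eq_zero_of_nmem {n : ℕ} {i : Fin n} {v v' : (Fin n → ℝ) → ℝ} (hv : PD i v v')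
    {x : Fin n → ℝ} (hx : x ∉ tsupport v) : v' x = 0 := by
  have h1 : v =ᶠ[𝓝 x] fun _ => (0:ℝ) := notMem_tsupport_iff_eventuallyEq.mp hx
  have hc : Tendsto (fun s : ℝ => Function.update x i s) (𝓝 (x i)) (𝓝 x) := by
    have : Continuous (fun s : ℝ => Function.update x i s) := by fun_prop
    have := this.tendsto (x i)
    rwa [Function.update_eq_self] at this
  have h2 := hc.eventually h1
  exact (hv x).unique ((hasDerivAt_const (x i) (0:ℝ)).congr_of_eventuallyEq h2)

theorem PD.tsupport_subset {n : ℕ} {i : Fin n} {v v' : (Fin n → ℝ) → ℝ} (hv : PD i v v') :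
    tsupport v' ⊆ tsupport v := by
  refine closure_minimal (fun y (hy : v' y ≠ 0) => ?_) (isClosed_tsupport v)
  by_contra h
  exact hy (hv.eq_zero_of_nmem h)

theorem PD.hasCompactSupport {n : ℕ} {i : Fin n} {v v' : (Fin n → ℝ) → ℝ} (hv : PD i v v')
    (hc : HasCompactSupport v) : HasCompactSupport v' :=
  hc.mono' (fun _ hx => by_contra fun h => hx (hv.eq_zero_of_nmem h))

/-- Integral of a partial derivative vanishes. -/
theorem PD.integral_eq_zero {n : ℕ} {i : Fin n} {v v' : (Fin n → ℝ) → ℝ} (hv : PD i v v')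
    (hc : HasCompactSupport v) (h1 : Continuous v) (h2 : Continuous v') : ∫ x, v' x = 0 := by
  have hi1 := h1.integrable_of_hasCompactSupport hc (μ := volume)
  have hi2 := h2.integrable_of_hasCompactSupport (hv.hasCompactSupport hc) (μ := volume)
  have := integral_bilinear_hasLineDerivAt_right_eq_neg_left_of_integrable (μ := volume)
    (f := fun _ : Fin n → ℝ => (1:ℝ)) (f' := fun _ => 0) (g := v) (g' := v') (v := Pi.single i 1)
    (B := ContinuousLinearMap.mul ℝ ℝ) (by simp) (by simpa using hi2) (by simpa using hi1)
    (fun x _ => hasDerivAt_const _ _)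
    (fun x _ => hv.hasLineDerivAt x)
  simpa using this

end
end LV

namespace LV
noncomputable section
open MeasureTheory Topology

/-- The integrand of the Bochner-type inequality. -/
def EX (N s a La D S L q : ℝ) : ℝ :=
  (-s ^ 2 * ((N - 1) / N) - s) * a * q ^ 2 + s * (2 / N + 1) * a * q * L
    - (N - 1) / N * a * L ^ 2 - S * La / 2 - L * D + s * q * D

theorem trace_ineq {n : ℕ} (m : Fin n → Fin n → ℝ) :
    (∑ i, m i i) ^ 2 ≤ (n : ℝ) * ∑ j, ∑ i, m i j ^ 2 := by
  have h1 : (∑ i, m i i) ^ 2 ≤ (n : ℝ) * ∑ i, m i i ^ 2 := by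
    have := sq_sum_le_card_mul_sum_sq (s := (Finset.univ : Finset (Fin n))) (f := fun i => m i i)
    simpa using this
  refine h1.trans ?_
  gcongr with j _
  exact Finset.single_le_sum (f := fun i => m i j ^ 2) (fun i _ => sq_nonneg _) (Finset.mem_univ j)

theorem algebra_point {n : ℕ} (hn : 1 ≤ n) (s a c : ℝ) (ha : 0 ≤ a) (aj ajj p lap : Fin n → ℝ)
    (h t : Fin n → Fin n → ℝ)
    (ht : ∑ j, ∑ i, p i * t i j = ∑ j, p j * lap j) :
    EX n s a (∑ j, ajj j) (∑ j, aj j * p j) (∑ j, p j ^ 2) (∑ j, h j j) ((∑ j, p j ^ 2) * c) ≤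
    ∑ j, (a * (∑ i, h i j ^ 2) + a * (∑ i, p i * t i j) - aj j * p j * (∑ j, h j j)
      - a * h j j * (∑ j, h j j) - a * (p j * lap j) - ajj j * (∑ j, p j ^ 2) / 2
      + s * c * (aj j * p j * (∑ j, p j ^ 2) + a * h j j * (∑ j, p j ^ 2)
        + 2 * a * (∑ i, h i j * p i * p j)) - s * a * p j ^ 2 * (∑ j, p j ^ 2) * c ^ 2) := by
  have hN : (0:ℝ) < n := by exact_mod_cast hn
  set L := ∑ j, h j j with hL
  set S := ∑ j, p j ^ 2 with hS
  set D := ∑ j, aj j * p j with hD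
  set La := ∑ j, ajj j with hLa
  have key := trace_ineq (fun i j => h i j + s * c * (p i * p j))
  have e1 : ∑ i, (h i i + s * c * (p i * p i)) = L + s * c * S := by
    rw [Finset.sum_add_distrib, ← Finset.mul_sum]
    simp only [hL, hS, sq]
  have e2 : ∑ j, ∑ i, (h i j + s * c * (p i * p j)) ^ 2 =
      (∑ j, ∑ i, h i j ^ 2) + 2 * (s * c) * (∑ j, ∑ i, h i j * p i * p j) + (s * c) ^ 2 * S ^ 2 := by
    have : S ^ 2 = ∑ j, ∑ i, p i ^ 2 * p j ^ 2 := by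
      rw [sq, hS, Finset.sum_mul_sum]
      rw [Finset.sum_comm]
    rw [this]
    simp only [Finset.mul_sum, ← Finset.sum_add_distrib]
    refine Finset.sum_congr rfl fun j _ => Finset.sum_congr rfl fun i _ => ?_
    ring
  rw [e1, e2] at key
  set Q := ∑ j, ∑ i, h i j ^ 2 with hQ
  set M := ∑ j, ∑ i, h i j * p i * p j with hM
  have e3 : ∑ j, (a * (∑ i, h i j ^ 2) + a * (∑ i, p i * t i j) - aj j * p j * L
      - a * h j j * L - a * (p j * lap j) - ajj j * S / 2
      + s * c * (aj j * p j * S + a * h j j * S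
        + 2 * a * (∑ i, h i j * p i * p j)) - s * a * p j ^ 2 * S * c ^ 2)
      = a * Q - D * L - a * L * L - La * S / 2 + s * c * (D * S + a * L * S + 2 * a * M)
        - s * a * S * S * c ^ 2 := by
    have : a * Q - D * L - a * L * L - La * S / 2 + s * c * (D * S + a * L * S + 2 * a * M)
        - s * a * S * S * c ^ 2 =
        a * Q + a * (∑ j, ∑ i, p i * t i j) - D * L - a * L * L - a * (∑ j, p j * lap j)
        - La * S / 2 + s * c * (D * S + a * L * S + 2 * a * M)
        - s * a * S * S * c ^ 2 := by rw [ht]; ring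
    rw [this]
    have c1 : D * L = ∑ j, aj j * p j * L := by rw [hD, Finset.sum_mul]
    have c2 : a * L * L = ∑ j, a * h j j * L := by
      rw [← Finset.sum_mul, ← Finset.mul_sum]
    have c3 : La * S / 2 = ∑ j, ajj j * S / 2 := by rw [hLa, Finset.sum_mul, Finset.sum_div]
    have c4 : s * c * (D * S + a * L * S + 2 * a * M) = ∑ j, s * c * (aj j * p j * S + a * h j j * S
        + 2 * a * (∑ i, h i j * p i * p j)) := by
      rw [← Finset.mul_sum, Finset.sum_add_distrib, Finset.sum_add_distrib, ← Finset.mul_sum,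
        ← Finset.sum_mul, ← Finset.sum_mul, ← Finset.mul_sum]
    have c5 : s * a * S * S * c ^ 2 = ∑ j, s * a * p j ^ 2 * S * c ^ 2 := by
      rw [← Finset.sum_mul, ← Finset.sum_mul, ← Finset.mul_sum]
    rw [c1, c2, c3, c4, c5]
    simp only [Finset.sum_add_distrib, Finset.sum_sub_distrib, Finset.mul_sum, hQ]
  rw [e3]
  unfold EX
  have key2 : 0 ≤ a * ((Q + 2 * (s * c) * M + (s * c) ^ 2 * S ^ 2) - (L + s * c * S) ^ 2 / n) := by
    apply mul_nonneg ha
    rw [sub_nonneg, div_le_iff₀ hN]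
    linarith
  have : (a * Q - D * L - a * L * L - La * S / 2 + s * c * (D * S + a * L * S + 2 * a * M)
        - s * a * S * S * c ^ 2) - ((-s ^ 2 * (((n:ℝ) - 1) / n) - s) * a * (S * c) ^ 2 + s * (2 / n + 1) * a * (S * c) * L
    - ((n:ℝ) - 1) / n * a * L ^ 2 - S * La / 2 - L * D + s * (S * c) * D) =
    a * ((Q + 2 * (s * c) * M + (s * c) ^ 2 * S ^ 2) - (L + s * c * S) ^ 2 / n) := by
    field_simp
    ring
  linarith

theorem smooth_bochner {n : ℕ} (hn : 1 ≤ n) (s : ℝ) {v a : (Fin n → ℝ) → ℝ}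
    (hv : ContDiff ℝ ((⊤ : ℕ∞) : WithTop ℕ∞) v) (hpos : ∀ x, 0 < v x)
    (ha : ContDiff ℝ ((⊤ : ℕ∞) : WithTop ℕ∞) a) (ha0 : ∀ x, 0 ≤ a x) (hac : HasCompactSupport a) :
    ∫ x, EX n s (a x) (∑ j, d j (d j a) x) (∑ j, d j a x * d j v x) (∑ j, d j v x ^ 2)
      (∑ j, d j (d j v) x) ((∑ j, d j v x ^ 2) * (v x)⁻¹) ≤ 0 := by
  have df : ∀ {g : (Fin n → ℝ) → ℝ}, ContDiff ℝ ((⊤ : ℕ∞) : WithTop ℕ∞) g → Differentiable ℝ g :=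
    fun h => h.differentiable (by simp)
  have cd : ∀ {g : (Fin n → ℝ) → ℝ}, ContDiff ℝ ((⊤ : ℕ∞) : WithTop ℕ∞) g → ∀ i, Continuous (d i g) :=
    fun h i => (contDiff_d i h).continuous
  have hv1 : ∀ i, ContDiff ℝ ((⊤ : ℕ∞) : WithTop ℕ∞) (d i v) := fun i => contDiff_d i hv
  have hv2 : ∀ i j, ContDiff ℝ ((⊤ : ℕ∞) : WithTop ℕ∞) (d j (d i v)) := fun i j => contDiff_d j (hv1 i)
  have ha1 : ∀ i, ContDiff ℝ ((⊤ : ℕ∞) : WithTop ℕ∞) (d i a) := fun i => contDiff_d i ha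
  -- PD facts
  have P0 : ∀ j, PD j v (d j v) := fun j => PD_d j (df hv)
  have P1 : ∀ i j, PD j (d i v) (d j (d i v)) := fun i j => PD_d j (df (hv1 i))
  have P2 : ∀ i k j, PD j (d k (d i v)) (d j (d k (d i v))) := fun i k j => PD_d j (df (hv2 i k))
  have A0 : ∀ j, PD j a (d j a) := fun j => PD_d j (df ha)
  have A1 : ∀ i j, PD j (d i a) (d j (d i a)) := fun i j => PD_d j (df (ha1 i))
  have Pinv : ∀ j, PD j (fun x => (v x)⁻¹) (fun x => -((v x) ^ 2)⁻¹ * d j v x) := fun j =>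
    (P0 j).comp (g := fun y => y⁻¹) (g' := fun y => -(y ^ 2)⁻¹) (fun x => hasDerivAt_inv (hpos x).ne')
  have PS : ∀ j, PD j (fun x => ∑ i, d i v x ^ 2) (fun x => ∑ i, 2 * (d i v x * d j (d i v) x)) := by
    intro j
    apply PD.sum
    intro i _
    exact (((P1 i j).mul (P1 i j)).congr (w' := fun x => 2 * (d i v x * d j (d i v) x))
      (fun x => by ring)) |> fun h => by simpa only [sq] using h
  have PL : ∀ j, PD j (fun x => ∑ i, d i (d i v) x) (fun x => ∑ i, d j (d i (d i v)) x) := by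
    intro j
    exact PD.sum _ fun i _ => P2 i i j
  -- the vector field
  let W : Fin n → (Fin n → ℝ) → ℝ := fun j x => a x * (∑ i, d i v x * d j (d i v) x)
    - a x * (d j v x * (∑ i, d i (d i v) x)) - (1/2) * (d j a x * (∑ i, d i v x ^ 2))
    + s * (a x * (d j v x * ((∑ i, d i v x ^ 2) * (v x)⁻¹)))
  let W' : Fin n → (Fin n → ℝ) → ℝ := fun j x =>
    (a x * (∑ i, d j (d i v) x ^ 2) + a x * (∑ i, d i v x * d j (d j (d i v)) x) - d j a x * d j v x * (∑ j, d j (d j v) x)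
      - a x * d j (d j v) x * (∑ j, d j (d j v) x) - a x * (d j v x * (∑ i, d j (d i (d i v)) x)) - d j (d j a) x * (∑ j, d j v x ^ 2) / 2
      + s * (v x)⁻¹ * (d j a x * d j v x * (∑ j, d j v x ^ 2) + a x * d j (d j v) x * (∑ j, d j v x ^ 2)
        + 2 * a x * (∑ i, d j (d i v) x * d i v x * d j v x)) - s * a x * d j v x ^ 2 * (∑ j, d j v x ^ 2) * ((v x)⁻¹) ^ 2)
  have hW : ∀ j, PD j (W j) (W' j) := by
    intro j
    have q1 : PD j (fun x => ∑ i, d i v x * d j (d i v) x)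
        (fun x => ∑ i, (d j (d i v) x * d j (d i v) x + d i v x * d j (d j (d i v)) x)) :=
      PD.sum _ fun i _ => (P1 i j).mul (P2 i j j)
    have r1 := (A0 j).mul q1
    have r2 := (A0 j).mul ((P1 j j).mul (PL j))
    have r3 := ((A1 j j).mul (PS j)).const_mul (1/2)
    have r4 := ((A0 j).mul ((P1 j j).mul ((PS j).mul (Pinv j)))).const_mul s
    refine (((r1.sub r2).sub r3).add r4).congr fun x => ?_
    simp only [W']
    simp only [Finset.sum_add_distrib, ← Finset.mul_sum]
    have z1 : ∑ i, d j (d i v) x * d i v x * d j v x = (∑ i, d i v x * d j (d i v) x) * d j v x := by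
      rw [Finset.sum_mul]; exact Finset.sum_congr rfl fun i _ => by ring
    have z2 : ∑ i, d j (d i v) x * d j (d i v) x = ∑ i, d j (d i v) x ^ 2 :=
      Finset.sum_congr rfl fun i _ => by ring
    rw [z1, z2, inv_pow]
    ring
  have hc0 : ∀ i, Continuous (d i v) := fun i => cd hv i
  have hc1 : ∀ i j, Continuous (d j (d i v)) := fun i j => cd (hv1 i) j
  have hc2 : ∀ i j k, Continuous (d k (d j (d i v))) := fun i j k => cd (hv2 i j) k
  have hca : Continuous a := ha.continuous
  have hca0 : ∀ i, Continuous (d i a) := fun i => cd ha i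
  have hca1 : ∀ i j, Continuous (d j (d i a)) := fun i j => cd (ha1 i) j
  have hcv : Continuous (fun x => (v x)⁻¹) := hv.continuous.inv₀ fun x => (hpos x).ne'
  have hWc : ∀ j, Continuous (W j) := fun j => by
    simp only [W]; fun_prop
  have hWc' : ∀ j, Continuous (W' j) := fun j => by
    simp only [W']; fun_prop
  have hWs : ∀ j, HasCompactSupport (W j) := by
    intro j
    refine hac.mono' fun x hx => ?_
    by_contra h
    apply hx
    have h1 := image_eq_zero_of_notMem_tsupport h
    have h2 := (A0 j).eq_zero_of_nmem h
    simp [W, h1, h2]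
  have hWi : ∀ j, Integrable (W' j) := fun j =>
    (hWc' j).integrable_of_hasCompactSupport ((hW j).hasCompactSupport (hWs j))
  have hsum : ∫ x, ∑ j, W' j x = 0 := by
    rw [integral_finsetSum _ fun j _ => hWi j]
    exact Finset.sum_eq_zero fun j _ => (hW j).integral_eq_zero (hWs j) (hWc j) (hWc' j)
  rw [← hsum]
  apply integral_mono
  · apply Continuous.integrable_of_hasCompactSupport
    · unfold EX; fun_prop
    · refine hac.mono' fun x hx => ?_
      by_contra h
      apply hx
      have h1 := image_eq_zero_of_notMem_tsupport h
      have h2 := fun j => (A0 j).eq_zero_of_nmem h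
      have h3 : ∀ j, d j (d j a) x = 0 := fun j => (A1 j j).eq_zero_of_nmem
        fun h' => h ((A0 j).tsupport_subset h')
      simp [EX, h1, h2, h3]
  · exact integrable_finsetSum _ fun j _ => hWi j
  · intro x
    refine algebra_point hn s (a x) (v x)⁻¹ (ha0 x) (fun j => d j a x) (fun j => d j (d j a) x)
      (fun j => d j v x) (fun j => ∑ i, d j (d i (d i v)) x) (fun i j => d j (d i v) x)
      (fun i j => d j (d j (d i v)) x) ?_
    simp only [Finset.mul_sum]
    rw [Finset.sum_comm]
    refine Finset.sum_congr rfl fun i _ => Finset.sum_congr rfl fun j _ => ?_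
    rw [d_comm j i hv, d_comm j i (hv1 j)]

end
end LV

open scoped Convolution

namespace LV
noncomputable section
open MeasureTheory Topology

local notation "CInf" => ((⊤ : ℕ∞) : WithTop ℕ∞)

theorem EX_zero (N s S L q : ℝ) : EX N s 0 0 0 S L q = 0 := by simp [EX]

/-- Mollification. -/
def mol {n : ℕ} (φ : ContDiffBump (0 : Fin n → ℝ)) (v : (Fin n → ℝ) → ℝ) : (Fin n → ℝ) → ℝ :=
  φ.normed volume ⋆[ContinuousLinearMap.lsmul ℝ ℝ, volume] v

theorem mol_apply {n : ℕ} (φ : ContDiffBump (0 : Fin n → ℝ)) (v : (Fin n → ℝ) → ℝ) (x : Fin n → ℝ) :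
    mol φ v x = ∫ t, φ.normed volume t * v (x - t) := by
  simp [mol, convolution_def]

theorem mol_contDiff {n : ℕ} (φ : ContDiffBump (0 : Fin n → ℝ)) {v : (Fin n → ℝ) → ℝ} (hv : Continuous v) :
    ContDiff ℝ CInf (mol φ v) :=
  HasCompactSupport.contDiff_convolution_left _ φ.hasCompactSupport_normed φ.contDiff_normed
    hv.locallyIntegrable

theorem mol_PD {n : ℕ} (φ : ContDiffBump (0 : Fin n → ℝ)) {v v' : (Fin n → ℝ) → ℝ} {i : Fin n}
    (hv : Continuous v) (hv' : Continuous v') (h : PD i v v') : PD i (mol φ v) (mol φ v') := by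
  intro x
  have hφc : Continuous (φ.normed (volume : Measure (Fin n → ℝ))) := φ.continuous_normed
  have hφs : HasCompactSupport (φ.normed (volume : Measure (Fin n → ℝ))) := φ.hasCompactSupport_normed
  have hfun : (fun s => mol φ v (Function.update x i s)) =
      fun s => ∫ t, φ.normed volume t * v (Function.update x i s - t) := by
    funext s; rw [mol_apply]
  have hval : mol φ v' x = ∫ t, φ.normed volume t * v' (Function.update x i (x i) - t) := by
    rw [mol_apply, Function.update_eq_self]
  rw [hfun, hval]
  obtain ⟨C, hC⟩ : ∃ C, ∀ z ∈ (Metric.closedBall (x i) 1) ×ˢ tsupport (φ.normed (volume : Measure (Fin n → ℝ))),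
      ‖v' (Function.update x i z.1 - z.2)‖ ≤ C := by
    apply ((isCompact_closedBall (x i) 1).prod hφs).exists_bound_of_continuousOn
    apply Continuous.continuousOn
    fun_prop
  have int1 : ∀ (g : (Fin n → ℝ) → ℝ), Continuous g → ∀ s : ℝ,
      Integrable (fun t => φ.normed volume t * g (Function.update x i s - t)) := by
    intro g hg s
    apply Continuous.integrable_of_hasCompactSupport
    · fun_prop
    · exact hφs.mul_right
  refine (hasDerivAt_integral_of_dominated_loc_of_deriv_le (μ := volume)
    (F := fun s t => φ.normed volume t * v (Function.update x i s - t))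
    (F' := fun s t => φ.normed volume t * v' (Function.update x i s - t))
    (bound := fun t => φ.normed volume t * C)
    (Metric.ball_mem_nhds (x i) one_pos) ?_ ?_ ?_ ?_ ?_ ?_).2
  · exact Eventually.of_forall fun s => (int1 v hv s).aestronglyMeasurable
  · exact int1 v hv _
  · exact (int1 v' hv' _).aestronglyMeasurable
  · refine Eventually.of_forall fun t s hs => ?_
    rw [norm_mul, Real.norm_of_nonneg (φ.nonneg_normed t)]
    by_cases ht : t ∈ tsupport (φ.normed (volume : Measure (Fin n → ℝ)))
    · exact mul_le_mul_of_nonneg_left (hC (s, t) ⟨Metric.ball_subset_closedBall hs, ht⟩) (φ.nonneg_normed t)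
    · simp [image_eq_zero_of_notMem_tsupport ht]
  · exact (hφc.integrable_of_hasCompactSupport hφs).mul_const C
  · refine Eventually.of_forall fun t s _ => ?_
    apply HasDerivAt.const_mul
    have h1 := h (Function.update x i s - t)
    have h2 : HasDerivAt (fun r : ℝ => r - t i) 1 s := (hasDerivAt_id s).sub_const _
    have h3 : (Function.update x i s - t) i = s - t i := by simp
    rw [h3] at h1
    have h4 := HasDerivAt.comp s h1 h2
    rw [mul_one] at h4
    refine h4.congr_of_eventuallyEq (Eventually.of_forall fun r => ?_)
    simp only [Function.comp]
    congr 1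
    funext j
    by_cases hj : j = i
    · subst hj; simp
    · simp [hj]

theorem mol_nonneg {n : ℕ} (φ : ContDiffBump (0 : Fin n → ℝ)) {v : (Fin n → ℝ) → ℝ} (hv : ∀ x, 0 ≤ v x)
    (x : Fin n → ℝ) : 0 ≤ mol φ v x := by
  rw [mol_apply]
  exact integral_nonneg fun t => mul_nonneg (φ.nonneg_normed t) (hv _)

theorem mol_bound {n : ℕ} {v : (Fin n → ℝ) → ℝ} (hv : Continuous v) {K : Set (Fin n → ℝ)} (hK : IsCompact K) :
    ∃ C, ∀ φ : ContDiffBump (0 : Fin n → ℝ), φ.rOut ≤ 1 → ∀ x ∈ K, |mol φ v x| ≤ C := by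
  obtain ⟨C, hC⟩ := (hK.cthickening (r := 1)).exists_bound_of_continuousOn hv.continuousOn
  have hC' : ∀ x ∈ K, ∀ y ∈ Metric.closedBall x 1, |v y| ≤ C := fun x hx y hy =>
    hC y (Metric.closedBall_subset_cthickening hx 1 hy)
  refine ⟨3 * C, fun φ hφ x hx => ?_⟩
  have h0 := hC' x hx x (Metric.mem_closedBall_self zero_le_one)
  have := φ.dist_normed_convolution_le (μ := volume) (g := v) (x₀ := x) (ε := 2 * C)
    hv.aestronglyMeasurable (fun y hy => by
      have h1 := hC' x hx y (Metric.ball_subset_closedBall (Metric.ball_subset_ball hφ hy))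
      rw [Real.dist_eq]
      have := abs_sub (v y) (v x)
      linarith)
  rw [Real.dist_eq] at this
  change |mol φ v x - v x| ≤ 2 * C at this
  have h2 := abs_add_le (mol φ v x - v x) (v x)
  rw [sub_add_cancel] at h2
  linarith

theorem slice_bochner_delta {n : ℕ} (hn : 1 ≤ n) (s : ℝ) {v a : (Fin n → ℝ) → ℝ} {p h : Fin n → (Fin n → ℝ) → ℝ}
    (hv : Continuous v) (hp : ∀ i, Continuous (p i)) (hh : ∀ i, Continuous (h i))
    (hvp : ∀ i, PD i v (p i)) (hph : ∀ i, PD i (p i) (h i)) (hpos : ∀ x, 0 ≤ v x)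
    (ha : ContDiff ℝ CInf a) (ha0 : ∀ x, 0 ≤ a x) (hac : HasCompactSupport a) {δ : ℝ} (hδ : 0 < δ) :
    ∫ x, EX n s (a x) (∑ j, d j (d j a) x) (∑ j, d j a x * p j x) (∑ j, p j x ^ 2)
      (∑ j, h j x) ((∑ j, p j x ^ 2) * (v x + δ)⁻¹) ≤ 0 := by
  let φ : ℕ → ContDiffBump (0 : Fin n → ℝ) := fun m =>
    { rIn := 1 / (2 * ((m:ℝ) + 1)), rOut := 1 / ((m:ℝ) + 1)
      rIn_pos := by positivity
      rIn_lt_rOut := by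
        apply one_div_lt_one_div_of_lt <;> linarith [(Nat.cast_nonneg m : (0:ℝ) ≤ m)] }
  have hφ1 : ∀ m, (φ m).rOut ≤ 1 := fun m => by
    change 1 / ((m:ℝ) + 1) ≤ 1
    rw [div_le_one (by positivity)]
    linarith [(Nat.cast_nonneg m : (0:ℝ) ≤ m)]
  have hφ0 : Tendsto (fun m => (φ m).rOut) atTop (𝓝 0) := tendsto_one_div_add_atTop_nhds_zero_nat
  have hlim : ∀ {g : (Fin n → ℝ) → ℝ}, Continuous g → ∀ x, Tendsto (fun m => mol (φ m) g x) atTop (𝓝 (g x)) :=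
    fun hg x => ContDiffBump.convolution_tendsto_right_of_continuous hφ0 hg x
  have A0 : ∀ j, PD j a (d j a) := fun j => PD_d j (ha.differentiable (by simp))
  have A1 : ∀ i j, PD j (d i a) (d j (d i a)) := fun i j =>
    PD_d j ((contDiff_d i ha).differentiable (by simp))
  have ca0 : ∀ j, Continuous (d j a) := fun j => (contDiff_d j ha).continuous
  have ca1 : ∀ j, Continuous (d j (d j a)) := fun j => (contDiff_d j (contDiff_d j ha)).continuous
  have ca := ha.continuous
  -- derivatives of the mollified function
  have hd1 : ∀ m j, d j (fun x => mol (φ m) v x + δ) = mol (φ m) (p j) := by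
    intro m j
    have h1 := (mol_PD (φ m) hv (hp j) (hvp j)).add_const δ
    exact (PD_d j (((mol_contDiff (φ m) hv).add contDiff_const).differentiable (by simp))).unique h1
  have hd2 : ∀ m j, d j (mol (φ m) (p j)) = mol (φ m) (h j) := by
    intro m j
    exact (PD_d j ((mol_contDiff (φ m) (hp j)).differentiable (by simp))).unique
      (mol_PD (φ m) (hp j) (hh j) (hph j))
  let Ψ : (Fin n → ℝ) × ℝ × (Fin n → ℝ) × (Fin n → ℝ) → ℝ := fun z =>
    EX n s (a z.1) (∑ j, d j (d j a) z.1) (∑ j, d j a z.1 * z.2.2.1 j) (∑ j, z.2.2.1 j ^ 2)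
      (∑ j, z.2.2.2 j) ((∑ j, z.2.2.1 j ^ 2) * (|z.2.1| + δ)⁻¹)
  have hΨ : Continuous Ψ := by
    have : Continuous fun z : (Fin n → ℝ) × ℝ × (Fin n → ℝ) × (Fin n → ℝ) => (|z.2.1| + δ)⁻¹ := by
      apply Continuous.inv₀ (by fun_prop)
      intro z
      have := abs_nonneg z.2.1
      linarith
    simp only [Ψ]; unfold EX; fun_prop
  have key : ∀ m, ∫ x, Ψ (x, mol (φ m) v x, (fun j => mol (φ m) (p j) x), (fun j => mol (φ m) (h j) x)) ≤ 0 := by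
    intro m
    have := smooth_bochner hn s (v := fun x => mol (φ m) v x + δ) ((mol_contDiff (φ m) hv).add contDiff_const)
      (fun x => by have := mol_nonneg (φ m) hpos x; linarith) ha ha0 hac
    simp only [hd1, hd2] at this
    simpa only [Ψ, abs_of_nonneg (mol_nonneg (φ m) hpos _)] using this
  have hgoal : ∫ x, EX n s (a x) (∑ j, d j (d j a) x) (∑ j, d j a x * p j x) (∑ j, p j x ^ 2)
      (∑ j, h j x) ((∑ j, p j x ^ 2) * (v x + δ)⁻¹) =
      ∫ x, Ψ (x, v x, (fun j => p j x), (fun j => h j x)) := by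
    simp only [Ψ, abs_of_nonneg (hpos _)]
  rw [hgoal]
  have hK : IsCompact (tsupport a) := hac
  obtain ⟨Cv, hCv⟩ := mol_bound hv hK
  choose Cp hCp using fun j => mol_bound (hp j) hK
  choose Ch hCh using fun j => mol_bound (hh j) hK
  obtain ⟨M, hM⟩ := (hK.prod ((isCompact_Icc (a := -Cv) (b := Cv)).prod
    ((isCompact_univ_pi (fun j => isCompact_Icc (a := -Cp j) (b := Cp j))).prod
    (isCompact_univ_pi (fun j => isCompact_Icc (a := -Ch j) (b := Ch j)))))).exists_bound_of_continuousOn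
    hΨ.continuousOn
  refine le_of_tendsto (x := atTop) (tendsto_integral_of_dominated_convergence (μ := volume)
    (F := fun m x => Ψ (x, mol (φ m) v x, (fun j => mol (φ m) (p j) x), (fun j => mol (φ m) (h j) x)))
    ((tsupport a).indicator fun _ => M) ?_ ?_ ?_ ?_) (Eventually.of_forall key)
  · intro m
    apply Continuous.aestronglyMeasurable
    have c1 : Continuous (mol (φ m) v) := (mol_contDiff (φ m) hv).continuous
    have c2 : ∀ j, Continuous (mol (φ m) (p j)) := fun j => (mol_contDiff (φ m) (hp j)).continuous
    have c3 : ∀ j, Continuous (mol (φ m) (h j)) := fun j => (mol_contDiff (φ m) (hh j)).continuous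
    exact hΨ.comp (by fun_prop)
  · rw [integrable_indicator_iff (isClosed_tsupport a).measurableSet]
    exact integrableOn_const hK.measure_lt_top.ne
  · intro m
    refine Eventually.of_forall fun x => ?_
    by_cases hx : x ∈ tsupport a
    · rw [indicator_of_mem hx]
      refine hM _ ⟨hx, ?_, ?_, ?_⟩
      · exact abs_le.mp (hCv _ (hφ1 m) x hx)
      · exact fun j _ => abs_le.mp (hCp j _ (hφ1 m) x hx)
      · exact fun j _ => abs_le.mp (hCh j _ (hφ1 m) x hx)
    · rw [indicator_of_notMem hx]
      have h1 := image_eq_zero_of_notMem_tsupport hx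
      have h2 := fun j => (A0 j).eq_zero_of_nmem hx
      have h3 : ∀ j, d j (d j a) x = 0 := fun j => (A1 j j).eq_zero_of_nmem
        fun h' => hx ((A0 j).tsupport_subset h')
      simp [Ψ, h1, h2, h3, EX_zero]
  · refine Eventually.of_forall fun x => ?_
    refine (hΨ.tendsto (x, v x, (fun j => p j x), (fun j => h j x))).comp ?_
    refine tendsto_const_nhds.prodMk_nhds ((hlim hv x).prodMk_nhds (Tendsto.prodMk_nhds ?_ ?_))
    · exact tendsto_pi_nhds.mpr fun j => hlim (hp j) x
    · exact tendsto_pi_nhds.mpr fun j => hlim (hh j) x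

end
end LV

namespace LV
noncomputable section
open MeasureTheory Topology

local notation "CInf" => ((⊤ : ℕ∞) : WithTop ℕ∞)

theorem grad_bound_one {g g' g'' : ℝ → ℝ} {s0 M : ℝ} (hM : 0 < M) (hg : ∀ s, 0 ≤ g s)
    (h1 : ∀ s, HasDerivAt g (g' s) s) (h2 : ∀ s, HasDerivAt g' (g'' s) s)
    (hb1 : |g' s0| ≤ M) (hb2 : ∀ s ∈ Icc (s0 - 1) (s0 + 1), |g'' s| ≤ M) :
    g' s0 ^ 2 ≤ 4 * M * g s0 := by
  set h := -(g' s0) / (2 * M) with hh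
  have hh1 : |h| ≤ 1 := by
    rw [hh, abs_div, abs_neg, abs_of_pos (by positivity : 0 < 2 * M), div_le_one (by positivity)]
    linarith
  have hseg : ∀ s ∈ Icc (s0 - |h|) (s0 + |h|), |g' s - g' s0| ≤ M * |h| := by
    intro s hs
    have hsub : Icc (s0 - |h|) (s0 + |h|) ⊆ Icc (s0 - 1) (s0 + 1) :=
      Icc_subset_Icc (by linarith) (by linarith)
    have := (convex_Icc (s0 - |h|) (s0 + |h|)).norm_image_sub_le_of_norm_hasDerivWithin_le
      (f := g') (f' := g'') (C := M) (fun x _ => (h2 x).hasDerivWithinAt) (fun x hx => hb2 x (hsub hx))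
      (x := s0) (y := s) ⟨by linarith [abs_nonneg h], by linarith [abs_nonneg h]⟩ hs
    refine this.trans ?_
    gcongr
    rw [Real.norm_eq_abs, abs_le]
    constructor <;> linarith [hs.1, hs.2]
  have := (convex_Icc (s0 - |h|) (s0 + |h|)).norm_image_sub_le_of_norm_hasDerivWithin_le
      (f := fun s => g s - g' s0 * s) (f' := fun s => g' s - g' s0) (C := M * |h|)
      (fun x _ => by simpa using ((h1 x).fun_sub ((hasDerivAt_id' x).const_mul (g' s0))).hasDerivWithinAt) hseg
      (x := s0) (y := s0 + h) ⟨by linarith [abs_nonneg h], by linarith [abs_nonneg h]⟩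
      ⟨by linarith [neg_abs_le h], by linarith [le_abs_self h]⟩
  have e : s0 + h - s0 = h := by ring
  rw [e, Real.norm_eq_abs, Real.norm_eq_abs, mul_assoc, abs_mul_abs_self] at this
  have h3 := (abs_le.mp this).2
  have h4 := hg (s0 + h)
  have h5 : 0 ≤ g s0 + g' s0 * h + M * (h * h) := by nlinarith
  have h6 : g s0 + g' s0 * h + M * (h * h) = g s0 - g' s0 ^ 2 / (4 * M) := by
    rw [hh]; field_simp; ring
  rw [h6] at h5
  have h7 : g' s0 ^ 2 / (4 * M) ≤ g s0 := by linarith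
  rw [div_le_iff₀ (by positivity)] at h7
  linarith

theorem PD.slice {n : ℕ} {i : Fin n} {v v' : (Fin n → ℝ) → ℝ} (h : PD i v v') (x : Fin n → ℝ) (s : ℝ) :
    HasDerivAt (fun r => v (Function.update x i r)) (v' (Function.update x i s)) s := by
  have := h (Function.update x i s)
  simpa using this

theorem grad_bound_pt {n : ℕ} {i : Fin n} {v p h : (Fin n → ℝ) → ℝ} (hvp : PD i v p) (hph : PD i p h)
    (hpos : ∀ x, 0 ≤ v x) {M : ℝ} (hM : 0 < M) {x : Fin n → ℝ}
    (hb1 : |p x| ≤ M) (hb2 : ∀ y ∈ Metric.closedBall x 1, |h y| ≤ M) : p x ^ 2 ≤ 4 * M * v x := by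
  have := grad_bound_one (g := fun r => v (Function.update x i r)) (g' := fun r => p (Function.update x i r))
    (g'' := fun r => h (Function.update x i r)) (s0 := x i) hM (fun s => hpos _)
    (fun s => hvp.slice x s) (fun s => hph.slice x s) (by simpa using hb1) (by
      intro s hs
      apply hb2
      rw [Metric.mem_closedBall, dist_pi_le_iff zero_le_one]
      intro j
      by_cases hj : j = i
      · subst hj
        simp only [Function.update_self, Real.dist_eq]
        rw [abs_le]; constructor <;> linarith [hs.1, hs.2]
      · simp [hj])
  simpa using this

theorem grad_bound_slice {n : ℕ} {v : (Fin n → ℝ) → ℝ} {p h : Fin n → (Fin n → ℝ) → ℝ}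
    (hp : ∀ i, Continuous (p i)) (hh : ∀ i, Continuous (h i))
    (hvp : ∀ i, PD i v (p i)) (hph : ∀ i, PD i (p i) (h i)) (hpos : ∀ x, 0 ≤ v x)
    {K : Set (Fin n → ℝ)} (hK : IsCompact K) :
    ∃ C, 0 ≤ C ∧ ∀ x ∈ K, ∑ j, p j x ^ 2 ≤ C * v x := by
  have hK' : IsCompact (Metric.cthickening 1 K) := hK.cthickening
  choose M1 hM1 using fun j => hK'.exists_bound_of_continuousOn (hp j).continuousOn
  choose M2 hM2 using fun j => hK'.exists_bound_of_continuousOn (hh j).continuousOn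
  refine ⟨∑ j, 4 * (|M1 j| + |M2 j| + 1), by positivity, fun x hx => ?_⟩
  rw [Finset.sum_mul]
  refine Finset.sum_le_sum fun j _ => ?_
  refine grad_bound_pt (hvp j) (hph j) hpos (by positivity) ?_ ?_
  · have := hM1 j x (Metric.closedBall_subset_cthickening hx 1 (Metric.mem_closedBall_self zero_le_one))
    rw [Real.norm_eq_abs] at this
    linarith [le_abs_self (M1 j), abs_nonneg (M2 j)]
  · intro y hy
    have := hM2 j y (Metric.closedBall_subset_cthickening hx 1 hy)
    rw [Real.norm_eq_abs] at this
    linarith [le_abs_self (M2 j), abs_nonneg (M1 j)]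

theorem limit_lemma {n : ℕ} {Φ : (Fin n → ℝ) × ℝ × ℝ → ℝ} (hΦ : Continuous Φ) {K : Set (Fin n → ℝ)}
    (hK : IsCompact K) (hΦ0 : ∀ x ∉ K, ∀ z, Φ (x, z) = 0) {q g : (Fin n → ℝ) → ℝ}
    {qm gm : ℕ → (Fin n → ℝ) → ℝ} (hqm : ∀ m, Continuous (qm m)) (hgm : ∀ m, Continuous (gm m))
    {C : ℝ} (hqC : ∀ m, ∀ x ∈ K, |qm m x| ≤ C) (hgC : ∀ m, ∀ x ∈ K, |gm m x| ≤ C)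
    (hq : ∀ x ∈ K, Tendsto (fun m => qm m x) atTop (𝓝 (q x)))
    (hg : ∀ x ∈ K, Tendsto (fun m => gm m x) atTop (𝓝 (g x)))
    (hle : ∀ m, ∫ x, Φ (x, qm m x, gm m x) ≤ 0) : ∫ x, Φ (x, q x, g x) ≤ 0 := by
  obtain ⟨M, hM⟩ := (hK.prod ((isCompact_Icc (a := -C) (b := C)).prod
    (isCompact_Icc (a := -C) (b := C)))).exists_bound_of_continuousOn hΦ.continuousOn
  refine le_of_tendsto (x := atTop) (tendsto_integral_of_dominated_convergence (μ := volume)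
    (F := fun m x => Φ (x, qm m x, gm m x))
    (K.indicator fun _ => M) ?_ ?_ ?_ ?_) (Eventually.of_forall hle)
  · intro m
    exact (hΦ.comp (continuous_id.prodMk ((hqm m).prodMk (hgm m)))).aestronglyMeasurable
  · rw [integrable_indicator_iff hK.isClosed.measurableSet]
    exact integrableOn_const hK.measure_lt_top.ne
  · intro m
    refine Eventually.of_forall fun x => ?_
    by_cases hx : x ∈ K
    · rw [indicator_of_mem hx]
      exact hM _ ⟨hx, abs_le.mp (hqC m x hx), abs_le.mp (hgC m x hx)⟩
    · rw [indicator_of_notMem hx, hΦ0 x hx, norm_zero]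
  · refine Eventually.of_forall fun x => ?_
    by_cases hx : x ∈ K
    · exact (hΦ.tendsto (x, q x, g x)).comp
        (tendsto_const_nhds.prodMk_nhds ((hq x hx).prodMk_nhds (hg x hx)))
    · simp only [hΦ0 x hx]; exact tendsto_const_nhds

theorem q_tendsto {S v : ℝ} (h0 : v = 0 → S = 0) :
    Tendsto (fun m : ℕ => S * (v + 1 / ((m:ℝ) + 1))⁻¹) atTop (𝓝 (S * v⁻¹)) := by
  by_cases hv : v = 0
  · simp [h0 hv]
  · apply Tendsto.const_mul
    apply Tendsto.inv₀ _ hv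
    simpa using (tendsto_const_nhds (x := v)).add (tendsto_one_div_add_atTop_nhds_zero_nat (𝕜 := ℝ))

theorem q_bound {S v C δ : ℝ} (hS : 0 ≤ S) (hv : 0 ≤ v) (hδ : 0 < δ) (h : S ≤ C * v) (hC : 0 ≤ C) :
    |S * (v + δ)⁻¹| ≤ C := by
  rw [abs_of_nonneg (by positivity), ← div_eq_mul_inv, div_le_iff₀ (by positivity)]
  nlinarith

theorem slice_bochner {n : ℕ} (hn : 1 ≤ n) (s : ℝ) {v a : (Fin n → ℝ) → ℝ} {p h : Fin n → (Fin n → ℝ) → ℝ}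
    (hv : Continuous v) (hp : ∀ i, Continuous (p i)) (hh : ∀ i, Continuous (h i))
    (hvp : ∀ i, PD i v (p i)) (hph : ∀ i, PD i (p i) (h i)) (hpos : ∀ x, 0 ≤ v x)
    (ha : ContDiff ℝ CInf a) (ha0 : ∀ x, 0 ≤ a x) (hac : HasCompactSupport a) :
    ∫ x, EX n s (a x) (∑ j, d j (d j a) x) (∑ j, d j a x * p j x) (∑ j, p j x ^ 2)
      (∑ j, h j x) ((∑ j, p j x ^ 2) * (v x)⁻¹) ≤ 0 := by
  have A0 : ∀ j, PD j a (d j a) := fun j => PD_d j (ha.differentiable (by simp))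
  have A1 : ∀ i j, PD j (d i a) (d j (d i a)) := fun i j =>
    PD_d j ((contDiff_d i ha).differentiable (by simp))
  have ca0 : ∀ j, Continuous (d j a) := fun j => (contDiff_d j ha).continuous
  have ca1 : ∀ j, Continuous (d j (d j a)) := fun j => (contDiff_d j (contDiff_d j ha)).continuous
  have ca := ha.continuous
  obtain ⟨C, hC0, hC⟩ := grad_bound_slice hp hh hvp hph hpos (K := tsupport a) hac
  refine limit_lemma (K := tsupport a) (C := C) (g := fun _ => 0) (gm := fun _ _ => 0)
    (Φ := fun z => EX n s (a z.1) (∑ j, d j (d j a) z.1) (∑ j, d j a z.1 * p j z.1) (∑ j, p j z.1 ^ 2)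
      (∑ j, h j z.1) z.2.1)
    (q := fun x => (∑ j, p j x ^ 2) * (v x)⁻¹)
    (qm := fun m x => (∑ j, p j x ^ 2) * (v x + 1 / ((m:ℝ) + 1))⁻¹)
    ?_ hac ?_ ?_ ?_ ?_ ?_ ?_ ?_ ?_
  · unfold EX; fun_prop
  · intro x hx z
    have h1 := image_eq_zero_of_notMem_tsupport hx
    have h2 := fun j => (A0 j).eq_zero_of_nmem hx
    have h3 : ∀ j, d j (d j a) x = 0 := fun j => (A1 j j).eq_zero_of_nmem
      fun h' => hx ((A0 j).tsupport_subset h')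
    simp [h1, h2, h3, EX_zero]
  · intro m
    apply Continuous.mul (by fun_prop)
    apply Continuous.inv₀ (by fun_prop)
    intro x
    have := hpos x
    positivity
  · fun_prop
  · intro m x hx
    exact q_bound (by positivity) (hpos x) (by positivity) (hC x hx) hC0
  · simp [hC0]
  · intro x hx
    apply q_tendsto
    intro h0
    have := hC x hx
    rw [h0, mul_zero] at this
    exact le_antisymm this (by positivity)
  · intro x hx; exact tendsto_const_nhds
  · intro m
    exact slice_bochner_delta hn s hv hp hh hvp hph hpos ha ha0 hac (by positivity)

/-- Multiplicative average of `f`. -/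
def avg (f : ℝ → ℝ) (ε w : ℝ) : ℝ := (∫ r in w..((1 + ε) * w), f r) / (ε * w)

def avg' (f : ℝ → ℝ) (ε w : ℝ) : ℝ := ((1 + ε) * f ((1 + ε) * w) - f w) / (ε * w) - avg f ε w / w

theorem avg_hasDerivAt {f : ℝ → ℝ} (hf : Continuous f) {ε w : ℝ} (hε : 0 < ε) (hw : 0 < w) :
    HasDerivAt (avg f ε) (avg' f ε w) w := by
  have hF : ∀ s, HasDerivAt (fun s => ∫ r in (0:ℝ)..s, f r) (f s) s := fun s =>
    intervalIntegral.integral_hasDerivAt_right (hf.intervalIntegrable _ _)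
      (hf.stronglyMeasurableAtFilter _ _) hf.continuousAt
  have e : ∀ w, ∫ r in w..((1 + ε) * w), f r = (∫ r in (0:ℝ)..((1 + ε) * w), f r) - ∫ r in (0:ℝ)..w, f r :=
    fun w => (intervalIntegral.integral_interval_sub_left (hf.intervalIntegrable _ _)
      (hf.intervalIntegrable _ _)).symm
  have h1 : HasDerivAt (fun w => ∫ r in w..((1 + ε) * w), f r) ((1 + ε) * f ((1 + ε) * w) - f w) w := by
    simp only [e]
    have h2 : HasDerivAt (fun w : ℝ => (1 + ε) * w) (1 + ε) w := by
      simpa using (hasDerivAt_id w).const_mul (1 + ε)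
    have h3 := HasDerivAt.comp w (hF ((1 + ε) * w)) h2
    have h4 := h3.sub (hF w)
    rw [mul_comm (f _)] at h4
    exact h4
  have h5 : HasDerivAt (fun w : ℝ => ε * w) ε w := by simpa using (hasDerivAt_id w).const_mul ε
  have h6 := h1.div h5 (by positivity)
  refine (h6.congr_deriv ?_)
  unfold avg' avg
  field_simp

theorem avg_mvt {f : ℝ → ℝ} (hf : Continuous f) {ε w : ℝ} (hε : 0 < ε) (hw : 0 < w) :
    ∃ ξ ∈ Icc w ((1 + ε) * w), avg f ε w = f ξ := by
  have hF : ∀ s, HasDerivAt (fun s => ∫ r in w..s, f r) (f s) s := fun s =>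
    intervalIntegral.integral_hasDerivAt_right (hf.intervalIntegrable _ _)
      (hf.stronglyMeasurableAtFilter _ _) hf.continuousAt
  have hlt : w < (1 + ε) * w := by nlinarith
  obtain ⟨ξ, hξ, h⟩ := exists_hasDerivAt_eq_slope (fun s => ∫ r in w..s, f r) f hlt
    (fun s _ => (hF s).continuousAt.continuousWithinAt) (fun s _ => hF s)
  refine ⟨ξ, Ioo_subset_Icc_self hξ, ?_⟩
  rw [h, intervalIntegral.integral_same, sub_zero, avg]
  congr 1
  ring

theorem avg_eq {f : ℝ → ℝ} {ε w : ℝ} (hw : 0 < w) :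
    avg f ε w = (∫ l in (1:ℝ)..(1 + ε), f (l * w)) / ε := by
  rw [intervalIntegral.integral_comp_mul_right (fun x => f x) hw.ne', avg, one_mul, smul_eq_mul]
  by_cases hε : ε = 0
  · simp [hε]
  field_simp

theorem avg_antitone {f : ℝ → ℝ} (hf : Continuous f) {p : ℝ}
    (hA : AntitoneOn (fun s : ℝ => f s / s ^ p) (Ioi 0)) {ε : ℝ} (hε : 0 < ε) :
    AntitoneOn (fun w => avg f ε w * w ^ (-p)) (Ioi 0) := by
  intro w1 hw1 w2 hw2 h12
  have hw1' : 0 < w1 := hw1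
  have hw2' : 0 < w2 := hw2
  simp only [avg_eq hw1', avg_eq hw2']
  rw [div_mul_eq_mul_div, div_mul_eq_mul_div]
  refine div_le_div_of_nonneg_right ?_ hε.le
  rw [← intervalIntegral.integral_mul_const, ← intervalIntegral.integral_mul_const]
  apply intervalIntegral.integral_mono_on (by linarith)
  · exact (Continuous.intervalIntegrable (by fun_prop) _ _)
  · exact (Continuous.intervalIntegrable (by fun_prop) _ _)
  · intro l hl
    have hl0 : 0 < l := by linarith [hl.1]
    have := hA (show l * w1 ∈ Ioi 0 from mul_pos hl0 hw1') (show l * w2 ∈ Ioi 0 from mul_pos hl0 hw2')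
      (mul_le_mul_of_nonneg_left h12 hl0.le)
    simp only [Real.mul_rpow hl0.le hw1'.le, Real.mul_rpow hl0.le hw2'.le] at this
    rw [Real.rpow_neg hw1'.le, Real.rpow_neg hw2'.le]
    have hlp : 0 < l ^ p := Real.rpow_pos_of_pos hl0 p
    have a1 := mul_le_mul_of_nonneg_right this hlp.le
    have b1 : ∀ w : ℝ, 0 < w → f (l * w) / (l ^ p * w ^ p) * l ^ p = f (l * w) * (w ^ p)⁻¹ := by
      intro w hw
      have := Real.rpow_pos_of_pos hw p
      field_simp
    rwa [b1 _ hw1', b1 _ hw2'] at a1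

theorem avg_deriv_le {f : ℝ → ℝ} (hf : Continuous f) {p : ℝ}
    (hA : AntitoneOn (fun s : ℝ => f s / s ^ p) (Ioi 0)) {ε w : ℝ} (hε : 0 < ε) (hw : 0 < w) :
    avg' f ε w ≤ p * (avg f ε w * w⁻¹) := by
  have h1 := (avg_hasDerivAt hf hε hw).mul (Real.hasDerivAt_rpow_const (p := -p) (Or.inl hw.ne'))
  have h2 : derivWithin (fun w => avg f ε w * w ^ (-p)) (Ioi 0) w ≤ 0 :=
    (avg_antitone hf hA hε).derivWithin_nonpos
  have h3 : HasDerivWithinAt (fun w => avg f ε w * w ^ (-p)) _ (Ioi 0) w := h1.hasDerivWithinAt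
  rw [h3.derivWithin (isOpen_Ioi.uniqueDiffWithinAt hw)] at h2
  have hwp : 0 < w ^ (-p) := Real.rpow_pos_of_pos hw _
  rw [Real.rpow_sub_one hw.ne'] at h2
  have h4 : (avg' f ε w - p * (avg f ε w * w⁻¹)) * w ^ (-p) ≤ 0 := by
    refine le_of_eq_of_le ?_ h2
    field_simp
    ring
  have h5 := nonpos_of_mul_nonpos_left h4 hwp
  linarith

theorem slice_f {n : ℕ} {v a : (Fin n → ℝ) → ℝ} {p h : Fin n → (Fin n → ℝ) → ℝ}
    (hv : Continuous v) (hp : ∀ i, Continuous (p i)) (hh : ∀ i, Continuous (h i))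
    (hvp : ∀ i, PD i v (p i)) (hph : ∀ i, PD i (p i) (h i)) (hpos : ∀ x, 0 ≤ v x)
    (ha : ContDiff ℝ CInf a) (ha0 : ∀ x, 0 ≤ a x) (hac : HasCompactSupport a)
    {f : ℝ → ℝ} (hf : Continuous f) {e : ℝ}
    (hA : AntitoneOn (fun s : ℝ => f s / s ^ e) (Ioi 0)) :
    ∫ x, (-(a x * f (v x) * ∑ j, h j x) - e * (a x * f (v x) * ((∑ j, p j x ^ 2) * (v x)⁻¹))
      - f (v x) * ∑ j, d j a x * p j x) ≤ 0 := by
  have A0 : ∀ j, PD j a (d j a) := fun j => PD_d j (ha.differentiable (by simp))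
  have ca0 : ∀ j, Continuous (d j a) := fun j => (contDiff_d j ha).continuous
  have ca := ha.continuous
  have hac' : IsCompact (tsupport a) := hac
  obtain ⟨C, hC0, hC⟩ := grad_bound_slice hp hh hvp hph hpos (K := tsupport a) hac
  obtain ⟨V, hV⟩ := hac'.exists_bound_of_continuousOn hv.continuousOn
  obtain ⟨B, hB⟩ := (isCompact_Icc (a := (0:ℝ)) (b := 2 * (|V| + 1))).exists_bound_of_continuousOn hf.continuousOn
  have ep : ∀ m : ℕ, (0:ℝ) < 1 / ((m:ℝ) + 1) := fun m => by positivity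
  have ep1 : ∀ m : ℕ, 1 / ((m:ℝ) + 1) ≤ 1 := fun m => by
    rw [div_le_one (by positivity)]
    linarith [(Nat.cast_nonneg m : (0:ℝ) ≤ m)]
  have wpos : ∀ (m : ℕ) x, 0 < v x + 1 / ((m:ℝ) + 1) := fun m x => by linarith [hpos x, ep m]
  have cavg : ∀ m : ℕ, Continuous fun x => avg f (1 / ((m:ℝ) + 1)) (v x + 1 / ((m:ℝ) + 1)) := by
    intro m
    rw [continuous_iff_continuousAt]
    intro x
    exact ContinuousAt.comp (f := fun x => v x + 1 / ((m:ℝ) + 1))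
      (avg_hasDerivAt hf (ep m) (wpos m x)).continuousAt (by fun_prop)
  have cinv : ∀ m : ℕ, Continuous fun x => (v x + 1 / ((m:ℝ) + 1))⁻¹ := fun m =>
    Continuous.inv₀ (by fun_prop) fun x => (wpos m x).ne'
  refine limit_lemma (K := tsupport a) (C := C + B)
    (Φ := fun z => (-(a z.1 * z.2.2 * ∑ j, h j z.1) - e * (a z.1 * z.2.2 * z.2.1)
      - z.2.2 * ∑ j, d j a z.1 * p j z.1))
    (q := fun x => (∑ j, p j x ^ 2) * (v x)⁻¹)
    (qm := fun m x => (∑ j, p j x ^ 2) * (v x + 1 / ((m:ℝ) + 1))⁻¹)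
    (g := fun x => f (v x)) (gm := fun m x => avg f (1 / ((m:ℝ) + 1)) (v x + 1 / ((m:ℝ) + 1)))
    ?_ hac ?_ ?_ ?_ ?_ ?_ ?_ ?_ ?_
  · fun_prop
  · intro x hx z
    have h1 := image_eq_zero_of_notMem_tsupport hx
    have h2 := fun j => (A0 j).eq_zero_of_nmem hx
    simp [h1, h2]
  · intro m
    exact Continuous.mul (by fun_prop) (cinv m)
  · exact cavg
  · intro m x hx
    have hB0 : 0 ≤ B := (norm_nonneg _).trans (hB 0 ⟨le_rfl, by positivity⟩)
    have := q_bound (by positivity) (hpos x) (ep m) (hC x hx) hC0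
    linarith
  · intro m x hx
    obtain ⟨ξ, hξ, h1⟩ := avg_mvt hf (ep m) (wpos m x)
    simp only [h1]
    have : |f ξ| ≤ B := by
      apply hB
      have h2 := hV x hx
      rw [Real.norm_of_nonneg (hpos x)] at h2
      refine ⟨(wpos m x).le.trans hξ.1, hξ.2.trans ?_⟩
      apply mul_le_mul (by linarith [ep1 m]) _ (wpos m x).le (by norm_num)
      linarith [le_abs_self V, ep1 m]
    linarith
  · intro x hx
    apply q_tendsto
    intro h0
    have := hC x hx
    rw [h0, mul_zero] at this
    exact le_antisymm this (by positivity)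
  · intro x hx
    choose ξ hξ h1 using fun m : ℕ => avg_mvt hf (ep m) (wpos m x)
    simp only [h1]
    refine (hf.tendsto (v x)).comp ?_
    have l0 := tendsto_one_div_add_atTop_nhds_zero_nat (𝕜 := ℝ)
    have l1 : Tendsto (fun m : ℕ => v x + 1 / ((m:ℝ) + 1)) atTop (𝓝 (v x)) := by
      simpa using (tendsto_const_nhds (x := v x)).add l0
    have l2 : Tendsto (fun m : ℕ => (1 + 1 / ((m:ℝ) + 1)) * (v x + 1 / ((m:ℝ) + 1))) atTop (𝓝 (v x)) := by
      simpa using ((tendsto_const_nhds (x := (1:ℝ))).add l0).mul l1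
    exact tendsto_of_tendsto_of_tendsto_of_le_of_le l1 l2 (fun m => (hξ m).1) (fun m => (hξ m).2)
  · intro m
    set ε := 1 / ((m:ℝ) + 1) with hε
    have cavg' : Continuous fun x => avg' f ε (v x + ε) := by
      unfold avg'
      apply Continuous.sub
      · apply Continuous.div (by fun_prop) (by fun_prop)
        intro x
        exact (mul_pos (ep m) (wpos m x)).ne'
      · exact (cavg m).div (by fun_prop) fun x => (wpos m x).ne'
    have cavgm := cavg m
    rw [← hε] at cavgm
    have key : ∀ j, PD j (fun x => a x * (avg f ε (v x + ε) * p j x))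
        (fun x => d j a x * (avg f ε (v x + ε) * p j x) + a x * (avg' f ε (v x + ε) * p j x * p j x
          + avg f ε (v x + ε) * h j x)) := by
      intro j
      refine (A0 j).mul (PD.mul ?_ (hph j))
      exact ((hvp j).add_const ε).comp (g := avg f ε) (g' := avg' f ε)
        (fun x => avg_hasDerivAt hf (ep m) (wpos m x))
    have cs : ∀ j, HasCompactSupport (fun x => a x * (avg f ε (v x + ε) * p j x)) := fun j => hac.mul_right
    have c1 : ∀ j, Continuous (fun x => a x * (avg f ε (v x + ε) * p j x)) := fun j => by fun_prop
    have c2 : ∀ j, Continuous (fun x => d j a x * (avg f ε (v x + ε) * p j x) + a x * (avg' f ε (v x + ε) * p j x * p j x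
          + avg f ε (v x + ε) * h j x)) := fun j => by fun_prop
    have i2 := fun j => (c2 j).integrable_of_hasCompactSupport ((key j).hasCompactSupport (cs j)) (μ := volume)
    have hz : ∫ x, -∑ j, (d j a x * (avg f ε (v x + ε) * p j x) + a x * (avg' f ε (v x + ε) * p j x * p j x
          + avg f ε (v x + ε) * h j x)) = 0 := by
      rw [integral_neg, integral_finsetSum _ fun j _ => i2 j, neg_eq_zero]
      exact Finset.sum_eq_zero fun j _ => (key j).integral_eq_zero (cs j) (c1 j) (c2 j)
    rw [← hz]
    apply integral_mono
    · apply Continuous.integrable_of_hasCompactSupport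
      · have := cinv m
        rw [← hε] at this
        fun_prop
      · refine hac.mono' fun x hx => ?_
        by_contra h'
        apply hx
        have h1 := image_eq_zero_of_notMem_tsupport h'
        have h2 := fun j => (A0 j).eq_zero_of_nmem h'
        simp [h1, h2]
    · exact (integrable_finsetSum _ fun j _ => i2 j).neg
    · intro x
      have hd := avg_deriv_le hf hA (ep m) (wpos m x)
      rw [← hε] at hd
      simp only
      have e1 : ∑ j, (d j a x * (avg f ε (v x + ε) * p j x) + a x * (avg' f ε (v x + ε) * p j x * p j x
          + avg f ε (v x + ε) * h j x)) = avg f ε (v x + ε) * (∑ j, d j a x * p j x) +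
          a x * avg' f ε (v x + ε) * (∑ j, p j x ^ 2) + a x * avg f ε (v x + ε) * (∑ j, h j x) := by
        simp only [Finset.mul_sum, ← Finset.sum_add_distrib]
        exact Finset.sum_congr rfl fun j _ => by ring
      rw [e1]
      have hS : 0 ≤ ∑ j, p j x ^ 2 := by positivity
      have := mul_le_mul_of_nonneg_left hd (mul_nonneg (ha0 x) hS)
      nlinarith

end
end LV

namespace LV
noncomputable section
open MeasureTheory Topology

local notation "CInf" => ((⊤ : ℕ∞) : WithTop ℕ∞)

/-- Space-time data of an entire nonnegative classical solution. -/
structure Sol (n : ℕ) (f : ℝ → ℝ) where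
  u : (Fin n → ℝ) × ℝ → ℝ
  ut : (Fin n → ℝ) × ℝ → ℝ
  p : Fin n → (Fin n → ℝ) × ℝ → ℝ
  h : Fin n → (Fin n → ℝ) × ℝ → ℝ
  cu : Continuous u
  cut : Continuous ut
  cp : ∀ i, Continuous (p i)
  ch : ∀ i, Continuous (h i)
  dt : ∀ x t, HasDerivAt (fun t => u (x, t)) (ut (x, t)) t
  dp : ∀ i t, PD i (fun x => u (x, t)) (fun x => p i (x, t))
  dh : ∀ i t, PD i (fun x => p i (x, t)) (fun x => h i (x, t))
  pos : ∀ z, 0 ≤ u z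
  cf : Continuous f
  eq : ∀ z, ut z = ∑ i, h i z + f (u z)

namespace Sol
variable {n : ℕ} {f : ℝ → ℝ} (U : Sol n f)

def S (z : (Fin n → ℝ) × ℝ) : ℝ := ∑ j, U.p j z ^ 2
def L (z : (Fin n → ℝ) × ℝ) : ℝ := ∑ j, U.h j z
def q (z : (Fin n → ℝ) × ℝ) : ℝ := U.S z * (U.u z)⁻¹
def D (a : (Fin n → ℝ) → ℝ) (z : (Fin n → ℝ) × ℝ) : ℝ := ∑ j, d j a z.1 * U.p j z
def F (f : ℝ → ℝ) (s : ℝ) : ℝ := ∫ r in (0:ℝ)..s, f r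

theorem cS : Continuous U.S := by
  have := U.cp
  unfold S; fun_prop

theorem cL : Continuous U.L := by
  have := U.ch
  unfold L; fun_prop

theorem cD {a : (Fin n → ℝ) → ℝ} (ha : ContDiff ℝ CInf a) : Continuous (U.D a) := by
  have ca0 : ∀ j, Continuous (d j a) := fun j => (contDiff_d j ha).continuous
  have := U.cp
  unfold D; fun_prop

theorem S_nonneg (z : (Fin n → ℝ) × ℝ) : 0 ≤ U.S z := by unfold S; positivity

theorem q_nonneg (z : (Fin n → ℝ) × ℝ) : 0 ≤ U.q z := mul_nonneg (U.S_nonneg z) (inv_nonneg.mpr (U.pos z))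

theorem grad_bound {K : Set ((Fin n → ℝ) × ℝ)} (hK : IsCompact K) :
    ∃ C, 0 ≤ C ∧ ∀ z ∈ K, U.S z ≤ C * U.u z := by
  have hK' : IsCompact (Metric.cthickening 1 K) := hK.cthickening
  choose M1 hM1 using fun j => hK'.exists_bound_of_continuousOn (U.cp j).continuousOn
  choose M2 hM2 using fun j => hK'.exists_bound_of_continuousOn (U.ch j).continuousOn
  refine ⟨∑ j, 4 * (|M1 j| + |M2 j| + 1), by positivity, fun z hz => ?_⟩
  rw [Finset.sum_mul]
  refine Finset.sum_le_sum fun j _ => ?_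
  obtain ⟨x, t⟩ := z
  refine grad_bound_pt (U.dp j t) (U.dh j t) (fun x => U.pos (x, t)) (by positivity) ?_ ?_
  · have := hM1 j (x, t) (Metric.closedBall_subset_cthickening hz 1 (Metric.mem_closedBall_self zero_le_one))
    rw [Real.norm_eq_abs] at this
    linarith [le_abs_self (M1 j), abs_nonneg (M2 j)]
  · intro y hy
    have hy' : (y, t) ∈ Metric.closedBall (x, t) 1 := by
      rw [Metric.mem_closedBall] at hy ⊢
      rw [Prod.dist_eq]
      simpa using hy
    have := hM2 j (y, t) (Metric.closedBall_subset_cthickening hz 1 hy')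
    rw [Real.norm_eq_abs] at this
    linarith [le_abs_self (M2 j), abs_nonneg (M1 j)]

theorem S_eq_zero {z : (Fin n → ℝ) × ℝ} (hz : U.u z = 0) : U.S z = 0 := by
  obtain ⟨C, _, h⟩ := U.grad_bound (isCompact_singleton (x := z))
  have := h z rfl
  rw [hz, mul_zero] at this
  exact le_antisymm this (U.S_nonneg z)

theorem q_mul_u (z : (Fin n → ℝ) × ℝ) : U.q z * U.u z = U.S z := by
  unfold q
  by_cases h : U.u z = 0
  · rw [h, U.S_eq_zero h]; simp
  · field_simp

theorem q_bounded {K : Set ((Fin n → ℝ) × ℝ)} (hK : IsCompact K) :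
    ∃ C, ∀ z ∈ K, |U.q z| ≤ C := by
  obtain ⟨C, hC0, h⟩ := U.grad_bound hK
  refine ⟨C, fun z hz => ?_⟩
  rw [abs_of_nonneg (U.q_nonneg z)]
  by_cases h0 : U.u z = 0
  · simpa [q, h0] using hC0
  · have hp : 0 < U.u z := lt_of_le_of_ne (U.pos z) (Ne.symm h0)
    unfold q
    rw [← div_eq_mul_inv, div_le_iff₀ hp]
    exact h z hz

theorem mq : Measurable U.q := U.cS.measurable.mul U.cu.measurable.inv

theorem int_q {Φ : ((Fin n → ℝ) × ℝ) × ℝ → ℝ} (hΦ : Continuous Φ) {K : Set ((Fin n → ℝ) × ℝ)}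
    (hK : IsCompact K) (h0 : ∀ z ∉ K, ∀ r, Φ (z, r) = 0) : Integrable (fun z => Φ (z, U.q z)) := by
  obtain ⟨C, hC⟩ := U.q_bounded hK
  obtain ⟨M, hM⟩ := (hK.prod (isCompact_Icc (a := -C) (b := C))).exists_bound_of_continuousOn hΦ.continuousOn
  refine Integrable.mono' (g := K.indicator fun _ => M) ?_ ?_ ?_
  · rw [integrable_indicator_iff hK.isClosed.measurableSet]
    exact integrableOn_const hK.measure_lt_top.ne
  · exact (hΦ.measurable.comp (measurable_id.prodMk U.mq)).aestronglyMeasurable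
  · refine Eventually.of_forall fun z => ?_
    by_cases hz : z ∈ K
    · rw [indicator_of_mem hz]
      exact hM _ ⟨hz, abs_le.mp (hC z hz)⟩
    · rw [indicator_of_notMem hz, h0 z hz, norm_zero]

end Sol

theorem int_of_zero {n : ℕ} {g : (Fin n → ℝ) × ℝ → ℝ} (hg : Continuous g) {K : Set ((Fin n → ℝ) × ℝ)}
    (hK : IsCompact K) (h0 : ∀ z ∉ K, g z = 0) : Integrable g :=
  hg.integrable_of_hasCompactSupport (HasCompactSupport.intro hK h0)

theorem prod_nonpos {n : ℕ} {g : (Fin n → ℝ) × ℝ → ℝ} (hg : Integrable g)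
    (h : ∀ t, ∫ x, g (x, t) ≤ 0) : ∫ z, g z ≤ 0 := by
  rw [Measure.volume_eq_prod] at hg ⊢
  rw [integral_prod_symm _ hg]
  exact integral_nonpos h

theorem space_zero {n : ℕ} (i : Fin n) {G G' : (Fin n → ℝ) × ℝ → ℝ} (hG : Continuous G) (hG' : Continuous G')
    (hd : ∀ t, PD i (fun x => G (x, t)) (fun x => G' (x, t)))
    {K : Set (Fin n → ℝ)} {J : Set ℝ} (hK : IsCompact K) (hJ : IsCompact J)
    (h0 : ∀ x t, (x ∉ K ∨ t ∉ J) → G (x, t) = 0) : ∫ z, G' z = 0 := by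
  have hc : ∀ t, HasCompactSupport (fun x => G (x, t)) := fun t =>
    HasCompactSupport.intro hK fun x hx => h0 x t (Or.inl hx)
  have hz : ∀ z ∉ K ×ˢ J, G' z = 0 := by
    rintro ⟨x, t⟩ hz
    rw [mem_prod, not_and_or] at hz
    rcases hz with hz | hz
    · refine (hd t).eq_zero_of_nmem (x := x) fun hx => hz ?_
      exact closure_minimal (s := Function.support fun x => G (x, t)) (t := K) (fun y (hy : G (y, t) ≠ 0) => by_contra fun hy' => hy (h0 y t (Or.inl hy'))) hK.isClosed hx
    · refine (hd t).eq_zero_of_nmem (x := x) fun hx => ?_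
      have : (fun x => G (x, t)) = fun _ => 0 := funext fun y => h0 y t (Or.inr hz)
      rw [this] at hx
      simp [tsupport] at hx
  have hi := int_of_zero hG' (hK.prod hJ) hz
  rw [Measure.volume_eq_prod] at hi ⊢
  rw [integral_prod_symm _ hi]
  have : ∀ t, ∫ x, G' (x, t) = 0 := fun t =>
    (hd t).integral_eq_zero (hc t) (by fun_prop) (by fun_prop)
  simp [this]

theorem time_zero {n : ℕ} {G G' : (Fin n → ℝ) × ℝ → ℝ} (hG : Continuous G) (hG' : Continuous G')
    (hd : ∀ x t, HasDerivAt (fun t => G (x, t)) (G' (x, t)) t)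
    {K : Set (Fin n → ℝ)} {J : Set ℝ} (hK : IsCompact K) (hJ : IsCompact J)
    (h0 : ∀ x t, (x ∉ K ∨ t ∉ J) → G (x, t) = 0)
    (h0' : ∀ x t, (x ∉ K ∨ t ∉ J) → G' (x, t) = 0) : ∫ z, G' z = 0 := by
  have hi := int_of_zero hG' (hK.prod hJ) (by
    rintro ⟨x, t⟩ hz
    rw [mem_prod, not_and_or] at hz
    exact h0' x t hz)
  rw [Measure.volume_eq_prod] at hi ⊢
  rw [integral_prod _ hi]
  have : ∀ x, ∫ t, G' (x, t) = 0 := fun x => by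
    apply integral_eq_zero_of_hasDerivAt_of_integrable (f := fun t => G (x, t)) (hd x)
    · exact Continuous.integrable_of_hasCompactSupport (by fun_prop)
        (HasCompactSupport.intro hJ fun t ht => h0' x t (Or.inr ht))
    · exact Continuous.integrable_of_hasCompactSupport (by fun_prop)
        (HasCompactSupport.intro hJ fun t ht => h0 x t (Or.inr ht))
  simp [this]

end
end LV

namespace LV
noncomputable section
open MeasureTheory Topology

local notation "CInf" => ((⊤ : ℕ∞) : WithTop ℕ∞)

/-- A product cutoff `a(x) b(t)`. -/
structure Cut (n : ℕ) where
  a : (Fin n → ℝ) → ℝ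
  b : ℝ → ℝ
  ha : ContDiff ℝ CInf a
  hb : ContDiff ℝ CInf b
  ha0 : ∀ x, 0 ≤ a x
  hb0 : ∀ t, 0 ≤ b t
  hac : HasCompactSupport a
  hbc : HasCompactSupport b

namespace Cut
variable {n : ℕ} (c : Cut n)

def La (x : Fin n → ℝ) : ℝ := ∑ j, d j (d j c.a) x
def b' (t : ℝ) : ℝ := deriv c.b t

theorem ca : Continuous c.a := c.ha.continuous
theorem cb : Continuous c.b := c.hb.continuous
theorem cLa : Continuous c.La := by
  have ca1 : ∀ j, Continuous (d j (d j c.a)) := fun j => (contDiff_d j (contDiff_d j c.ha)).continuous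
  unfold La; fun_prop
theorem cd (j : Fin n) : Continuous (d j c.a) := (contDiff_d j c.ha).continuous
theorem cb' : Continuous c.b' := c.hb.continuous_deriv (by exact_mod_cast le_top)
theorem hbd (t : ℝ) : HasDerivAt c.b (c.b' t) t := ((c.hb.differentiable (by simp)) t).hasDerivAt
theorem hda (j : Fin n) : PD j c.a (d j c.a) := PD_d j (c.ha.differentiable (by simp))
theorem hdda (j : Fin n) : PD j (d j c.a) (d j (d j c.a)) :=
  PD_d j ((contDiff_d j c.ha).differentiable (by simp))
theorem a0 {x : Fin n → ℝ} (hx : x ∉ tsupport c.a) : c.a x = 0 := image_eq_zero_of_notMem_tsupport hx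
theorem b0 {t : ℝ} (ht : t ∉ tsupport c.b) : c.b t = 0 := image_eq_zero_of_notMem_tsupport ht
theorem d0 (j : Fin n) {x : Fin n → ℝ} (hx : x ∉ tsupport c.a) : d j c.a x = 0 :=
  (c.hda j).eq_zero_of_nmem hx
theorem La0 {x : Fin n → ℝ} (hx : x ∉ tsupport c.a) : c.La x = 0 :=
  Finset.sum_eq_zero fun j _ => (c.hdda j).eq_zero_of_nmem fun h' => hx ((c.hda j).tsupport_subset h')
theorem b'0 {t : ℝ} (ht : t ∉ tsupport c.b) : c.b' t = 0 := by
  have h1 : c.b =ᶠ[𝓝 t] fun _ => (0:ℝ) := notMem_tsupport_iff_eventuallyEq.mp ht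
  exact (c.hbd t).unique ((hasDerivAt_const t (0:ℝ)).congr_of_eventuallyEq h1)

def K : Set ((Fin n → ℝ) × ℝ) := tsupport c.a ×ˢ tsupport c.b
theorem cK : IsCompact c.K := IsCompact.prod c.hac c.hbc

end Cut

theorem F_deriv {f : ℝ → ℝ} (hf : Continuous f) (s : ℝ) : HasDerivAt (Sol.F f) (f s) s :=
  intervalIntegral.integral_hasDerivAt_right (hf.intervalIntegrable _ _)
      (hf.stronglyMeasurableAtFilter _ _) hf.continuousAt

theorem cF {f : ℝ → ℝ} (hf : Continuous f) : Continuous (Sol.F f) :=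
  continuous_iff_continuousAt.mpr fun s => (F_deriv hf s).continuousAt

namespace Sol
variable {n : ℕ} {f : ℝ → ℝ} (U : Sol n f) (c : Cut n)

theorem D0 {z : (Fin n → ℝ) × ℝ} (hz : z.1 ∉ tsupport c.a) : U.D c.a z = 0 := by
  unfold D; exact Finset.sum_eq_zero fun j _ => by rw [c.d0 j hz, zero_mul]

def N1 (s : ℝ) (z : (Fin n → ℝ) × ℝ) : ℝ :=
  c.b z.2 * EX n s (c.a z.1) (c.La z.1) (U.D c.a z) (U.S z) (U.L z) (U.q z)

def N2 (e : ℝ) (z : (Fin n → ℝ) × ℝ) : ℝ :=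
  c.b z.2 * (-(c.a z.1 * f (U.u z) * U.L z) - e * (c.a z.1 * f (U.u z) * U.q z) - f (U.u z) * U.D c.a z)

def N3 (z : (Fin n → ℝ) × ℝ) : ℝ := c.b z.2 * (f (U.u z) * U.D c.a z + F f (U.u z) * c.La z.1)

def N4 (z : (Fin n → ℝ) × ℝ) : ℝ := c.a z.1 * (c.b z.2 * (f (U.u z) * U.ut z) + c.b' z.2 * F f (U.u z))

def N5 (z : (Fin n → ℝ) × ℝ) : ℝ :=
  c.b z.2 * (U.ut z * (c.a z.1 * U.L z + U.D c.a z)) - c.a z.1 * c.b' z.2 * U.S z / 2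

def N6 (z : (Fin n → ℝ) × ℝ) : ℝ :=
  c.b z.2 * (c.a z.1 * (U.u z * f (U.u z)) - c.a z.1 * U.S z - U.u z * U.D c.a z)
    + c.a z.1 * c.b' z.2 * U.u z ^ 2 / 2

theorem nK {z : (Fin n → ℝ) × ℝ} (hz : z ∉ c.K) : z.1 ∉ tsupport c.a ∨ z.2 ∉ tsupport c.b := by
  unfold Cut.K at hz
  rwa [mem_prod, not_and_or] at hz

theorem iN1 (s : ℝ) : Integrable (U.N1 c s) := by
  have := U.cS; have := U.cL; have := U.cD c.ha; have := c.ca; have := c.cb; have := c.cLa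
  refine U.int_q (Φ := fun y => c.b y.1.2 * EX n s (c.a y.1.1) (c.La y.1.1) (U.D c.a y.1) (U.S y.1)
    (U.L y.1) y.2) (by unfold EX; fun_prop) c.cK fun z hz r => ?_
  rcases nK c hz with h | h
  · simp [c.a0 h, c.La0 h, U.D0 c h, EX_zero]
  · simp [c.b0 h]

theorem iN2 (e : ℝ) : Integrable (U.N2 c e) := by
  have := U.cL; have := U.cD c.ha; have := c.ca; have := c.cb; have := U.cf; have := U.cu
  refine U.int_q (Φ := fun y => c.b y.1.2 * (-(c.a y.1.1 * f (U.u y.1) * U.L y.1)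
    - e * (c.a y.1.1 * f (U.u y.1) * y.2) - f (U.u y.1) * U.D c.a y.1)) (by fun_prop) c.cK fun z hz r => ?_
  rcases nK c hz with h | h
  · simp [c.a0 h, U.D0 c h]
  · simp [c.b0 h]

theorem N1_le (hn : 1 ≤ n) (s : ℝ) : ∫ z, U.N1 c s z ≤ 0 := by
  refine prod_nonpos (U.iN1 c s) fun t => ?_
  unfold N1
  simp only
  rw [integral_const_mul]
  refine mul_nonpos_of_nonneg_of_nonpos (c.hb0 t) ?_
  have := U.cu; have := U.cp; have := U.ch
  exact slice_bochner hn s (v := fun x => U.u (x, t)) (p := fun i x => U.p i (x, t))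
    (h := fun i x => U.h i (x, t)) (by fun_prop) (by fun_prop) (by fun_prop) (fun i => U.dp i t)
    (fun i => U.dh i t) (fun x => U.pos _) c.ha c.ha0 c.hac

theorem N2_le {e : ℝ} (hA : AntitoneOn (fun s : ℝ => f s / s ^ e) (Ioi 0)) : ∫ z, U.N2 c e z ≤ 0 := by
  refine prod_nonpos (U.iN2 c e) fun t => ?_
  unfold N2
  simp only
  rw [integral_const_mul]
  refine mul_nonpos_of_nonneg_of_nonpos (c.hb0 t) ?_
  have := U.cu; have := U.cp; have := U.ch
  exact slice_f (v := fun x => U.u (x, t)) (p := fun i x => U.p i (x, t))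
    (h := fun i x => U.h i (x, t)) (by fun_prop) (by fun_prop) (by fun_prop) (fun i => U.dp i t)
    (fun i => U.dh i t) (fun x => U.pos _) c.ha c.ha0 c.hac U.cf hA

theorem iN3 : Integrable (U.N3 c) := by
  have := U.cD c.ha; have := c.cLa; have := c.cb; have := U.cf; have := U.cu; have := cF U.cf
  refine int_of_zero (by unfold N3; fun_prop) c.cK fun z hz => ?_
  rcases nK c hz with h | h
  · simp [N3, c.La0 h, U.D0 c h]
  · simp [N3, c.b0 h]

theorem iN4 : Integrable (U.N4 c) := by
  have := c.ca; have := c.cb'; have := c.cb; have := U.cf; have := U.cu; have := cF U.cf; have := U.cut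
  refine int_of_zero (by unfold N4; fun_prop) c.cK fun z hz => ?_
  rcases nK c hz with h | h
  · simp [N4, c.a0 h]
  · simp [N4, c.b0 h, c.b'0 h]

theorem iN5 : Integrable (U.N5 c) := by
  have := c.ca; have := c.cb'; have := c.cb; have := U.cD c.ha; have := U.cu; have := U.cL; have := U.cut
  have := U.cS
  refine int_of_zero (by unfold N5; fun_prop) c.cK fun z hz => ?_
  rcases nK c hz with h | h
  · simp [N5, c.a0 h, U.D0 c h]
  · simp [N5, c.b0 h, c.b'0 h]

theorem iN6 : Integrable (U.N6 c) := by
  have := c.ca; have := c.cb'; have := c.cb; have := U.cD c.ha; have := U.cu; have := U.cf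
  have := U.cS
  refine int_of_zero (by unfold N6; fun_prop) c.cK fun z hz => ?_
  rcases nK c hz with h | h
  · simp [N6, c.a0 h, U.D0 c h]
  · simp [N6, c.b0 h, c.b'0 h]

/-- Integral of a finite sum of functions with vanishing integral. -/
theorem sum_int_zero {m : ℕ} {G : Fin n → (Fin m → ℝ) × ℝ → ℝ} (hi : ∀ j, Integrable (G j))
    (h : ∀ j, ∫ z, G j z = 0) : ∫ z, ∑ j, G j z = 0 := by
  rw [integral_finsetSum _ fun j _ => hi j]
  exact Finset.sum_eq_zero fun j _ => h j

theorem N3_eq : ∫ z, U.N3 c z = 0 := by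
  have := U.cp; have := c.cd; have := c.cb; have := U.cf; have := U.cu; have := cF U.cf
  have cdd : ∀ j, Continuous (d j (d j c.a)) := fun j => (contDiff_d j (contDiff_d j c.ha)).continuous
  have hz : ∀ x t, (x ∉ tsupport c.a ∨ t ∉ tsupport c.b) → ∀ j,
      c.b t * (F f (U.u (x, t)) * d j c.a x) = 0 := by
    rintro x t (h | h) j
    · simp [c.d0 j h]
    · simp [c.b0 h]
  have := sum_int_zero (n := n) (m := n) (G := fun j z => c.b z.2 * (f (U.u z) * U.p j z * d j c.a z.1
      + F f (U.u z) * d j (d j c.a) z.1)) (fun j => by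
      refine int_of_zero (by fun_prop) c.cK fun z hz => ?_
      rcases nK c hz with h | h
      · have : d j (d j c.a) z.1 = 0 :=
          (c.hdda j).eq_zero_of_nmem fun h' => h ((c.hda j).tsupport_subset h')
        simp [c.d0 j h, this]
      · simp [c.b0 h]) (fun j => by
      refine space_zero j (G := fun z => c.b z.2 * (F f (U.u z) * d j c.a z.1)) (by fun_prop) (by fun_prop) ?_
        c.hac c.hbc (fun x t h => hz x t h j)
      intro t
      exact PD.const_mul (c.b t) (PD.mul ((U.dp j t).comp (fun x => F_deriv U.cf _)) (c.hdda j)))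
  rw [← this]
  congr 1
  funext z
  simp only [N3, D, Cut.La, Finset.mul_sum, ← Finset.sum_add_distrib]
  exact Finset.sum_congr rfl fun j _ => by ring

theorem N4_eq : ∫ z, U.N4 c z = 0 := by
  have := c.ca; have := c.cb'; have := c.cb; have := U.cf; have := U.cu; have := cF U.cf; have := U.cut
  refine time_zero (G := fun z => c.a z.1 * (c.b z.2 * F f (U.u z))) (by fun_prop) (by unfold N4; fun_prop) ?_
    c.hac c.hbc ?_ ?_
  · intro x t
    have h1 : HasDerivAt (fun t => F f (U.u (x, t))) (f (U.u (x, t)) * U.ut (x, t)) t :=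
      HasDerivAt.comp (h₂ := F f) (h := fun t => U.u (x, t)) t (F_deriv U.cf (U.u (x, t))) (U.dt x t)
    refine (((c.hbd t).mul h1).const_mul (c.a x)).congr_deriv ?_
    simp only [N4]; ring
  · rintro x t (h | h)
    · simp [c.a0 h]
    · simp [c.b0 h]
  · rintro x t (h | h)
    · simp [N4, c.a0 h]
    · simp [N4, c.b0 h, c.b'0 h]

theorem N6_eq : ∫ z, U.N6 c z = 0 := by
  have := U.cp; have := c.cd; have := c.cb; have := U.cf; have := U.cu; have := cF U.cf; have := U.ch
  have := c.ca; have := c.cb'; have := U.cut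
  have h1 : ∫ z, ∑ j, c.b z.2 * (d j c.a z.1 * (U.u z * U.p j z) + c.a z.1 * (U.p j z * U.p j z
      + U.u z * U.h j z)) = 0 := by
    refine sum_int_zero (n := n) (m := n) (fun j => ?_) (fun j => ?_)
    · refine int_of_zero (by fun_prop) c.cK fun z hz => ?_
      rcases nK c hz with h | h
      · simp [c.d0 j h, c.a0 h]
      · simp [c.b0 h]
    · refine space_zero j (G := fun z => c.b z.2 * (c.a z.1 * (U.u z * U.p j z))) (by fun_prop) (by fun_prop) ?_
        c.hac c.hbc ?_
      · intro t
        exact PD.const_mul (c.b t) ((c.hda j).mul ((U.dp j t).mul (U.dh j t)))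
      · rintro x t (h | h)
        · simp [c.a0 h]
        · simp [c.b0 h]
  have h2 : ∫ z, (c.a z.1 * (c.b z.2 * (U.u z * U.ut z) + c.b' z.2 * U.u z ^ 2 / 2)) = 0 := by
    refine time_zero (G := fun z => c.a z.1 * (c.b z.2 * (U.u z ^ 2 / 2))) (by fun_prop) (by fun_prop) ?_
      c.hac c.hbc ?_ ?_
    · intro x t
      refine (((c.hbd t).mul (((U.dt x t).pow 2).div_const 2)).const_mul (c.a x)).congr_deriv ?_
      simp; left; ring
    · rintro x t (h | h)
      · simp [c.a0 h]
      · simp [c.b0 h]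
    · rintro x t (h | h)
      · simp [c.a0 h]
      · simp [c.b0 h, c.b'0 h]
  have e : ∀ z, U.N6 c z = (c.a z.1 * (c.b z.2 * (U.u z * U.ut z) + c.b' z.2 * U.u z ^ 2 / 2))
    - ∑ j, c.b z.2 * (d j c.a z.1 * (U.u z * U.p j z) + c.a z.1 * (U.p j z * U.p j z
      + U.u z * U.h j z)) := by
    intro z
    have e1 : ∑ j, c.b z.2 * (d j c.a z.1 * (U.u z * U.p j z) + c.a z.1 * (U.p j z * U.p j z
      + U.u z * U.h j z)) = c.b z.2 * (U.u z * U.D c.a z + c.a z.1 * U.S z + c.a z.1 * (U.u z * U.L z)) := by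
      simp only [D, S, L, Finset.mul_sum, ← Finset.sum_add_distrib]
      exact Finset.sum_congr rfl fun j _ => by ring
    rw [e1, N6, U.eq z]
    simp only [L]
    ring
  simp only [e]
  rw [integral_sub, h1, h2, sub_zero]
  · refine int_of_zero (by fun_prop) c.cK fun z hz => ?_
    rcases nK c hz with h | h
    · simp [c.a0 h]
    · simp [c.b0 h, c.b'0 h]
  · refine int_of_zero (by fun_prop) c.cK fun z hz => ?_
    rcases nK c hz with h | h
    · simp [c.d0 _ h, c.a0 h]
    · simp [c.b0 h]

end Sol
end
end LV

namespace LV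
noncomputable section
open MeasureTheory Topology

local notation "CInf" => ((⊤ : ℕ∞) : WithTop ℕ∞)

/-- Slope of a C¹ function in time, as a continuous function. -/
theorem slope_eq {g g' : ℝ → ℝ} (hg : ∀ t, HasDerivAt g (g' t) t) (hc : Continuous g') (t η : ℝ) :
    g (t + η) - g t = η * ∫ s in (0:ℝ)..1, g' (t + η * s) := by
  have := intervalIntegral.integral_eq_sub_of_hasDerivAt (f := fun s => g (t + η * s))
    (f' := fun s => g' (t + η * s) * η) (a := 0) (b := 1) (fun s _ => by
      have h1 : HasDerivAt (fun s : ℝ => t + η * s) η s := by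
        simpa using ((hasDerivAt_id s).const_mul η).const_add t
      exact HasDerivAt.comp (h₂ := g) s (hg (t + η * s)) h1)
    (Continuous.intervalIntegrable (by fun_prop) _ _)
  rw [intervalIntegral.integral_mul_const] at this
  simp only [mul_one, mul_zero, add_zero] at this
  rw [← this]; ring

namespace Sol
variable {n : ℕ} {f : ℝ → ℝ} (U : Sol n f) (c : Cut n)

def su (z : (Fin n → ℝ) × ℝ) (η : ℝ) : ℝ := ∫ s in (0:ℝ)..1, U.ut (z.1, z.2 + η * s)
def sb (t η : ℝ) : ℝ := ∫ s in (0:ℝ)..1, c.b' (t + η * s)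

def tr (η : ℝ) (z : (Fin n → ℝ) × ℝ) : (Fin n → ℝ) × ℝ := (z.1, z.2 + η)

def G5 (η : ℝ) (z : (Fin n → ℝ) × ℝ) : ℝ :=
  sb c z.2 η * c.a z.1 * U.S (tr η z) - c.b z.2 * (U.su z η *
    (c.a z.1 * (U.L (tr η z) + U.L z) + (U.D c.a (tr η z) + U.D c.a z)))

theorem cG5 : Continuous (fun y : ℝ × ((Fin n → ℝ) × ℝ) => U.G5 c y.1 y.2) := by
  have := c.ca; have := c.cb'; have := c.cb; have := U.cD c.ha; have := U.cu; have := U.cL; have := U.cut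
  have := U.cS
  have h1 : Continuous (fun y : ℝ × ((Fin n → ℝ) × ℝ) => U.su y.2 y.1) := by
    unfold su
    apply intervalIntegral.continuous_parametric_intervalIntegral_of_continuous'
    fun_prop
  have h2 : Continuous (fun y : ℝ × ((Fin n → ℝ) × ℝ) => sb c y.2.2 y.1) := by
    unfold sb
    apply intervalIntegral.continuous_parametric_intervalIntegral_of_continuous'
    fun_prop
  unfold G5 tr
  fun_prop

theorem vol_inv : (volume : Measure ((Fin n → ℝ) × ℝ)).IsAddRightInvariant := by
  rw [Measure.volume_eq_prod]
  infer_instance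

theorem translate (g : (Fin n → ℝ) × ℝ → ℝ) (η : ℝ) : ∫ z, g (tr η z) = ∫ z, g z := by
  haveI := vol_inv (n := n)
  have := integral_add_right_eq_self (μ := (volume : Measure ((Fin n → ℝ) × ℝ))) g (0, η)
  rw [← this]
  congr 1
  funext z
  simp [tr, Prod.add_def]

theorem G5_eq {η : ℝ} (hη : η ≠ 0) : ∫ z, U.G5 c η z = 0 := by
  have := c.ca; have := c.cb'; have := c.cb; have := U.cD c.ha; have := U.cu; have := U.cL; have := U.cut
  have := U.cS; have := U.cp; have := U.ch; have := c.cd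
  have ctr : Continuous (tr (n := n) η) := by unfold tr; fun_prop
  -- translation part
  have i0 : Integrable (fun z : (Fin n → ℝ) × ℝ => c.b z.2 * (c.a z.1 * U.S z)) := by
    refine int_of_zero (by fun_prop) c.cK fun z hz => ?_
    rcases nK c hz with h | h
    · simp [c.a0 h]
    · simp [c.b0 h]
  have i1 : Integrable (fun z : (Fin n → ℝ) × ℝ => c.b (tr η z).2 * (c.a (tr η z).1 * U.S (tr η z))) := by
    haveI := vol_inv (n := n)
    have := i0.comp_add_right ((0, η) : (Fin n → ℝ) × ℝ)
    refine this.congr (Eventually.of_forall fun z => ?_)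
    simp [tr, Prod.add_def]
  have h1 : ∫ z, (c.b (tr η z).2 * (c.a (tr η z).1 * U.S (tr η z)) - c.b z.2 * (c.a z.1 * U.S z)) = 0 := by
    rw [integral_sub i1 i0, translate (fun z => c.b z.2 * (c.a z.1 * U.S z)), sub_self]
  -- space part
  have i2 : ∀ j, Integrable (fun z : (Fin n → ℝ) × ℝ => c.b z.2 * ((d j c.a z.1 * (U.u (tr η z) - U.u z) +
      c.a z.1 * (U.p j (tr η z) - U.p j z)) * (U.p j (tr η z) + U.p j z) +
      c.a z.1 * (U.u (tr η z) - U.u z) * (U.h j (tr η z) + U.h j z))) := by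
    intro j
    refine int_of_zero (by fun_prop) c.cK fun z hz => ?_
    rcases nK c hz with h | h
    · simp [c.a0 h, c.d0 j h]
    · simp [c.b0 h]
  have h2 : ∫ z : (Fin n → ℝ) × ℝ, ∑ j, c.b z.2 * ((d j c.a z.1 * (U.u (tr η z) - U.u z) +
      c.a z.1 * (U.p j (tr η z) - U.p j z)) * (U.p j (tr η z) + U.p j z) +
      c.a z.1 * (U.u (tr η z) - U.u z) * (U.h j (tr η z) + U.h j z)) = 0 := by
    refine sum_int_zero i2 fun j => ?_
    refine space_zero j (G := fun z => c.b z.2 * (c.a z.1 * (U.u (tr η z) - U.u z) *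
      (U.p j (tr η z) + U.p j z))) (by fun_prop) (by fun_prop) ?_ c.hac c.hbc ?_
    · intro t
      exact PD.const_mul (c.b t) (((c.hda j).mul ((U.dp j (t + η)).sub (U.dp j t))).mul
        ((U.dh j (t + η)).add (U.dh j t)))
    · rintro x t (h | h)
      · simp [c.a0 h]
      · simp [c.b0 h]
  have key : ∀ z, U.G5 c η z = η⁻¹ * ((c.b (tr η z).2 * (c.a (tr η z).1 * U.S (tr η z))
      - c.b z.2 * (c.a z.1 * U.S z)) - ∑ j, c.b z.2 * ((d j c.a z.1 * (U.u (tr η z) - U.u z) +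
      c.a z.1 * (U.p j (tr η z) - U.p j z)) * (U.p j (tr η z) + U.p j z) +
      c.a z.1 * (U.u (tr η z) - U.u z) * (U.h j (tr η z) + U.h j z))) := by
    intro z
    have e1 : ∑ j, c.b z.2 * ((d j c.a z.1 * (U.u (tr η z) - U.u z) +
      c.a z.1 * (U.p j (tr η z) - U.p j z)) * (U.p j (tr η z) + U.p j z) +
      c.a z.1 * (U.u (tr η z) - U.u z) * (U.h j (tr η z) + U.h j z)) =
      c.b z.2 * ((U.u (tr η z) - U.u z) * (U.D c.a (tr η z) + U.D c.a z) +
        c.a z.1 * (U.S (tr η z) - U.S z) + (U.u (tr η z) - U.u z) * (c.a z.1 * (U.L (tr η z) + U.L z))) := by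
      simp only [D, S, L, Finset.mul_sum, ← Finset.sum_add_distrib, ← Finset.sum_sub_distrib]
      refine Finset.sum_congr rfl fun j _ => ?_
      have : (tr η z).1 = z.1 := rfl
      rw [this]
      ring
    have e2 : U.u (tr η z) - U.u z = η * U.su z η :=
      slope_eq (U.dt z.1) (by fun_prop) z.2 η
    have e3 : c.b (tr η z).2 = c.b z.2 + η * sb c z.2 η := by
      have := slope_eq c.hbd c.cb' z.2 η
      have e : c.b (tr η z).2 = c.b (z.2 + η) := rfl
      rw [e, sb, ← this]; ring
    have e4 : (tr η z).1 = z.1 := rfl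
    rw [e1, e2, e3, e4, G5]
    field_simp
    ring
  simp only [key]
  have i3 : Integrable (fun z : (Fin n → ℝ) × ℝ => c.b (tr η z).2 * (c.a (tr η z).1 * U.S (tr η z))
      - c.b z.2 * (c.a z.1 * U.S z)) := i1.sub i0
  rw [integral_const_mul, integral_sub i3 (integrable_finsetSum _ fun j _ => i2 j), h1, h2]
  simp

theorem N5_eq : ∫ z, U.N5 c z = 0 := by
  have hc : ContinuousOn (fun η => ∫ z, U.G5 c η z) (Icc (-1) 1) := by
    refine continuousOn_integral_of_compact_support
      (k := tsupport c.a ×ˢ Metric.cthickening 1 (tsupport c.b)) (IsCompact.prod c.hac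
        (IsCompact.cthickening c.hbc)) (U.cG5 c).continuousOn ?_
    rintro η z hη hz
    rw [mem_prod, not_and_or] at hz
    rcases hz with h | h
    · simp [G5, c.a0 h, U.D0 c h, U.D0 c (z := tr η z) h]
    · have hb : c.b z.2 = 0 := c.b0 fun h' => h (Metric.self_subset_cthickening _ h')
      have hs : sb c z.2 η = 0 := by
        unfold sb
        rw [intervalIntegral.integral_congr (g := fun _ => 0)]
        · simp
        · intro s hs
          rw [uIcc_of_le zero_le_one] at hs
          refine c.b'0 fun h' => h (Metric.closedBall_subset_cthickening h' 1 ?_)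
          rw [Metric.mem_closedBall, Real.dist_eq]
          have : z.2 - (z.2 + η * s) = -(η * s) := by ring
          rw [this, abs_neg, abs_mul]
          exact mul_le_one₀ (abs_le.mpr hη) (abs_nonneg _) (abs_le.mpr ⟨by linarith [hs.1], hs.2⟩)
      simp [G5, hb, hs]
  have hcl : ∫ z, U.G5 c 0 z = 0 := by
    have h0 : (0:ℝ) ∈ Icc (-1:ℝ) 1 := by norm_num
    have h1 : ContinuousAt (fun η => ∫ z, U.G5 c η z) 0 :=
      hc.continuousAt (Icc_mem_nhds (by norm_num) (by norm_num))
    have h2 : Tendsto (fun η => ∫ z, U.G5 c η z) (𝓝[≠] 0) (𝓝 (∫ z, U.G5 c 0 z)) :=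
      h1.tendsto.mono_left nhdsWithin_le_nhds
    have h3 : Tendsto (fun η => ∫ z, U.G5 c η z) (𝓝[≠] 0) (𝓝 0) := by
      refine tendsto_const_nhds.congr' ?_
      filter_upwards [self_mem_nhdsWithin] with η hη
      exact (U.G5_eq c hη).symm
    exact tendsto_nhds_unique h2 h3
  have e : ∀ z, U.N5 c z = (-1/2) * U.G5 c 0 z := by
    intro z
    have e0 : tr 0 z = z := by simp [tr]
    have e1 : U.su z 0 = U.ut z := by simp [su]
    have e2 : sb c z.2 0 = c.b' z.2 := by simp [sb]
    rw [G5, N5, e0, e1, e2]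
    ring
  simp only [e]
  rw [integral_const_mul, hcl, mul_zero]

end Sol
end
end LV

namespace LV
noncomputable section
open MeasureTheory Topology

theorem young {X D w y ε : ℝ} (hw : 0 ≤ w) (hy : 0 ≤ y) (hε : 0 < ε) (h : D ^ 2 ≤ w * y) :
    |X * D| ≤ ε * w * X ^ 2 + y / (4 * ε) := by
  rcases hw.eq_or_lt with h0 | h0
  · rw [← h0, zero_mul] at h
    have : D = 0 := by nlinarith [sq_nonneg D]
    rw [this, ← h0]
    simp
    positivity
  · have key : ∀ Y : ℝ, Y ^ 2 = X ^ 2 → Y * D ≤ ε * w * X ^ 2 + y / (4 * ε) := by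
      intro Y hY
      rw [← sub_nonneg]
      have h1 : 0 ≤ 4 * ε * w * (ε * w * X ^ 2 + y / (4 * ε) - Y * D) := by
        have : 4 * ε * w * (ε * w * X ^ 2 + y / (4 * ε) - Y * D)
          = (2 * ε * w * Y - D) ^ 2 + (w * y - D ^ 2) := by
          rw [← hY]; field_simp; ring
        rw [this]
        nlinarith [sq_nonneg (2 * ε * w * Y - D)]
      exact nonneg_of_mul_nonneg_right h1 (by positivity)
    rw [abs_le]
    constructor
    · have := key (-X) (by ring)
      linarith
    · exact key X rfl

set_option maxHeartbeats 400000 in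
theorem absorb {N κ e γ μ α c0 CF : ℝ} (hγ : γ = (N - 1) / N) (hμ : μ = κ * (2 / N + 1))
    (hα : α = κ - κ ^ 2 * γ) (hα0 : 0 < α) (hγ0 : 0 ≤ γ) (hγ1 : γ ≤ 1) (hμe : γ * e ≤ μ)
    (hc0 : 0 ≤ c0) (hCF : 0 ≤ CF) :
    ∃ Λ Γ C : ℝ, 0 ≤ Λ ∧ 0 ≤ Γ ∧ 0 ≤ C ∧ ∀ w v z0 u q ff F L ut S D Dl β D2 β2 : ℝ,
      0 ≤ w → 0 ≤ v → 0 ≤ z0 → v ^ 2 = w * z0 → 0 ≤ u → 0 ≤ q → 0 ≤ ff → 0 ≤ F → F ≤ CF * (u * ff) →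
      ut = L + ff → S = q * u → |β| ≤ c0 * v → |Dl| ≤ c0 * v → D ^ 2 ≤ w * (c0 * (v * S)) →
      |β2| ≤ c0 * z0 → D2 ^ 2 ≤ c0 * z0 * (v * S) →
      α / 4 * (w * q ^ 2) + w * ut ^ 2 + v * (u * ff) - C * (z0 * u ^ 2) ≤
      (EX N (-κ) w Dl D S L q) + γ * (ut * (w * L + D) - β * S / 2)
        + γ * (-(w * ff * L) - e * (w * ff * q) - ff * D) - (1 - γ) * (ff * D + F * Dl)
        + Λ * (w * (ff * ut) + β * F + (ut * (w * L + D) - β * S / 2))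
        + Γ * (v * (u * ff) - v * S - u * D2 + β2 * u ^ 2 / 2) := by
  obtain ⟨Λ, hΛ⟩ : ∃ x, x = μ ^ 2 / α + 2 := ⟨_, rfl⟩
  have hΛ0 : 0 ≤ Λ := by rw [hΛ]; positivity
  obtain ⟨Γ, hΓ⟩ : ∃ x, x = 1 + (Λ + 1) * c0 * CF := ⟨_, rfl⟩
  have hΓ0 : 0 ≤ Γ := by rw [hΓ]; positivity
  obtain ⟨m, hm⟩ : ∃ x, x = Λ - 1 + γ := ⟨_, rfl⟩
  obtain ⟨C1, hC1⟩ : ∃ x, x = c0 + Λ * c0 + κ ^ 2 * c0 / α + m ^ 2 * c0 / 4 + Γ + 1 := ⟨_, rfl⟩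
  obtain ⟨C, hC⟩ : ∃ x, x = Γ ^ 2 * c0 / 4 + C1 ^ 2 / α + Γ * c0 / 2 := ⟨_, rfl⟩
  refine ⟨Λ, Γ, C, hΛ0, hΓ0, by rw [hC]; positivity, ?_⟩
  intro w v z0 u q ff F L ut S D Dl β D2 β2 hw hv hz0 hvw hu hq hff hF hFu hut hS hβ hDl hD hβ2 hD2
  have hS0 : 0 ≤ S := by rw [hS]; positivity
  have hvS : 0 ≤ v * S := by positivity
  -- Young inequalities
  have y1 : |q * (-κ * D)| ≤ α / 4 * w * q ^ 2 + κ ^ 2 * c0 * (v * S) / (4 * (α / 4)) :=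
    young hw (by positivity) (by positivity) (by linarith only [mul_le_mul_of_nonneg_left hD (sq_nonneg κ)])
  have y2 : |ut * (m * D)| ≤ 1 * w * ut ^ 2 + m ^ 2 * c0 * (v * S) / (4 * 1) :=
    young hw (by positivity) (by positivity) (by linarith only [mul_le_mul_of_nonneg_left hD (sq_nonneg m)])
  have y3 : |u * (Γ * D2)| ≤ 1 / 4 * (Γ ^ 2 * c0 * z0) * u ^ 2 + v * S / (4 * (1 / 4)) :=
    young (by positivity) (by positivity) (by positivity) (by linarith only [mul_le_mul_of_nonneg_left hD2 (sq_nonneg Γ)])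
  have y4 : |q * (C1 * (v * u))| ≤ α / 4 * w * q ^ 2 + C1 ^ 2 * (z0 * u ^ 2) / (4 * (α / 4)) :=
    young hw (by positivity) (by positivity) (by
      apply le_of_eq
      calc (C1 * (v * u)) ^ 2 = C1 ^ 2 * u ^ 2 * v ^ 2 := by ring
        _ = _ := by rw [hvw]; ring)
  have y5 : μ * (w * (q * ut)) ≤ α / 4 * (w * q ^ 2) + μ ^ 2 / α * (w * ut ^ 2) := by
    have : 0 ≤ w * (α / 4 * q ^ 2 + μ ^ 2 / α * ut ^ 2 - μ * (q * ut)) := by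
      apply mul_nonneg hw
      have : α / 4 * q ^ 2 + μ ^ 2 / α * ut ^ 2 - μ * (q * ut) = (α * q / 2 - μ * ut) ^ 2 / α := by
        field_simp; ring
      rw [this]; positivity
    linarith
  have a1 := (abs_le.mp y1).1
  have a2 := (abs_le.mp y2).1
  have a3 := (abs_le.mp y3).2
  have a4 := (abs_le.mp y4).2
  -- linear absolute value bounds
  have b1 : S * Dl ≤ c0 * (v * S) := by
    have := mul_le_mul_of_nonneg_left ((le_abs_self Dl).trans hDl) hS0
    linarith
  have b2 : (γ + Λ) * (β * S) ≤ (1 + Λ) * (c0 * (v * S)) := by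
    have h1 : β * S ≤ c0 * v * S := mul_le_mul_of_nonneg_right ((le_abs_self β).trans hβ) hS0
    calc (γ + Λ) * (β * S) ≤ (γ + Λ) * (c0 * v * S) := mul_le_mul_of_nonneg_left h1 (by positivity)
      _ ≤ (1 + Λ) * (c0 * v * S) := mul_le_mul_of_nonneg_right (by linarith) (by positivity)
      _ = _ := by ring
  have hvF : v * F ≤ CF * (v * (u * ff)) := by
    have := mul_le_mul_of_nonneg_left hFu hv
    linarith
  have hvuf : 0 ≤ v * (u * ff) := by positivity
  have b3 : -(c0 * CF * (v * (u * ff))) ≤ F * β := by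
    have := mul_le_mul_of_nonneg_left ((abs_le.mp hβ).1) hF
    linarith only [this, mul_le_mul_of_nonneg_left hvF hc0]
  have b4 : F * Dl ≤ c0 * CF * (v * (u * ff)) := by
    have := mul_le_mul_of_nonneg_left ((abs_le.mp hDl).2) hF
    linarith only [this, mul_le_mul_of_nonneg_left hvF hc0]
  have b3' := mul_le_mul_of_nonneg_left b3 hΛ0
  have b4' : (1 - γ) * (F * Dl) ≤ c0 * CF * (v * (u * ff)) := by
    calc (1 - γ) * (F * Dl) ≤ (1 - γ) * (c0 * CF * (v * (u * ff))) :=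
          mul_le_mul_of_nonneg_left b4 (by linarith)
      _ ≤ 1 * (c0 * CF * (v * (u * ff))) := mul_le_mul_of_nonneg_right (by linarith) (by positivity)
      _ = _ := by ring
  have b5 : -(Γ * (c0 * (z0 * u ^ 2))) ≤ Γ * (β2 * u ^ 2) := by
    have := mul_le_mul_of_nonneg_right ((abs_le.mp hβ2).1) (sq_nonneg u)
    have := mul_le_mul_of_nonneg_left this hΓ0
    linarith
  have b6 : 0 ≤ (μ - γ * e) * (w * (ff * q)) := mul_nonneg (by linarith) (by positivity)
  have eEX : EX N (-κ) w Dl D S L q = α * (w * q ^ 2) - μ * (w * (q * ut)) + μ * (w * (ff * q))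
      - γ * (w * L ^ 2) - S * Dl / 2 - L * D + q * (-κ * D) := by
    rw [EX, ← hγ, hα, hμ, hut]; ring
  rw [eEX]
  have hvSq : C1 * (v * S) = q * (C1 * (v * u)) := by rw [hS]; ring
  have e1 : κ ^ 2 * c0 * (v * S) / (4 * (α / 4)) = κ ^ 2 * c0 / α * (v * S) := by field_simp
  have e2 : C1 ^ 2 * (z0 * u ^ 2) / (4 * (α / 4)) = C1 ^ 2 / α * (z0 * u ^ 2) := by field_simp
  rw [e1] at a1
  rw [e2] at a4
  have hL : L = ut - ff := by linarith
  have eq1 : α * (w * q ^ 2) - μ * (w * (q * ut)) + μ * (w * (ff * q))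
      - γ * (w * L ^ 2) - S * Dl / 2 - L * D + q * (-κ * D) + γ * (ut * (w * L + D) - β * S / 2)
        + γ * (-(w * ff * L) - e * (w * ff * q) - ff * D) - (1 - γ) * (ff * D + F * Dl)
        + Λ * (w * (ff * ut) + β * F + (ut * (w * L + D) - β * S / 2))
        + Γ * (v * (u * ff) - v * S - u * D2 + β2 * u ^ 2 / 2) =
      α * (w * q ^ 2) - μ * (w * (q * ut)) + (μ - γ * e) * (w * (ff * q)) - S * Dl / 2
       + q * (-κ * D) + ut * (m * D) - ((γ + Λ) * (β * S)) / 2 - (1 - γ) * (F * Dl) + Λ * (w * ut ^ 2)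
       + Λ * (F * β) + Γ * (v * (u * ff)) - Γ * (v * S) - u * (Γ * D2) + Γ * (β2 * u ^ 2) / 2 := by
    rw [hL, hm]; ring
  rw [eq1]
  have eΛ : Λ * (w * ut ^ 2) = μ ^ 2 / α * (w * ut ^ 2) + 2 * (w * ut ^ 2) := by rw [hΛ]; ring
  have eΓ : Γ * (v * (u * ff)) = v * (u * ff) + Λ * (c0 * CF * (v * (u * ff))) + c0 * CF * (v * (u * ff)) := by
    rw [hΓ]; ring
  have eC : C * (z0 * u ^ 2) = 1 / 4 * (Γ ^ 2 * c0 * z0) * u ^ 2 + C1 ^ 2 / α * (z0 * u ^ 2)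
    + Γ * (c0 * (z0 * u ^ 2)) / 2 := by rw [hC]; ring
  have eC1 : C1 * (v * S) = c0 * (v * S) + Λ * c0 * (v * S) + κ ^ 2 * c0 / α * (v * S)
     + m ^ 2 * c0 * (v * S) / 4 + Γ * (v * S) + v * S := by rw [hC1]; ring
  rw [eΛ, eΓ, eC]
  rw [← hvSq, eC1] at a4
  have hx : 0 ≤ Λ * (c0 * (v * S)) := by positivity
  linarith only [hx, a1, a2, a3, a4, b1, b2, b3', b4', b5, b6, y5]

end
end LV

namespace LV
noncomputable section
open MeasureTheory Topology

local notation "CInf" => ((⊤ : ℕ∞) : WithTop ℕ∞)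

theorem d_scale {n : ℕ} (j : Fin n) (v : (Fin n → ℝ) → ℝ) (r : ℝ) :
    d j (fun x => v (r • x)) = fun x => r * d j v (r • x) := by
  funext x
  unfold d
  rw [fderiv_comp_smul]
  simp

theorem d_const_mul {n : ℕ} (j : Fin n) {v : (Fin n → ℝ) → ℝ} (hv : Differentiable ℝ v) (r : ℝ) :
    d j (fun x => r * v x) = fun x => r * d j v x := by
  refine PD.unique (PD_d j (hv.const_mul r)) ?_
  exact (PD_d j hv).const_mul r

theorem d_pow {n : ℕ} (j : Fin n) {v : (Fin n → ℝ) → ℝ} (hv : Differentiable ℝ v) (k : ℕ) :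
    d j (fun x => v x ^ (k + 1)) = fun x => ((k:ℝ) + 1) * v x ^ k * d j v x := by
  refine PD.unique (PD_d j (hv.pow (k + 1))) ?_
  refine ((PD_d j hv).comp (g := fun s => s ^ (k + 1)) (g' := fun s => ((k:ℝ) + 1) * s ^ k) ?_)
  intro x
  have := hasDerivAt_pow (k + 1) (v x)
  simpa using this

theorem dd_pow {n : ℕ} (j : Fin n) {v : (Fin n → ℝ) → ℝ} (hv : ContDiff ℝ CInf v) (k : ℕ) :
    d j (d j (fun x => v x ^ (k + 2))) = fun x => ((k:ℝ) + 2) * (((k:ℝ) + 1) * v x ^ k * d j v x * d j v x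
      + v x ^ (k + 1) * d j (d j v) x) := by
  have hd := hv.differentiable (by simp)
  have hd1 : Differentiable ℝ (d j v) := (contDiff_d j hv).differentiable (by simp)
  have e : d j (fun x => v x ^ (k + 2)) = fun x => ((k:ℝ) + 2) * (v x ^ (k + 1) * d j v x) := by
    rw [d_pow j hd (k + 1)]
    funext x
    push_cast; ring
  rw [e]
  refine PD.unique (PD_d j (((hd.pow (k + 1)).mul hd1).const_mul _)) ?_
  refine PD.const_mul _ (PD.mul ?_ (PD_d j hd1))
  have := PD_d j (hd.pow (k + 1))
  have e2 := d_pow j hd k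
  exact e2 ▸ this

def A0 (n : ℕ) : ContDiffBump (0 : Fin n → ℝ) := ⟨1, 2, one_pos, one_lt_two⟩
def B0 : ContDiffBump (0 : ℝ) := ⟨1, 2, one_pos, one_lt_two⟩

def AR (n : ℕ) (R : ℝ) (x : Fin n → ℝ) : ℝ := A0 n (R⁻¹ • x)
def BR (R : ℝ) (t : ℝ) : ℝ := B0 ((R ^ 2)⁻¹ * t)
def th (n : ℕ) (R : ℝ) (z : (Fin n → ℝ) × ℝ) : ℝ := AR n R z.1 * BR R z.2

theorem AR_smooth (n : ℕ) (R : ℝ) : ContDiff ℝ CInf (AR n R) :=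
  (A0 n).contDiff.comp (contDiff_const_smul R⁻¹)
theorem BR_smooth (R : ℝ) : ContDiff ℝ CInf (BR R) :=
  B0.contDiff.comp (contDiff_const.mul contDiff_id)
theorem AR_nonneg (n : ℕ) (R : ℝ) (x) : 0 ≤ AR n R x := (A0 n).nonneg
theorem BR_nonneg (R : ℝ) (x) : 0 ≤ BR R x := B0.nonneg
theorem AR_le (n : ℕ) (R : ℝ) (x) : AR n R x ≤ 1 := (A0 n).le_one
theorem BR_le (R : ℝ) (x) : BR R x ≤ 1 := B0.le_one
theorem AR_zero {n : ℕ} {R : ℝ} (hR : 0 < R) {x : Fin n → ℝ} (hx : 2 * R ≤ ‖x‖) : AR n R x = 0 := by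
  apply (A0 n).zero_of_le_dist
  rw [dist_zero_right, norm_smul, norm_inv, Real.norm_of_nonneg hR.le]
  change 2 ≤ _
  rw [inv_mul_eq_div, le_div_iff₀ hR]
  exact hx
theorem BR_zero {R : ℝ} (hR : 0 < R) {t : ℝ} (ht : 2 * R ^ 2 ≤ |t|) : BR R t = 0 := by
  apply B0.zero_of_le_dist
  rw [dist_zero_right, norm_mul, norm_inv, Real.norm_of_nonneg (sq_nonneg R)]
  change 2 ≤ _
  rw [inv_mul_eq_div, le_div_iff₀ (by positivity)]
  exact ht
theorem AR_one {n : ℕ} {R : ℝ} (hR : 0 < R) {x : Fin n → ℝ} (hx : ‖x‖ ≤ R) : AR n R x = 1 := by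
  apply (A0 n).one_of_mem_closedBall
  rw [Metric.mem_closedBall, dist_zero_right, norm_smul, norm_inv, Real.norm_of_nonneg hR.le]
  change _ ≤ 1
  rw [inv_mul_eq_div, div_le_one hR]
  exact hx
theorem BR_one {R : ℝ} (hR : 0 < R) {t : ℝ} (ht : |t| ≤ R ^ 2) : BR R t = 1 := by
  apply B0.one_of_mem_closedBall
  rw [Metric.mem_closedBall, dist_zero_right, norm_mul, norm_inv, Real.norm_of_nonneg (sq_nonneg R)]
  change _ ≤ 1
  rw [inv_mul_eq_div, div_le_one (by positivity)]
  exact ht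

theorem AR_cpt {n : ℕ} {R : ℝ} (hR : 0 < R) : HasCompactSupport (AR n R) :=
  HasCompactSupport.intro (isCompact_closedBall (0 : Fin n → ℝ) (2 * R)) fun x hx => AR_zero hR (by
    rw [Metric.mem_closedBall, dist_zero_right, not_le] at hx; exact hx.le)
theorem BR_cpt {R : ℝ} (hR : 0 < R) : HasCompactSupport (BR R) :=
  HasCompactSupport.intro (isCompact_closedBall (0 : ℝ) (2 * R ^ 2)) fun x hx => BR_zero hR (by
    rw [Metric.mem_closedBall, dist_zero_right, not_le] at hx; exact hx.le)

theorem exists_bd (n : ℕ) : ∃ M : ℝ, 0 ≤ M ∧ (∀ j x, |d j (A0 n) x| ≤ M) ∧ (∀ j x, |d j (d j (A0 n)) x| ≤ M)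
    ∧ (∀ t, |deriv B0 t| ≤ M) := by
  have hs : ContDiff ℝ CInf (A0 n) := (A0 n).contDiff
  have hc : HasCompactSupport (A0 n) := (A0 n).hasCompactSupport
  have p0 : ∀ j, PD j (A0 n) (d j (A0 n)) := fun j => PD_d j (hs.differentiable (by simp))
  have p1 : ∀ j, PD j (d j (A0 n)) (d j (d j (A0 n))) := fun j =>
    PD_d j ((contDiff_d j hs).differentiable (by simp))
  have c1 : ∀ j, HasCompactSupport (d j (A0 n)) := fun j => (p0 j).hasCompactSupport hc
  have c2 : ∀ j, HasCompactSupport (d j (d j (A0 n))) := fun j => (p1 j).hasCompactSupport (c1 j)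
  choose M1 h1 using fun j => (c1 j).exists_bound_of_continuous (contDiff_d j hs).continuous
  choose M2 h2 using fun j => (c2 j).exists_bound_of_continuous (contDiff_d j (contDiff_d j hs)).continuous
  have hB : ContDiff ℝ CInf B0 := B0.contDiff
  obtain ⟨M3, h3⟩ := (B0.hasCompactSupport.deriv).exists_bound_of_continuous
    (hB.continuous_deriv (by exact_mod_cast le_top))
  refine ⟨∑ j, |M1 j| + ∑ j, |M2 j| + |M3|, by positivity, ?_, ?_, ?_⟩
  · intro j x
    have a := h1 j x
    rw [Real.norm_eq_abs] at a
    have b := Finset.single_le_sum (f := fun j => |M1 j|) (fun i _ => abs_nonneg _) (Finset.mem_univ j)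
    have c : 0 ≤ ∑ j, |M2 j| := by positivity
    linarith [le_abs_self (M1 j), abs_nonneg M3]
  · intro j x
    have a := h2 j x
    rw [Real.norm_eq_abs] at a
    have b := Finset.single_le_sum (f := fun j => |M2 j|) (fun i _ => abs_nonneg _) (Finset.mem_univ j)
    have c : 0 ≤ ∑ j, |M1 j| := by positivity
    linarith [le_abs_self (M2 j), abs_nonneg M3]
  · intro t
    have a := h3 t
    rw [Real.norm_eq_abs] at a
    have c : 0 ≤ ∑ j, |M1 j| := by positivity
    have c : 0 ≤ ∑ j, |M2 j| := by positivity
    linarith [le_abs_self M3]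

/-- The cutoff with exponent `k + 2` at scale `R`. -/
def cutR (n k : ℕ) (R : ℝ) (hR : 0 < R) : Cut n where
  a x := AR n R x ^ (k + 2)
  b t := BR R t ^ (k + 2)
  ha := (AR_smooth n R).pow _
  hb := (BR_smooth R).pow _
  ha0 x := pow_nonneg (AR_nonneg n R x) _
  hb0 x := pow_nonneg (BR_nonneg R x) _
  hac := (AR_cpt hR).mono' (fun x hx => subset_tsupport _ (fun h => hx (by simp [h])))
  hbc := (BR_cpt hR).mono' (fun x hx => subset_tsupport _ (fun h => hx (by simp [h])))

theorem cut_ab (n k : ℕ) {R : ℝ} (hR : 0 < R) (z : (Fin n → ℝ) × ℝ) :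
    (cutR n k R hR).a z.1 * (cutR n k R hR).b z.2 = th n R z ^ (k + 2) := by
  simp only [cutR, th, mul_pow]

theorem th_nonneg (n : ℕ) (R : ℝ) (z) : 0 ≤ th n R z := mul_nonneg (AR_nonneg _ _ _) (BR_nonneg _ _)
theorem th_le (n : ℕ) (R : ℝ) (z) : th n R z ≤ 1 := mul_le_one₀ (AR_le _ _ _) (BR_nonneg _ _) (BR_le _ _)
theorem th_cont (n : ℕ) (R : ℝ) : Continuous (th n R) := by
  have h1 := (AR_smooth n R).continuous
  have h2 := (BR_smooth R).continuous
  unfold th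
  fun_prop

theorem cut_bounds (n k : ℕ) : ∃ c0 : ℝ, 0 ≤ c0 ∧ ∀ (R : ℝ) (hR : 0 < R) (z : (Fin n → ℝ) × ℝ),
    |(cutR n k R hR).a z.1 * (cutR n k R hR).b' z.2| ≤ c0 * ((R ^ 2)⁻¹ * th n R z ^ k) ∧
    |(cutR n k R hR).b z.2 * (cutR n k R hR).La z.1| ≤ c0 * ((R ^ 2)⁻¹ * th n R z ^ k) ∧
    ∀ p : Fin n → ℝ, ((cutR n k R hR).b z.2 * ∑ j, d j (cutR n k R hR).a z.1 * p j) ^ 2 ≤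
      c0 * (R ^ 2)⁻¹ * th n R z ^ (2 * k + 2) * ∑ j, p j ^ 2 := by
  obtain ⟨M, hM, h1, h2, h3⟩ := exists_bd n
  set κ : ℝ := (k:ℝ) + 2 with hκ
  have hκ0 : 0 ≤ κ := by positivity
  have hκ2 : 2 ≤ κ := by rw [hκ]; linarith [(Nat.cast_nonneg k : (0:ℝ) ≤ k)]
  refine ⟨κ * M + n * (κ * (κ * M ^ 2 + M)) + n * (κ * M) ^ 2, by positivity, fun R hR z => ?_⟩
  set A := AR n R z.1 with hA
  set B := BR R z.2 with hB
  have hA0 : 0 ≤ A := AR_nonneg _ _ _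
  have hB0 : 0 ≤ B := BR_nonneg _ _
  have hA1 : A ≤ 1 := AR_le _ _ _
  have hB1 : B ≤ 1 := BR_le _ _
  have hth : th n R z = A * B := rfl
  have hR2 : (0:ℝ) ≤ (R ^ 2)⁻¹ := by positivity
  have hθ : 0 ≤ A ^ k * B ^ k := by positivity
  have hAd := (AR_smooth n R).differentiable (by simp)
  have dA : ∀ j, d j (AR n R) z.1 = R⁻¹ * d j (A0 n) (R⁻¹ • z.1) := by
    intro j
    have := d_scale j (A0 n) R⁻¹
    exact congrFun this z.1
  have ddA : ∀ j, d j (d j (AR n R)) z.1 = (R ^ 2)⁻¹ * d j (d j (A0 n)) (R⁻¹ • z.1) := by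
    intro j
    have e1 : d j (AR n R) = fun x => R⁻¹ * d j (A0 n) (R⁻¹ • x) := d_scale j (A0 n) R⁻¹
    have hs : ContDiff ℝ CInf (A0 n) := (A0 n).contDiff
    have hd : Differentiable ℝ (fun x => d j (A0 n) (R⁻¹ • x)) :=
      ((contDiff_d j hs).comp (contDiff_const_smul R⁻¹)).differentiable (by simp)
    rw [e1, d_const_mul j hd, d_scale j (d j (A0 n))]
    simp only
    rw [← mul_assoc, ← mul_inv, ← sq]
  have bdA : ∀ j, |d j (AR n R) z.1| ≤ R⁻¹ * M := by
    intro j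
    rw [dA, abs_mul, abs_of_nonneg (by positivity : 0 ≤ R⁻¹)]
    exact mul_le_mul_of_nonneg_left (h1 _ _) (by positivity)
  have bddA : ∀ j, |d j (d j (AR n R)) z.1| ≤ (R ^ 2)⁻¹ * M := by
    intro j
    rw [ddA, abs_mul, abs_of_nonneg hR2]
    exact mul_le_mul_of_nonneg_left (h2 _ _) (by positivity)
  have bdB : |deriv (BR R) z.2| ≤ (R ^ 2)⁻¹ * M := by
    have : deriv (BR R) z.2 = (R ^ 2)⁻¹ * deriv B0 ((R ^ 2)⁻¹ * z.2) := by
      have := deriv_comp_mul_left (c := (R ^ 2)⁻¹) (f := B0) (x := z.2)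
      rw [smul_eq_mul] at this
      exact this
    rw [this, abs_mul, abs_of_nonneg hR2]
    exact mul_le_mul_of_nonneg_left (h3 _) (by positivity)
  have eb' : (cutR n k R hR).b' z.2 = κ * B ^ (k + 1) * deriv (BR R) z.2 := by
    have h : HasDerivAt (BR R) (deriv (BR R) z.2) z.2 :=
      (((BR_smooth R).differentiable (by simp)) z.2).hasDerivAt
    have := (h.pow (k + 2)).deriv
    change deriv (fun t => BR R t ^ (k + 2)) z.2 = _
    have e : (fun t => BR R t ^ (k + 2)) = BR R ^ (k + 2) := rfl
    rw [e, this]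
    push_cast
    rfl
  have eda : ∀ j, d j (cutR n k R hR).a z.1 = κ * A ^ (k + 1) * d j (AR n R) z.1 := by
    intro j
    have := congrFun (d_pow j hAd (k + 1)) z.1
    refine (this.trans ?_)
    rw [hκ]; push_cast; ring
  have edda : ∀ j, d j (d j (cutR n k R hR).a) z.1 = κ * ((κ - 1) * A ^ k * d j (AR n R) z.1 * d j (AR n R) z.1
      + A ^ (k + 1) * d j (d j (AR n R)) z.1) := by
    intro j
    have := congrFun (dd_pow j (AR_smooth n R) k) z.1
    refine (this.trans ?_)
    rw [hκ]
    have : (k:ℝ) + 2 - 1 = k + 1 := by ring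
    rw [this]
  have ea : (cutR n k R hR).a z.1 = A ^ (k + 2) := rfl
  have ebb : (cutR n k R hR).b z.2 = B ^ (k + 2) := rfl
  have hAk : A ^ (k + 2) ≤ A ^ k := pow_le_pow_of_le_one hA0 hA1 (by omega)
  have hAk1 : A ^ (k + 1) ≤ A ^ k := pow_le_pow_of_le_one hA0 hA1 (by omega)
  have hBk1 : B ^ (k + 1) ≤ B ^ k := pow_le_pow_of_le_one hB0 hB1 (by omega)
  have hBk : B ^ (k + 2) ≤ B ^ k := pow_le_pow_of_le_one hB0 hB1 (by omega)
  have hBk21 : B ^ (k + 2) ≤ B ^ (k + 1) := pow_le_pow_of_le_one hB0 hB1 (by omega)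
  rw [hth, mul_pow A B k]
  have x1 : 0 ≤ κ * M * ((R ^ 2)⁻¹ * (A ^ k * B ^ k)) := by positivity
  have x2 : 0 ≤ n * (κ * (κ * M ^ 2 + M)) * ((R ^ 2)⁻¹ * (A ^ k * B ^ k)) := by positivity
  have x3 : 0 ≤ n * (κ * M) ^ 2 * ((R ^ 2)⁻¹ * (A ^ k * B ^ k)) := by positivity
  refine ⟨?_, ?_, ?_⟩
  · rw [ea, eb', abs_mul, abs_mul, abs_of_nonneg (pow_nonneg hA0 _),
      abs_of_nonneg (by positivity : 0 ≤ κ * B ^ (k + 1))]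
    calc A ^ (k + 2) * (κ * B ^ (k + 1) * |deriv (BR R) z.2|) ≤ A ^ k * (κ * B ^ k * ((R ^ 2)⁻¹ * M)) := by
          gcongr
      _ = κ * M * ((R ^ 2)⁻¹ * (A ^ k * B ^ k)) := by ring
      _ ≤ _ := by linarith
  · have t1 : |(cutR n k R hR).La z.1| ≤ n * (κ * (κ * M ^ 2 + M) * ((R ^ 2)⁻¹ * A ^ k)) := by
      unfold Cut.La
      refine (Finset.abs_sum_le_sum_abs _ _).trans ?_
      refine (Finset.sum_le_sum (g := fun _ => κ * (κ * M ^ 2 + M) * ((R ^ 2)⁻¹ * A ^ k)) ?_).trans ?_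
      · intro j _
        rw [edda, abs_mul, abs_of_nonneg hκ0]
        have s1 : |(κ - 1) * A ^ k * d j (AR n R) z.1 * d j (AR n R) z.1| ≤ κ * A ^ k * (R⁻¹ * M) * (R⁻¹ * M) := by
          rw [abs_mul, abs_mul, abs_of_nonneg (mul_nonneg (by linarith) (by positivity))]
          have := bdA j
          gcongr
          linarith
        have s2 : |A ^ (k + 1) * d j (d j (AR n R)) z.1| ≤ A ^ k * ((R ^ 2)⁻¹ * M) := by
          rw [abs_mul, abs_of_nonneg (by positivity)]
          have := bddA j
          gcongr
        have s3 := (abs_add_le ((κ - 1) * A ^ k * d j (AR n R) z.1 * d j (AR n R) z.1)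
          (A ^ (k + 1) * d j (d j (AR n R)) z.1)).trans (add_le_add s1 s2)
        have s4 := mul_le_mul_of_nonneg_left s3 hκ0
        refine s4.trans (le_of_eq ?_)
        rw [inv_pow R 2 |>.symm]
        ring
      · simp
    rw [ebb, abs_mul, abs_of_nonneg (pow_nonneg hB0 _)]
    calc B ^ (k + 2) * |(cutR n k R hR).La z.1| ≤ B ^ k * (n * (κ * (κ * M ^ 2 + M) * ((R ^ 2)⁻¹ * A ^ k))) := by
          gcongr
      _ = n * (κ * (κ * M ^ 2 + M)) * ((R ^ 2)⁻¹ * (A ^ k * B ^ k)) := by ring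
      _ ≤ _ := by linarith
  · intro p
    have hp : 0 ≤ ∑ j, p j ^ 2 := by positivity
    have c1 : (∑ j, d j (cutR n k R hR).a z.1 * p j) ^ 2 ≤ (∑ j, d j (cutR n k R hR).a z.1 ^ 2) * ∑ j, p j ^ 2 :=
      Finset.sum_mul_sq_le_sq_mul_sq _ _ _
    have c2 : ∑ j, d j (cutR n k R hR).a z.1 ^ 2 ≤ n * (κ * A ^ (k + 1) * (R⁻¹ * M)) ^ 2 := by
      refine (Finset.sum_le_sum (g := fun _ => (κ * A ^ (k + 1) * (R⁻¹ * M)) ^ 2) ?_).trans ?_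
      · intro j _
        rw [eda]
        apply sq_le_sq'
        · have := (abs_le.mp (bdA j)).1
          have := mul_le_mul_of_nonneg_left this (by positivity : 0 ≤ κ * A ^ (k + 1))
          linarith
        · exact mul_le_mul_of_nonneg_left ((le_abs_self _).trans (bdA j)) (by positivity)
      · simp
    rw [ebb, mul_pow]
    calc (B ^ (k + 2)) ^ 2 * (∑ j, d j (cutR n k R hR).a z.1 * p j) ^ 2
        ≤ (B ^ (k + 1)) ^ 2 * ((n * (κ * A ^ (k + 1) * (R⁻¹ * M)) ^ 2) * ∑ j, p j ^ 2) := by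
          refine mul_le_mul (pow_le_pow_left₀ (by positivity) hBk21 2) ?_ (sq_nonneg _) (by positivity)
          exact c1.trans (mul_le_mul_of_nonneg_right c2 hp)
      _ = n * (κ * M) ^ 2 * (R ^ 2)⁻¹ * (A ^ (2 * k + 2) * B ^ (2 * k + 2)) * ∑ j, p j ^ 2 := by
          rw [inv_pow R 2 |>.symm]; ring
      _ ≤ _ := by
          rw [mul_pow A B]
          apply mul_le_mul_of_nonneg_right _ hp
          apply mul_le_mul_of_nonneg_right _ (by positivity)
          apply mul_le_mul_of_nonneg_right _ hR2
          have : 0 ≤ n * (κ * (κ * M ^ 2 + M)) := by positivity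
          nlinarith [mul_nonneg hκ0 hM]

end
end LV

namespace LV
noncomputable section
open MeasureTheory Topology

theorem EX_lin (b N s a La D S L q : ℝ) :
    b * EX N s a La D S L q = EX N s (a * b) (b * La) (b * D) S L q := by
  unfold EX; ring

theorem energy {n : ℕ} {f : ℝ → ℝ} (U : Sol n f) (hn : 1 ≤ n) (m : ℕ) {κ e γ CF : ℝ}
    (hγ : γ = ((n:ℝ) - 1) / n) (hα0 : 0 < κ - κ ^ 2 * γ) (hμe : γ * e ≤ κ * (2 / n + 1))
    (hf : ∀ s, 0 ≤ s → 0 ≤ f s)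
    (hF : ∀ s, 0 ≤ s → Sol.F f s ≤ CF * (s * f s)) (hCF : 0 ≤ CF)
    (hA : γ = 0 ∨ AntitoneOn (fun s : ℝ => f s / s ^ e) (Ioi 0)) :
    ∃ α C : ℝ, 0 < α ∧ 0 ≤ C ∧ ∀ R : ℝ, 0 < R → ∃ H : (Fin n → ℝ) × ℝ → ℝ, Integrable H ∧ ∫ z, H z ≤ 0 ∧
      ∀ z, α * (th n R z ^ (m + 4) * U.q z ^ 2) + th n R z ^ (m + 4) * U.ut z ^ 2
        + (R ^ 2)⁻¹ * th n R z ^ (m + 2) * (U.u z * f (U.u z))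
        - C * ((R ^ 4)⁻¹ * th n R z ^ m * U.u z ^ 2) ≤ H z := by
  have hn0 : (1:ℝ) ≤ n := by exact_mod_cast hn
  have hγ0 : 0 ≤ γ := by rw [hγ]; apply div_nonneg <;> linarith
  have hγ1 : γ ≤ 1 := by rw [hγ, div_le_one (by linarith)]; linarith
  obtain ⟨c1, hc1, h1⟩ := cut_bounds n (m + 2)
  obtain ⟨c2, hc2, h2⟩ := cut_bounds n m
  obtain ⟨Λ, Γ, C, hΛ, hΓ, hC, habs⟩ := absorb (N := n) (κ := κ) (e := e) (c0 := c1 + c2) (CF := CF) hγ rfl rfl hα0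
    hγ0 hγ1 hμe (by positivity) hCF
  refine ⟨(κ - κ ^ 2 * γ) / 4, C, by positivity, hC, fun R hR => ?_⟩
  set c := cutR n (m + 2) R hR with hc
  set c' := cutR n m R hR with hc'
  refine ⟨fun z => U.N1 c (-κ) z + γ * U.N5 c z + γ * U.N2 c e z - (1 - γ) * U.N3 c z
    + Λ * (U.N4 c z + U.N5 c z) + Γ * ((R ^ 2)⁻¹ * U.N6 c' z), ?_, ?_, ?_⟩
  · exact (((((U.iN1 c _).add ((U.iN5 c).const_mul _)).add ((U.iN2 c e).const_mul _)).sub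
      ((U.iN3 c).const_mul _)).add (((U.iN4 c).add (U.iN5 c)).const_mul _)).add
      (((U.iN6 c').const_mul _).const_mul _)
  · have i1 := U.iN1 c (-κ)
    have i2 := (U.iN5 c).const_mul γ
    have i3 := (U.iN2 c e).const_mul γ
    have i4 := (U.iN3 c).const_mul (1 - γ)
    have i5 : Integrable (fun z => Λ * (U.N4 c z + U.N5 c z)) := ((U.iN4 c).add (U.iN5 c)).const_mul Λ
    have i6 := ((U.iN6 c').const_mul (R ^ 2)⁻¹).const_mul Γ
    have j2 : Integrable (fun z => U.N1 c (-κ) z + γ * U.N5 c z) := i1.add i2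
    have j3 : Integrable (fun z => U.N1 c (-κ) z + γ * U.N5 c z + γ * U.N2 c e z) := j2.add i3
    have j4 : Integrable (fun z => U.N1 c (-κ) z + γ * U.N5 c z + γ * U.N2 c e z - (1 - γ) * U.N3 c z) := j3.sub i4
    have j5 : Integrable (fun z => U.N1 c (-κ) z + γ * U.N5 c z + γ * U.N2 c e z - (1 - γ) * U.N3 c z
      + Λ * (U.N4 c z + U.N5 c z)) := j4.add i5
    rw [integral_add j5 i6, integral_add j4 i5, integral_sub j3 i4, integral_add j2 i3, integral_add i1 i2]
    simp only [integral_const_mul]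
    rw [integral_add (U.iN4 c) (U.iN5 c), U.N5_eq, U.N3_eq, U.N4_eq, U.N6_eq]
    have := U.N1_le c hn (-κ)
    have h3 : γ * ∫ z, U.N2 c e z ≤ 0 := by
      rcases hA with h | h
      · rw [h, zero_mul]
      · exact mul_nonpos_of_nonneg_of_nonpos hγ0 (U.N2_le c h)
    simp only [mul_zero, add_zero, sub_zero]
    linarith
  · intro z
    obtain ⟨p1, p2, p3⟩ := h1 R hR z
    obtain ⟨r1, r2, r3⟩ := h2 R hR z
    have hab : c.a z.1 * c.b z.2 = th n R z ^ (m + 4) := cut_ab n (m + 2) hR z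
    have hab' : c'.a z.1 * c'.b z.2 = th n R z ^ (m + 2) := cut_ab n m hR z
    set θ := th n R z with hθ
    have hθ0 : 0 ≤ θ := th_nonneg n R z
    have hu := U.pos z
    have hR2 : 0 ≤ (R ^ 2)⁻¹ := by positivity
    have hS := U.S_nonneg z
    have hR4 : (R ^ 4)⁻¹ = (R ^ 2)⁻¹ * (R ^ 2)⁻¹ := by rw [← mul_inv]; congr 1; ring
    have key := habs (θ ^ (m + 4)) ((R ^ 2)⁻¹ * θ ^ (m + 2)) ((R ^ 4)⁻¹ * θ ^ m) (U.u z) (U.q z) (f (U.u z))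
      (Sol.F f (U.u z)) (U.L z) (U.ut z) (U.S z) (c.b z.2 * U.D c.a z) (c.b z.2 * c.La z.1)
      (c.a z.1 * c.b' z.2) ((R ^ 2)⁻¹ * (c'.b z.2 * U.D c'.a z)) ((R ^ 2)⁻¹ * (c'.a z.1 * c'.b' z.2))
      (by positivity) (by positivity) (by positivity) (by rw [hR4]; ring) hu (U.q_nonneg z) (hf _ hu)
      (intervalIntegral.integral_nonneg hu fun r hr => hf r hr.1) (hF _ hu) (U.eq z) (U.q_mul_u z).symm
      (p1.trans (mul_le_mul_of_nonneg_right (by linarith) (by positivity)))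
      (p2.trans (mul_le_mul_of_nonneg_right (by linarith) (by positivity)))
      ?_ ?_ ?_
    · refine key.trans (le_of_eq ?_)
      unfold Sol.N1 Sol.N2 Sol.N3 Sol.N4 Sol.N5 Sol.N6
      beta_reduce
      rw [EX_lin, ← hab, ← hab']
      ring
    · have := p3 (fun j => U.p j z)
      refine this.trans ?_
      have e : θ ^ (m + 4) * ((c1 + c2) * ((R ^ 2)⁻¹ * θ ^ (m + 2) * U.S z))
        = (c1 + c2) * ((R ^ 2)⁻¹ * θ ^ (2 * (m + 2) + 2) * U.S z) := by ring
      rw [e, mul_assoc, mul_assoc, ← mul_assoc ((R^2)⁻¹)]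
      exact mul_le_mul_of_nonneg_right (by linarith) (by positivity)
    · rw [abs_mul, abs_of_nonneg hR2]
      have e : (c1 + c2) * ((R ^ 4)⁻¹ * θ ^ m) = (R ^ 2)⁻¹ * ((c1 + c2) * ((R ^ 2)⁻¹ * θ ^ m)) := by rw [hR4]; ring
      rw [e]
      refine mul_le_mul_of_nonneg_left (r1.trans ?_) hR2
      exact mul_le_mul_of_nonneg_right (by linarith) (by positivity)
    · have := r3 (fun j => U.p j z)
      rw [mul_pow]
      have e : (c1 + c2) * ((R ^ 4)⁻¹ * θ ^ m) * ((R ^ 2)⁻¹ * θ ^ (m + 2) * U.S z)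
        = ((R ^ 2)⁻¹) ^ 2 * ((c1 + c2) * ((R ^ 2)⁻¹ * θ ^ (2 * m + 2) * U.S z)) := by rw [hR4]; ring
      rw [e]
      refine mul_le_mul_of_nonneg_left (this.trans ?_) (by positivity)
      rw [mul_assoc, mul_assoc, ← mul_assoc ((R^2)⁻¹)]
      exact mul_le_mul_of_nonneg_right (by linarith) (by positivity)

end
end LV

namespace LV
noncomputable section
open MeasureTheory Topology

theorem pw_one {q c C : ℝ} (hq : 1 < q) (hc : 0 < c) (hC : 0 ≤ C) {m : ℕ} (hm : 4 / (q - 1) ≤ m) {R θ s f : ℝ}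
    (hR : 0 < R) (hθ : 0 ≤ θ) (hθ1 : θ ≤ 1) (hs : 0 ≤ s) (hf : c * s ^ q ≤ f) :
    C * ((R ^ 4)⁻¹ * θ ^ m * s ^ 2) ≤ (R ^ 2)⁻¹ * θ ^ (m + 2) * (s * f)
      + C * (C / c) ^ (2 / (q - 1)) * R ^ (-(4 + 4 / (q - 1))) := by
  have hq1 : 0 < q - 1 := by linarith
  have hf0 : 0 ≤ f := le_trans (by positivity) hf
  rcases hs.eq_or_lt with rfl | hs0
  · simp
    positivity
  by_cases h : C * (R ^ 2)⁻¹ ≤ c * (θ ^ 2 * s ^ (q - 1))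
  · have e1 : s ^ q = s ^ (q - 1) * s := by
      rw [← Real.rpow_add_one hs0.ne']; congr 1; ring
    have : C * ((R ^ 4)⁻¹ * θ ^ m * s ^ 2) ≤ (R ^ 2)⁻¹ * θ ^ (m + 2) * (s * f) := by
      calc C * ((R ^ 4)⁻¹ * θ ^ m * s ^ 2) = (C * (R ^ 2)⁻¹) * ((R ^ 2)⁻¹ * θ ^ m * s ^ 2) := by
            have hR4 : (R ^ 4)⁻¹ = (R ^ 2)⁻¹ * (R ^ 2)⁻¹ := by rw [← mul_inv]; congr 1; ring
            rw [hR4]; ring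
        _ ≤ (c * (θ ^ 2 * s ^ (q - 1))) * ((R ^ 2)⁻¹ * θ ^ m * s ^ 2) :=
            mul_le_mul_of_nonneg_right h (by positivity)
        _ = (R ^ 2)⁻¹ * θ ^ (m + 2) * (s * (c * s ^ q)) := by rw [e1]; ring
        _ ≤ _ := by gcongr
    have : 0 ≤ C * (C / c) ^ (2 / (q - 1)) * R ^ (-(4 + 4 / (q - 1))) := by positivity
    linarith
  · push Not at h
    have h1 : θ ^ 2 * s ^ (q - 1) ≤ C / c * (R ^ 2)⁻¹ := by
      rw [div_mul_eq_mul_div, le_div_iff₀ hc]; linarith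
    have h2 : (θ ^ 2 * s ^ (q - 1)) ^ (2 / (q - 1)) ≤ (C / c * (R ^ 2)⁻¹) ^ (2 / (q - 1)) :=
      Real.rpow_le_rpow (by positivity) h1 (by positivity)
    rw [Real.mul_rpow (by positivity) (by positivity), Real.mul_rpow (by positivity) (by positivity),
      ← Real.rpow_mul hs, ← Real.rpow_natCast θ 2, ← Real.rpow_mul hθ, ← Real.rpow_natCast R 2,
      ← Real.rpow_neg hR.le, ← Real.rpow_mul hR.le] at h2
    have e1 : (q - 1) * (2 / (q - 1)) = (2:ℕ) := by field_simp; norm_num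
    have e2 : ((2:ℕ):ℝ) * (2 / (q - 1)) = 4 / (q - 1) := by push_cast; ring
    have e3 : -((2:ℕ):ℝ) * (2 / (q - 1)) = -(4 / (q - 1)) := by push_cast; ring
    rw [e1, e2, e3, Real.rpow_natCast] at h2
    have h3 : θ ^ m ≤ θ ^ (4 / (q - 1)) := by
      rcases hθ.eq_or_lt with h0 | h0
      · rw [← h0]
        have : m ≠ 0 := by
          rintro rfl
          have : 0 < 4 / (q - 1) := by positivity
          norm_num at hm; linarith
        rw [zero_pow this]; positivity
      · rw [← Real.rpow_natCast]
        exact Real.rpow_le_rpow_of_exponent_ge h0 hθ1 hm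
    have h4 : θ ^ m * s ^ 2 ≤ (C / c) ^ (2 / (q - 1)) * R ^ (-(4 / (q - 1))) :=
      (mul_le_mul_of_nonneg_right h3 (by positivity)).trans h2
    have e4 : R ^ (-(4 + 4 / (q - 1))) = (R ^ 4)⁻¹ * R ^ (-(4 / (q - 1))) := by
      rw [neg_add, Real.rpow_add hR, Real.rpow_neg hR.le]
      congr 2
      exact_mod_cast Real.rpow_natCast R 4
    have h5 : 0 ≤ (R ^ 2)⁻¹ * θ ^ (m + 2) * (s * f) := by positivity
    rw [e4]
    have := mul_le_mul_of_nonneg_left h4 (show 0 ≤ C * (R ^ 4)⁻¹ by positivity)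
    linarith

theorem pw {f : ℝ → ℝ} (hf : ∀ s, 0 ≤ s → 0 ≤ f s) {q c P : ℝ} (hq : 1 < q) (hc : 0 < c)
    (hg : ∀ s, 1 ≤ s → c * s ^ q ≤ f s)
    (hP : P = 4 ∨ ∃ e c' : ℝ, 1 < e ∧ 0 < c' ∧ P = 4 + 4 / (e - 1) ∧ ∀ s, 0 ≤ s → s ≤ 1 → c' * s ^ e ≤ f s) :
    ∃ m : ℕ, m ≠ 0 ∧ ∀ C, 0 ≤ C → ∃ C', 0 ≤ C' ∧ ∀ R θ s : ℝ, 1 ≤ R → 0 ≤ θ → θ ≤ 1 → 0 ≤ s →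
      C * ((R ^ 4)⁻¹ * θ ^ m * s ^ 2) ≤ (R ^ 2)⁻¹ * θ ^ (m + 2) * (s * f s) + C' * R ^ (-P) := by
  rcases hP with hP | ⟨e, c', he, hc', hP, hl⟩
  · obtain ⟨m, hm⟩ := exists_nat_ge (4 / (q - 1))
    have hq1 : 0 < 4 / (q - 1) := div_pos (by norm_num) (by linarith)
    refine ⟨m, ?_, fun C hC => ⟨C + C * (C / c) ^ (2 / (q - 1)), by positivity, fun R θ s hR hθ hθ1 hs => ?_⟩⟩
    · rintro rfl; norm_num at hm; linarith
    have hR0 : 0 < R := by linarith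
    have x1 : 0 ≤ C * R ^ (-P) := by positivity
    have x2 : 0 ≤ C * (C / c) ^ (2 / (q - 1)) * R ^ (-P) := by positivity
    have x3 : 0 ≤ (R ^ 2)⁻¹ * θ ^ (m + 2) * (s * f s) := by have := hf s hs; positivity
    rcases le_total 1 s with h | h
    · have := pw_one hq hc hC hm hR0 hθ hθ1 hs (hg s h)
      have e : R ^ (-(4 + 4 / (q - 1))) ≤ R ^ (-P) := Real.rpow_le_rpow_of_exponent_le hR (by linarith)
      have := mul_le_mul_of_nonneg_left e (show 0 ≤ C * (C / c) ^ (2 / (q - 1)) by positivity)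
      linarith
    · have e : (R ^ 4)⁻¹ = R ^ (-P) := by
        rw [hP, Real.rpow_neg hR0.le]; congr 1; exact_mod_cast (Real.rpow_natCast R 4).symm
      have : C * ((R ^ 4)⁻¹ * θ ^ m * s ^ 2) ≤ C * (R ^ 4)⁻¹ := by
        have h1 : θ ^ m ≤ 1 := pow_le_one₀ hθ hθ1
        have h2 : s ^ 2 ≤ 1 := pow_le_one₀ hs h
        have h3 : θ ^ m * s ^ 2 ≤ 1 := mul_le_one₀ h1 (by positivity) h2
        have := mul_le_mul_of_nonneg_left h3 (show 0 ≤ C * (R ^ 4)⁻¹ by positivity)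
        linarith
      rw [e] at this ⊢
      linarith
  · obtain ⟨r, hr, hrq, hre⟩ : ∃ r, 1 < r ∧ r ≤ q ∧ r ≤ e := ⟨min q e, lt_min hq he, min_le_left _ _, min_le_right _ _⟩
    obtain ⟨m, hm⟩ := exists_nat_ge (4 / (r - 1))
    have hr1 : 0 < 4 / (r - 1) := div_pos (by norm_num) (by linarith)
    have her : 4 / (e - 1) ≤ 4 / (r - 1) := div_le_div_of_nonneg_left (by norm_num) (by linarith) (by linarith)
    refine ⟨m, ?_, fun C hC => ⟨C * (C / c') ^ (2 / (e - 1)) + C * (C / c) ^ (2 / (r - 1)), by positivity, fun R θ s hR hθ hθ1 hs => ?_⟩⟩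
    · rintro rfl; norm_num at hm; linarith
    have hR0 : 0 < R := by linarith
    have x1 : 0 ≤ C * (C / c') ^ (2 / (e - 1)) * R ^ (-P) := by positivity
    have x2 : 0 ≤ C * (C / c) ^ (2 / (r - 1)) * R ^ (-P) := by positivity
    rcases le_total 1 s with h | h
    · have := pw_one hr hc hC hm hR0 hθ hθ1 hs
        (le_trans (mul_le_mul_of_nonneg_left (Real.rpow_le_rpow_of_exponent_le h hrq) hc.le) (hg s h))
      have e : R ^ (-(4 + 4 / (r - 1))) ≤ R ^ (-P) := Real.rpow_le_rpow_of_exponent_le hR (by linarith)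
      have := mul_le_mul_of_nonneg_left e (show 0 ≤ C * (C / c) ^ (2 / (r - 1)) by positivity)
      linarith
    · have := pw_one he hc' hC (her.trans hm) hR0 hθ hθ1 hs (hl s hs h)
      rw [← hP] at this
      linarith

end
end LV

namespace LV
noncomputable section
open MeasureTheory Topology

def KR (n : ℕ) (R : ℝ) : Set ((Fin n → ℝ) × ℝ) := Metric.closedBall 0 (2 * R) ×ˢ Metric.closedBall 0 (2 * R ^ 2)

theorem KR_cpt (n : ℕ) (R : ℝ) : IsCompact (KR n R) := (isCompact_closedBall _ _).prod (isCompact_closedBall _ _)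

theorem th_zero {n : ℕ} {R : ℝ} (hR : 0 < R) {z : (Fin n → ℝ) × ℝ} (hz : z ∉ KR n R) : th n R z = 0 := by
  unfold KR at hz
  rw [mem_prod, not_and_or, Metric.mem_closedBall, Metric.mem_closedBall, dist_zero_right, dist_zero_right,
    not_le, not_le] at hz
  unfold th
  rcases hz with h | h
  · rw [AR_zero hR h.le, zero_mul]
  · rw [BR_zero hR h.le, mul_zero]

theorem th_one {n : ℕ} {R : ℝ} (hR : 0 < R) {z : (Fin n → ℝ) × ℝ} (h1 : ‖z.1‖ ≤ R) (h2 : |z.2| ≤ R ^ 2) :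
    th n R z = 1 := by
  unfold th
  rw [AR_one hR h1, BR_one hR h2, mul_one]

theorem KR_vol (n : ℕ) {R : ℝ} (hR : 0 < R) : volume.real (KR n R) = (4 * R) ^ n * (4 * R ^ 2) := by
  unfold KR Measure.real
  rw [Measure.volume_eq_prod, Measure.prod_prod, Real.volume_pi_closedBall _ (by positivity), Real.volume_closedBall,
    ENNReal.toReal_mul, ENNReal.toReal_ofReal (by positivity), ENNReal.toReal_ofReal (by positivity)]
  simp
  ring

/-- Abstract conclusion. -/
theorem liouville {n : ℕ} {f : ℝ → ℝ} (U : Sol n f) (hn : 1 ≤ n) {κ e γ CF P q c : ℝ}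
    (hγ : γ = ((n:ℝ) - 1) / n) (hα0 : 0 < κ - κ ^ 2 * γ) (hμe : γ * e ≤ κ * (2 / n + 1))
    (hf : ∀ s, 0 ≤ s → 0 ≤ f s) (hfp : ∀ s, 0 < s → 0 < f s)
    (hF : ∀ s, 0 ≤ s → Sol.F f s ≤ CF * (s * f s)) (hCF : 0 ≤ CF)
    (hA : γ = 0 ∨ AntitoneOn (fun s : ℝ => f s / s ^ e) (Ioi 0))
    (hq : 1 < q) (hc : 0 < c) (hg : ∀ s, 1 ≤ s → c * s ^ q ≤ f s)
    (hP : P = 4 ∨ ∃ e c' : ℝ, 1 < e ∧ 0 < c' ∧ P = 4 + 4 / (e - 1) ∧ ∀ s, 0 ≤ s → s ≤ 1 → c' * s ^ e ≤ f s)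
    (hPn : (n:ℝ) + 2 < P) : ∀ z, U.u z = 0 := by
  obtain ⟨m, hm0, hm⟩ := pw hf hq hc hg hP
  obtain ⟨α, C, hα, hC, hE⟩ := energy U hn m hγ hα0 hμe hf hF hCF hA
  obtain ⟨C', hC', hpw⟩ := hm C hC
  let G : ℝ → (Fin n → ℝ) × ℝ → ℝ := fun R z => th n R z ^ (m + 4) * (α * U.q z ^ 2 + U.ut z ^ 2)
  have hG : ∀ R z, G R z = th n R z ^ (m + 4) * (α * U.q z ^ 2 + U.ut z ^ 2) := fun R z => rfl
  have Gint : ∀ R, 0 < R → Integrable (G R) := by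
    intro R hR
    have := U.cut; have := th_cont n R
    refine U.int_q (Φ := fun y => th n R y.1 ^ (m + 4) * (α * y.2 ^ 2 + U.ut y.1 ^ 2)) (by fun_prop) (KR_cpt n R) ?_
    intro z hz r
    simp [th_zero hR hz]
  have G0 : ∀ R z, 0 ≤ G R z := fun R z => by
    have := th_nonneg n R z
    rw [hG]; positivity
  have Gle : ∀ R, 1 ≤ R → ∫ z, G R z ≤ C' * R ^ (-P) * ((4 * R) ^ n * (4 * R ^ 2)) := by
    intro R hR
    have hR0 : 0 < R := by linarith
    obtain ⟨H, hHi, hH0, hH⟩ := hE R hR0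
    have hind : Integrable ((KR n R).indicator fun _ => C' * R ^ (-P)) := by
      rw [integrable_indicator_iff (KR_cpt n R).isClosed.measurableSet]
      exact integrableOn_const (KR_cpt n R).measure_lt_top.ne
    have : ∫ z, G R z ≤ ∫ z, (H z + (KR n R).indicator (fun _ => C' * R ^ (-P)) z) := by
      refine integral_mono (Gint R hR0) (hHi.add hind) fun z => ?_
      have h1 := hH z
      have h2 := hpw R (th n R z) (U.u z) hR (th_nonneg n R z) (th_le n R z) (U.pos z)
      by_cases hz : z ∈ KR n R
      · simp only [indicator_of_mem hz, hG]
        linarith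
      · simp only [indicator_of_notMem hz, hG]
        have := th_zero hR0 hz
        rw [this] at h1
        simp [hm0] at h1
        simpa [this] using h1
    rw [integral_add hHi hind, integral_indicator (KR_cpt n R).isClosed.measurableSet, setIntegral_const, KR_vol n hR0,
      smul_eq_mul] at this
    linarith
  have Gmono : ∀ r R, 1 ≤ r → 2 * r ≤ R → ∫ z, G r z ≤ ∫ z, G R z := by
    intro r R hr hR
    refine integral_mono (Gint r (by linarith)) (Gint R (by linarith)) fun z => ?_
    by_cases hz : z ∈ KR n r
    · simp only [hG]
      unfold KR at hz
      rw [mem_prod, Metric.mem_closedBall, Metric.mem_closedBall, dist_zero_right, dist_zero_right, Real.norm_eq_abs] at hz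
      rw [th_one (R := R) (by linarith) (hz.1.trans hR) (hz.2.trans (by nlinarith))]
      refine mul_le_mul_of_nonneg_right ?_ (by positivity)
      rw [one_pow]
      exact pow_le_one₀ (th_nonneg _ _ _) (th_le _ _ _)
    · have : G r z = 0 := by simp [hG, th_zero (by linarith : 0 < r) hz]
      rw [this]; exact G0 _ _
  have lim : Tendsto (fun R : ℝ => C' * R ^ (-P) * ((4 * R) ^ n * (4 * R ^ 2))) atTop (𝓝 0) := by
    have h1 : Tendsto (fun R : ℝ => C' * 4 ^ n * 4 * R ^ (-(P - (n + 2)))) atTop (𝓝 (C' * 4 ^ n * 4 * 0)) :=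
      (tendsto_rpow_neg_atTop (by linarith)).const_mul _
    rw [mul_zero] at h1
    refine h1.congr' ?_
    filter_upwards [eventually_gt_atTop 0] with R hR
    have : R ^ (-(P - ((n:ℝ) + 2))) = R ^ (-P) * (R ^ n * R ^ 2) := by
      rw [← pow_add, ← Real.rpow_natCast R (n + 2), ← Real.rpow_add hR]
      congr 1; push_cast; ring
    rw [this]; ring
  have Gz : ∀ r, 1 ≤ r → ∫ z, G r z = 0 := by
    intro r hr
    refine le_antisymm (ge_of_tendsto lim ?_) (integral_nonneg (G0 r))
    filter_upwards [eventually_ge_atTop (2 * r)] with R hR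
    exact (Gmono r R hr hR).trans (Gle R (by linarith))
  have key : ∀ z, U.S z = 0 ∧ U.ut z = 0 := by
    intro z
    obtain ⟨r, hr1, hr2, hr3⟩ : ∃ r : ℝ, 1 ≤ r ∧ ‖z.1‖ ≤ r ∧ |z.2| ≤ r ^ 2 := by
      refine ⟨1 + ‖z.1‖ + |z.2|, ?_, ?_, ?_⟩
      · linarith [norm_nonneg z.1, abs_nonneg z.2]
      · linarith [norm_nonneg z.1, abs_nonneg z.2]
      · nlinarith [norm_nonneg z.1, abs_nonneg z.2, mul_nonneg (norm_nonneg z.1) (abs_nonneg z.2)]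
    have hr0 : 0 < r := by linarith
    have h1 := (integral_eq_zero_iff_of_nonneg (G0 r) (Gint r hr0)).mp (Gz r hr1)
    have h2 : (fun z => th n r z * (U.S z ^ 2 + U.ut z ^ 2)) =ᵐ[volume] fun _ => (0:ℝ) := by
      filter_upwards [h1] with w hw
      have hw' : th n r w ^ (m + 4) * (α * U.q w ^ 2 + U.ut w ^ 2) = 0 := hw
      rcases mul_eq_zero.mp hw' with h | h
      · rw [pow_eq_zero_iff (by omega)] at h
        rw [h, zero_mul]
      · have a1 : 0 ≤ α * U.q w ^ 2 := by positivity
        have a2 : 0 ≤ U.ut w ^ 2 := by positivity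
        have a3 : U.ut w ^ 2 = 0 := by linarith
        have a4 : α * U.q w ^ 2 = 0 := by linarith
        have a5 : U.q w = 0 := by
          rcases mul_eq_zero.mp a4 with h | h
          · linarith
          · exact pow_eq_zero_iff (by norm_num) |>.mp h
        rw [a3, ← U.q_mul_u, a5]; ring
    have := U.cS; have := U.cut; have := th_cont n r
    have h3 := (Continuous.ae_eq_iff_eq volume (by fun_prop) (by fun_prop)).mp h2
    have h4 := congrFun h3 z
    simp only [th_one hr0 hr2 hr3, one_mul] at h4
    constructor
    · nlinarith [sq_nonneg (U.S z), sq_nonneg (U.ut z)]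
    · nlinarith [sq_nonneg (U.S z), sq_nonneg (U.ut z)]
  have hp : ∀ i z, U.p i z = 0 := by
    intro i z
    have h1 := (key z).1
    unfold Sol.S at h1
    have := (Finset.sum_eq_zero_iff_of_nonneg (fun j _ => sq_nonneg (U.p j z))).mp h1 i (Finset.mem_univ i)
    exact pow_eq_zero_iff (by norm_num) |>.mp this
  have hh : ∀ i z, U.h i z = 0 := by
    rintro i ⟨x, t⟩
    have h1 := U.dh i t x
    simp only [hp] at h1
    exact h1.unique (hasDerivAt_const _ _)
  intro z
  have h1 := U.eq z
  rw [(key z).2] at h1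
  simp only [hh, Finset.sum_const_zero, zero_add] at h1
  by_contra h
  exact absurd h1 (hfp _ (lt_of_le_of_ne (U.pos z) (Ne.symm h))).ne

end
end LV

namespace LV
noncomputable section
open MeasureTheory Topology

theorem iter_bound {f : ℝ → ℝ} {I : Set ℝ} (hI : ∀ s ∈ I, 0 < s) (hoc : I.OrdConnected) (hf : ∀ s, 0 < s → 0 < f s)
    {ρ q C : ℝ} (hρ : 0 < ρ) (hρ1 : ρ < 1) (hq : 0 < q) (hC : 0 ≤ C)
    (h : ∀ μ ∈ I, (∀ r, ρ * μ ≤ r → r ≤ μ → f r ≤ C * f μ) ∧ f (ρ * μ) ≤ ρ ^ q * f μ) :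
    ∀ r ∈ I, ∀ s ∈ I, r ≤ s → f r ≤ C * (ρ ^ q)⁻¹ * (r / s) ^ q * f s := by
  have hρq : 0 < ρ ^ q := by positivity
  have base : ∀ r ∈ I, ∀ s ∈ I, r ≤ s → ρ * s ≤ r → f r ≤ C * (ρ ^ q)⁻¹ * (r / s) ^ q * f s := by
    intro r hr s hs hrs h1
    have hs0 := hI s hs
    have hfs := hf s hs0
    refine ((h s hs).1 r h1 hrs).trans ?_
    have : ρ ^ q ≤ (r / s) ^ q := Real.rpow_le_rpow hρ.le (by rwa [le_div_iff₀ hs0]) hq.le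
    have h2 : 1 ≤ (ρ ^ q)⁻¹ * (r / s) ^ q := by
      rw [inv_mul_eq_div, le_div_iff₀ hρq]; linarith
    have := mul_le_mul_of_nonneg_left h2 (show 0 ≤ C * f s by positivity)
    linarith
  have key : ∀ k : ℕ, ∀ r ∈ I, ∀ s ∈ I, r ≤ s → ρ ^ (k + 1) * s ≤ r →
      f r ≤ C * (ρ ^ q)⁻¹ * (r / s) ^ q * f s := by
    intro k
    induction k with
    | zero => intro r hr s hs hrs h1; exact base r hr s hs hrs (by simpa using h1)
    | succ k ih =>
      intro r hr s hs hrs h1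
      rcases le_total (ρ * s) r with h2 | h2
      · exact base r hr s hs hrs h2
      · have hs0 := hI s hs
        have hr0 := hI r hr
        have hs' : ρ * s ∈ I := hoc.out hr hs ⟨h2, by nlinarith⟩
        have h3 := ih r hr (ρ * s) hs' h2 (by rw [pow_succ] at h1; linarith)
        have h4 := (h s hs).2
        refine h3.trans ?_
        have e : (r / (ρ * s)) ^ q = (ρ ^ q)⁻¹ * (r / s) ^ q := by
          rw [← Real.inv_rpow hρ.le, ← Real.mul_rpow (by positivity) (by positivity)]
          congr 1
          field_simp
        rw [e]
        have := mul_le_mul_of_nonneg_left h4 (show 0 ≤ C * (ρ ^ q)⁻¹ * ((ρ ^ q)⁻¹ * (r / s) ^ q) by positivity)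
        refine this.trans (le_of_eq ?_)
        field_simp
  intro r hr s hs hrs
  have hs0 := hI s hs
  have hr0 := hI r hr
  obtain ⟨k, hk⟩ := exists_pow_lt_of_lt_one (div_pos hr0 hs0) hρ1
  refine key k r hr s hs hrs ?_
  rw [lt_div_iff₀ hs0] at hk
  have : ρ ^ (k + 1) * s ≤ ρ ^ k * s :=
    mul_le_mul_of_nonneg_right (pow_le_pow_of_le_one hρ.le hρ1.le (by omega)) hs0.le
  linarith

theorem rv_local {f : ℝ → ℝ} (hfc : ContinuousOn f (Ici 0)) (hf : ∀ s, 0 < s → 0 < f s) {l : Filter ℝ}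
    [l.IsCountablyGenerated] (hl0 : ∀ᶠ x in l, 0 < x) (hlm : ∀ c : ℝ, 0 < c → Tendsto (fun x => x * c) l l)
    {m : ℝ} (hm : 1 < m) (hrv : ∀ s : ℝ, 0 < s → Tendsto (fun lam : ℝ => f (lam * s) / f lam) l (𝓝 (s ^ m))) :
    ∃ ρ q C : ℝ, 0 < ρ ∧ ρ < 1 ∧ 1 < q ∧ 0 ≤ C ∧
      ∀ᶠ μ in l, (∀ r, ρ * μ ≤ r → r ≤ μ → f r ≤ C * f μ) ∧ f (ρ * μ) ≤ ρ ^ q * f μ := by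
  obtain ⟨S, hS⟩ := l.exists_antitone_basis
  let E : ℕ → Set ℝ := fun N => {x | ∀ lam ∈ S N, 0 < lam → f (lam * Real.exp x) ≤ N * f lam}
  have hE : ∀ N, IsClosed (E N) := by
    intro N
    simp only [E, ofPred_forall]
    refine isClosed_iInter fun lam => isClosed_iInter fun _ => isClosed_iInter fun h0 => ?_
    refine isClosed_le ?_ continuous_const
    exact hfc.comp_continuous (by fun_prop) fun x => by
      have := Real.exp_pos x
      simp only [mem_Ici]; positivity
  have ev : ∀ s : ℝ, 0 < s → ∀ B : ℝ, s ^ m < B → ∀ᶠ lam in l, f (lam * s) ≤ B * f lam := by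
    intro s hs B hB
    filter_upwards [(hrv s hs).eventually (gt_mem_nhds hB), hl0] with lam h1 h2
    rw [div_lt_iff₀ (hf lam h2)] at h1
    exact h1.le
  have hU : ⋃ N, E N = univ := by
    rw [eq_univ_iff_forall]
    intro x
    have h1 := ev (Real.exp x) (Real.exp_pos x) (Real.exp x ^ m + 1) (by linarith)
    obtain ⟨N1, hN1⟩ := hS.eventually_subset h1 |>.exists
    obtain ⟨N2, hN2⟩ := exists_nat_ge (Real.exp x ^ m + 1)
    refine mem_iUnion.mpr ⟨max N1 N2, fun lam hlam h0 => ?_⟩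
    have h2 := hN1 (hS.antitone (le_max_left N1 N2) hlam)
    refine (show f (lam * Real.exp x) ≤ _ from h2).trans (mul_le_mul_of_nonneg_right ?_ (hf lam h0).le)
    refine hN2.trans ?_
    exact_mod_cast le_max_right N1 N2
  obtain ⟨N, x, hx⟩ := nonempty_interior_of_iUnion_of_closed hE hU
  rw [mem_interior_iff_mem_nhds, Metric.mem_nhds_iff] at hx
  obtain ⟨ε, hε, hball⟩ := hx
  obtain ⟨q, hq1, hqm⟩ := exists_between hm
  set b := x with hb
  set a := x - ε / 2 with ha
  have hab : ∀ y, a ≤ y → y ≤ b → y ∈ E N := by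
    intro y h1 h2
    apply hball
    rw [Metric.mem_ball, Real.dist_eq, abs_lt]
    constructor <;> linarith
  refine ⟨Real.exp (a - b), q, N * (Real.exp (-b) ^ m + 1), Real.exp_pos _, ?_, hq1, by positivity, ?_⟩
  · rw [Real.exp_lt_one_iff]; linarith
  have e1 := ev (Real.exp (-b)) (Real.exp_pos _) (Real.exp (-b) ^ m + 1) (by linarith)
  have e2 := ev (Real.exp (a - b)) (Real.exp_pos _) (Real.exp (a - b) ^ q)
    (Real.rpow_lt_rpow_of_exponent_gt (Real.exp_pos _) (by rw [Real.exp_lt_one_iff]; linarith) hqm)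
  have e3 := (hlm (Real.exp (-b)) (Real.exp_pos _)).eventually (hS.mem N)
  filter_upwards [e1, e2, e3, hl0] with μ h1 h2 h3 h4
  refine ⟨fun r hr1 hr2 => ?_, by rwa [mul_comm]⟩
  have hr0 : 0 < r := lt_of_lt_of_le (by positivity) hr1
  set lam := μ * Real.exp (-b) with hlam
  have hlam0 : 0 < lam := by positivity
  have hy := hab (Real.log (r / lam)) ?_ ?_ lam h3 hlam0
  · rw [Real.exp_log (by positivity), mul_div_cancel₀ _ hlam0.ne'] at hy
    refine hy.trans ?_
    rw [mul_assoc]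
    exact mul_le_mul_of_nonneg_left h1 (Nat.cast_nonneg _)
  · rw [Real.le_log_iff_exp_le (by positivity), le_div_iff₀ hlam0, hlam]
    refine le_trans (le_of_eq ?_) hr1
    rw [sub_eq_add_neg, Real.exp_add]; ring
  · rw [Real.log_le_iff_le_exp (by positivity), div_le_iff₀ hlam0, hlam]
    refine hr2.trans (le_of_eq ?_)
    rw [mul_comm, mul_assoc, ← Real.exp_add]; simp

def AM (f : ℝ → ℝ) (C : ℝ) (I : Set ℝ) : Prop := ∀ r ∈ I, ∀ s ∈ I, r ≤ s → f r ≤ C * f s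

theorem AM.glue {f : ℝ → ℝ} {C C' a b : ℝ} (ha : 0 < a) (hab : a ≤ b) (hfc : ContinuousOn f (Ici 0))
    (hf : ∀ s, 0 < s → 0 < f s) (h1 : AM f C (Ioc 0 a)) (h2 : AM f C' (Ici b)) : ∃ K, 0 ≤ K ∧ AM f K (Ioi 0) := by
  have hc : ContinuousOn f (Icc a b) := hfc.mono fun x hx => ha.le.trans hx.1
  obtain ⟨x0, hx0, hmin⟩ := isCompact_Icc.exists_isMinOn ⟨a, left_mem_Icc.mpr hab⟩ hc
  obtain ⟨x1, hx1, hmax⟩ := isCompact_Icc.exists_isMaxOn ⟨a, left_mem_Icc.mpr hab⟩ hc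
  have hx00 : 0 < f x0 := hf _ (ha.trans_le hx0.1)
  have hx10 : 0 < f x1 := hf _ (ha.trans_le hx1.1)
  have hx01 : f x0 ≤ f x1 := hmin hx1
  set B := f x1 / f x0 with hB
  have hB1 : 1 ≤ B := by rw [hB, one_le_div hx00]; exact hx01
  have hmid : ∀ r ∈ Icc a b, ∀ s ∈ Icc a b, f r ≤ B * f s := by
    intro r hr s hs
    have i1 : f r ≤ f x1 := hmax hr
    have i2 : f x0 ≤ f s := hmin hs
    rw [hB, div_mul_eq_mul_div, le_div_iff₀ hx00]
    have := hf r (ha.trans_le hr.1)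
    nlinarith
  have hC1 : 1 ≤ C := by
    have := h1 a ⟨ha, le_rfl⟩ a ⟨ha, le_rfl⟩ le_rfl
    have := hf a ha
    by_contra h; push Not at h; nlinarith
  have hC'1 : 1 ≤ C' := by
    have := h2 b self_mem_Ici b self_mem_Ici le_rfl
    have := hf b (ha.trans_le hab)
    by_contra h; push Not at h; nlinarith
  have s1 : ∀ r ∈ Ici a, ∀ s ∈ Ici a, r ≤ s → f r ≤ B * C' * f s := by
    intro r hr s hs hrs
    have hr : a ≤ r := hr
    have hs : a ≤ s := hs
    have hfs := hf s (ha.trans_le hs)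
    have hfr := hf r (ha.trans_le hr)
    rcases le_total s b with h | h
    · have := hmid r ⟨hr, hrs.trans h⟩ s ⟨hs, h⟩
      have : B * f s * 1 ≤ B * f s * C' := mul_le_mul_of_nonneg_left hC'1 (by positivity)
      linarith
    · rcases le_total r b with h' | h'
      · have i1 := hmid r ⟨hr, h'⟩ b ⟨hab, le_rfl⟩
        have i2 := h2 b self_mem_Ici s h h
        have := mul_le_mul_of_nonneg_left i2 (by positivity : 0 ≤ B)
        linarith
      · have i2 := h2 r h' s h hrs
        have : C' * f s * 1 ≤ C' * f s * B := mul_le_mul_of_nonneg_left hB1 (by positivity)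
        linarith
  refine ⟨C * (B * C'), by positivity, fun r hr s hs hrs => ?_⟩
  have hr : 0 < r := hr
  have hfs := hf s hs
  rcases le_total s a with h | h
  · have i1 := h1 r ⟨hr, hrs.trans h⟩ s ⟨hs, h⟩ hrs
    have : 1 ≤ B * C' := by nlinarith
    have : C * f s * 1 ≤ C * f s * (B * C') := mul_le_mul_of_nonneg_left this (by positivity)
    linarith
  · rcases le_total r a with h' | h'
    · have i1 := h1 r ⟨hr, h'⟩ a ⟨ha, le_rfl⟩ h'
      have i2 := s1 a self_mem_Ici s h h
      have := mul_le_mul_of_nonneg_left i2 (by positivity : 0 ≤ C)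
      linarith
    · have i2 := s1 r h' s h hrs
      have hp : 0 ≤ B * C' * f s := by positivity
      have : B * C' * f s * 1 ≤ B * C' * f s * C := mul_le_mul_of_nonneg_left hC1 hp
      linarith

theorem growth {f : ℝ → ℝ} {q c b : ℝ} (hq : 0 < q) (hc : 0 < c) (hfc : ContinuousOn f (Ici 0))
    (hf : ∀ s, 0 < s → 0 < f s) (h : ∀ s, b ≤ s → c * s ^ q ≤ f s) :
    ∃ c' : ℝ, 0 < c' ∧ ∀ s, 1 ≤ s → c' * s ^ q ≤ f s := by
  rcases le_total b 1 with hb | hb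
  · exact ⟨c, hc, fun s hs => h s (hb.trans hs)⟩
  have hcc : ContinuousOn f (Icc 1 b) := hfc.mono fun x hx => zero_le_one.trans hx.1
  obtain ⟨x0, hx0, hmin⟩ := isCompact_Icc.exists_isMinOn ⟨1, left_mem_Icc.mpr hb⟩ hcc
  have hx00 : 0 < f x0 := hf _ (one_pos.trans_le hx0.1)
  have hb0 : 0 < b := by linarith
  refine ⟨min c (f x0 / b ^ q), lt_min hc (by positivity), fun s hs => ?_⟩
  rcases le_total b s with h1 | h1
  · exact (mul_le_mul_of_nonneg_right (min_le_left _ _) (by positivity)).trans (h s h1)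
  · have i1 : f x0 ≤ f s := hmin ⟨hs, h1⟩
    refine le_trans ?_ i1
    calc min c (f x0 / b ^ q) * s ^ q ≤ f x0 / b ^ q * b ^ q :=
          mul_le_mul (min_le_right _ _) (Real.rpow_le_rpow (by linarith) h1 hq.le) (by positivity) (by positivity)
      _ = f x0 := by field_simp

theorem fcond {f : ℝ → ℝ} (hfc : ContinuousOn f (Ici 0)) (hf : ∀ s, 0 < s → 0 < f s)
    (hB : (∃ m₀ m₁ : ℝ, 1 < m₀ ∧ 1 < m₁ ∧
            (∀ s : ℝ, 0 < s → Tendsto (fun lam : ℝ => f (lam * s) / f lam)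
              (nhdsWithin 0 (Ioi 0)) (nhds (s ^ m₀))) ∧
            (∀ s : ℝ, 0 < s → Tendsto (fun lam : ℝ => f (lam * s) / f lam)
              atTop (nhds (s ^ m₁)))) ∨
          (∃ q σ s₀ s₁ : ℝ, 1 < q ∧ 0 < σ ∧ 0 < s₀ ∧ 0 < s₁ ∧
            MonotoneOn f (Ici s₀) ∧
            (∀ s : ℝ, s₀ ≤ s → s ^ q ≤ f s) ∧
            MonotoneOn (fun s : ℝ => f s / s ^ σ) (Ioc 0 s₁))) :
    (∃ K, 0 ≤ K ∧ AM f K (Ioi 0)) ∧ ∃ q c : ℝ, 1 < q ∧ 0 < c ∧ ∀ s, 1 ≤ s → c * s ^ q ≤ f s := by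
  rcases hB with ⟨m0, m1, hm0, hm1, h0, h1⟩ | ⟨q, σ, s0, s1, hq, hσ, hs0, hs1, hmono, hgr, hmono1⟩
  · have tosimple : ∀ {I : Set ℝ} {ρ q C : ℝ}, (∀ s ∈ I, 0 < s) → 0 < ρ → 1 < q → 0 ≤ C →
        (∀ r ∈ I, ∀ s ∈ I, r ≤ s → f r ≤ C * (ρ ^ q)⁻¹ * (r / s) ^ q * f s) → AM f (C * (ρ ^ q)⁻¹) I := by
      intro I ρ q C hI hρ hq hC h r hr s hs hrs
      refine (h r hr s hs hrs).trans ?_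
      have hr0 := hI r hr
      have hs0 := hI s hs
      have hfs := hf s hs0
      have : (r / s) ^ q ≤ 1 := Real.rpow_le_one (by positivity) (by rwa [div_le_one hs0]) (by linarith)
      have := mul_le_mul_of_nonneg_left this (show 0 ≤ C * (ρ ^ q)⁻¹ * f s by positivity)
      linarith
    obtain ⟨ρ, q, C, hρ, hρ1, hq, hC, hev⟩ := rv_local hfc hf (l := 𝓝[>] (0:ℝ)) self_mem_nhdsWithin (by
      intro c hc
      refine tendsto_nhdsWithin_iff.mpr ⟨?_, ?_⟩
      · have : Tendsto (fun x : ℝ => x * c) (𝓝 0) (𝓝 (0 * c)) := (continuous_mul_const c).tendsto 0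
        rw [zero_mul] at this
        exact this.mono_left nhdsWithin_le_nhds
      · filter_upwards [self_mem_nhdsWithin] with x hx
        have hx : 0 < x := hx
        simp only [mem_Ioi]; positivity) hm0 h0
    obtain ⟨ρ', q', C', hρ', hρ1', hq', hC', hev'⟩ := rv_local hfc hf (l := atTop) (eventually_gt_atTop 0) (fun c hc =>
      tendsto_id.atTop_mul_const hc) hm1 h1
    obtain ⟨a, ha, hev⟩ := mem_nhdsGT_iff_exists_Ioc_subset.mp hev
    obtain ⟨b0, hb0⟩ := eventually_atTop.mp hev'
    have ha : 0 < a := ha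
    set b := max a b0 with hb
    have hab : a ≤ b := le_max_left _ _
    have hb1 : 0 < b := ha.trans_le hab
    have k1 := iter_bound (I := Ioc 0 a) (fun s hs => hs.1) ordConnected_Ioc hf hρ hρ1 (by linarith) hC fun μ hμ => hev hμ
    have k2 := iter_bound (I := Ici b) (fun s hs => hb1.trans_le hs) ordConnected_Ici hf hρ' hρ1' (by linarith) hC'
      fun μ hμ => hb0 μ ((le_max_right _ _).trans hμ)
    refine ⟨AM.glue ha hab hfc hf (tosimple (fun s hs => hs.1) hρ hq hC k1)
      (tosimple (fun s hs => hb1.trans_le hs) hρ' hq' hC' k2), q', ?_⟩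
    have hfb := hf b hb1
    have hCp : 0 < C' * (ρ' ^ q')⁻¹ := by
      have := k2 b self_mem_Ici b self_mem_Ici le_rfl
      rw [div_self hb1.ne', Real.one_rpow, mul_one] at this
      by_contra h; push Not at h
      nlinarith
    set D := C' * (ρ' ^ q')⁻¹ with hD
    obtain ⟨c, hc, hcc⟩ := growth (q := q') (c := f b / (D * b ^ q')) (b := b) (by linarith) (by positivity) hfc hf (by
      intro s hs
      have hs0 : 0 < s := hb1.trans_le hs
      have := k2 b self_mem_Ici s hs hs
      rw [Real.div_rpow hb1.le hs0.le] at this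
      have hsq : 0 < s ^ q' := by positivity
      have hbq : 0 < b ^ q' := by positivity
      rw [div_mul_eq_mul_div, div_le_iff₀ (by positivity)]
      have := mul_le_mul_of_nonneg_right this hsq.le
      refine this.trans (le_of_eq ?_)
      field_simp)
    exact ⟨c, hq', hc, hcc⟩
  · constructor
    · set b := max s0 s1
      refine AM.glue (C := 1) (C' := 1) hs1 (le_max_right s0 s1) hfc hf ?_ ?_
      · intro r hr s hs hrs
        have h := hmono1 hr hs hrs
        simp only at h
        have hr0 : 0 < r := hr.1
        have hs0 : 0 < s := hs.1
        rw [one_mul]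
        have hrs' : r ^ σ ≤ s ^ σ := Real.rpow_le_rpow hr0.le hrs hσ.le
        have hfs := hf s hs0
        have e1 : f r = f r / r ^ σ * r ^ σ := by field_simp
        have e2 : f s = f s / s ^ σ * s ^ σ := by field_simp
        rw [e1, e2]
        exact mul_le_mul h hrs' (by positivity) (by positivity)
      · intro r hr s hs hrs
        rw [one_mul]
        exact hmono ((le_max_left s0 s1).trans hr) ((le_max_left s0 s1).trans hs) hrs
    · obtain ⟨c, hc, hcc⟩ := growth (q := q) (c := 1) (b := s0) (by linarith) one_pos hfc hf (by
        intro s hs; rw [one_mul]; exact hgr s hs)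
      exact ⟨q, c, hq, hc, hcc⟩

end
end LV

namespace LV
noncomputable section
open MeasureTheory Topology

theorem final {n : ℕ} (hn : 1 ≤ n) {f : ℝ → ℝ}
    (hf_cont : ContinuousOn f (Ici 0)) (hf_pos : ∀ s : ℝ, 0 < s → 0 < f s)
    (hA : n = 1 ∨ ∃ p : ℝ, 1 < p ∧ p < ((n : ℝ) * ((n : ℝ) + 2)) / ((n : ℝ) - 1) ^ 2 ∧
      AntitoneOn (fun s : ℝ => f s / s ^ p) (Ioi 0))
    (hK : ∃ K, 0 ≤ K ∧ AM f K (Ioi 0))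
    (hG : ∃ q c : ℝ, 1 < q ∧ 0 < c ∧ ∀ s, 1 ≤ s → c * s ^ q ≤ f s)
    {g : ℝ → ℝ} (hgdef : g = fun s => f (max s 0)) (U : Sol n g) : ∀ z, U.u z = 0 := by
  obtain ⟨K, hK0, hK⟩ := hK
  obtain ⟨q, c, hq, hc, hg⟩ := hG
  have hf0 : ∀ s, 0 ≤ s → 0 ≤ f s := by
    intro s hs
    rcases hs.eq_or_lt with rfl | h
    · have h1 : Tendsto f (𝓝[>] 0) (𝓝 (f 0)) :=
        (hf_cont 0 self_mem_Ici).mono_left (nhdsWithin_mono _ Ioi_subset_Ici_self)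
      refine ge_of_tendsto h1 ?_
      filter_upwards [self_mem_nhdsWithin] with x hx
      exact (hf_pos x hx).le
    · exact (hf_pos s h).le
  have gf : ∀ s, 0 ≤ s → g s = f s := fun s hs => by simp only [hgdef, max_eq_left hs]
  have g0 : ∀ s, 0 ≤ s → 0 ≤ g s := fun s hs => by rw [gf s hs]; exact hf0 s hs
  have gp : ∀ s, 0 < s → 0 < g s := fun s hs => by rw [gf s hs.le]; exact hf_pos s hs
  have gg : ∀ s, 1 ≤ s → c * s ^ q ≤ g s := fun s hs => by rw [gf s (by linarith)]; exact hg s hs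
  have gF : ∀ s, 0 ≤ s → Sol.F g s ≤ K * (s * g s) := by
    intro s hs
    unfold Sol.F
    have hgc : Continuous g := U.cf
    have : ∫ r in (0:ℝ)..s, g r ≤ ∫ r in (0:ℝ)..s, K * g s := by
      refine intervalIntegral.integral_mono_on_of_le_Ioo hs (hgc.intervalIntegrable _ _)
        (continuous_const.intervalIntegrable _ _) fun r hr => ?_
      rw [gf r hr.1.le, gf s hs]
      exact hK r hr.1 s (hr.1.trans hr.2) hr.2.le
    rw [intervalIntegral.integral_const, smul_eq_mul, sub_zero] at this
    linarith
  have hn0 : (1:ℝ) ≤ n := by exact_mod_cast hn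
  by_cases hn1 : n = 1
  · have hγ : (0:ℝ) = ((n:ℝ) - 1) / n := by rw [hn1]; simp
    refine liouville U hn (κ := 1) (e := 0) (P := 4) hγ (by norm_num) (by rw [zero_mul]; positivity) g0 gp gF hK0
      (Or.inl rfl) hq hc gg (Or.inl rfl) ?_
    rw [hn1]; norm_num
  · obtain ⟨e, he1, he2, hanti⟩ := hA.resolve_left hn1
    have hn2 : (2:ℝ) ≤ n := by
      have : 2 ≤ n := by omega
      exact_mod_cast this
    have hnm : 0 < (n:ℝ) - 1 := by linarith
    have hNp : 0 < (n:ℝ) := by linarith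
    have he3 : e * (n - 1) ^ 2 < n * (n + 2) := by rwa [lt_div_iff₀ (by positivity)] at he2
    obtain ⟨κ, hκ1, hκ2⟩ : ∃ κ, e * (n - 1) / (n + 2) < κ ∧ κ < (n:ℝ) / (n - 1) := by
      apply exists_between
      rw [div_lt_div_iff₀ (by positivity) hnm]
      nlinarith
    have hκ0 : 0 < κ := lt_trans (by positivity) hκ1
    rw [div_lt_iff₀ (by positivity)] at hκ1
    rw [lt_div_iff₀ hnm] at hκ2
    refine liouville U hn (κ := κ) (e := e) (P := 4 + 4 / (e - 1)) rfl ?_ ?_ g0 gp gF hK0 (Or.inr ?_) hq hc gg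
      (Or.inr ⟨e, f 1, he1, hf_pos 1 one_pos, rfl, ?_⟩) ?_
    · have : κ - κ ^ 2 * (((n:ℝ) - 1) / n) = κ * (n - κ * (n - 1)) / n := by field_simp
      rw [this]
      have : 0 < (n:ℝ) - κ * (n - 1) := by linarith
      positivity
    · have e1 : ((n:ℝ) - 1) / n * e = (e * (n - 1)) / n := by ring
      have e2 : κ * (2 / n + 1) = κ * (n + 2) / n := by field_simp; ring
      rw [e1, e2]
      gcongr
    · intro r hr s hs hrs
      have hr' : 0 < r := hr
      have hs' : 0 < s := hs
      simp only [gf r hr'.le, gf s hs'.le]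
      exact hanti hr hs hrs
    · intro s hs hs1
      rw [gf s hs]
      rcases hs.eq_or_lt with h | h
      · rw [← h, Real.zero_rpow (by linarith), mul_zero]; exact hf0 0 le_rfl
      · have := hanti (show s ∈ Ioi 0 from h) (show (1:ℝ) ∈ Ioi 0 from mem_Ioi.mpr one_pos) hs1
        simp only [Real.one_rpow, div_one] at this
        rwa [le_div_iff₀ (by positivity)] at this
    · have he4 : 0 < e - 1 := by linarith
      have : (n:ℝ) - 2 < 4 / (e - 1) := by
        rw [lt_div_iff₀ he4]
        have h1 : (e - 1) * (n - 1) ^ 2 < 4 * n - 1 := by nlinarith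
        have h2 : ((n:ℝ) - 2) * ((e - 1) * (n - 1) ^ 2) ≤ (n - 2) * (4 * n - 1) :=
          mul_le_mul_of_nonneg_left h1.le (by linarith)
        have h3 : ((n:ℝ) - 2) * (e - 1) * (n - 1) ^ 2 < 4 * (n - 1) ^ 2 := by nlinarith
        exact lt_of_mul_lt_mul_right h3 (by positivity)
      linarith

end
end LV

/-- parabolic Liouville theorem for non scale invariant
nonlinearities. -/
theorem stmt_6 (n : ℕ) (hn : 1 ≤ n) (f : ℝ → ℝ)
    (hf_cont : ContinuousOn f (Ici 0)) (hf_pos : ∀ s : ℝ, 0 < s → 0 < f s)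
    (hA : n = 1 ∨ ∃ p : ℝ, 1 < p ∧ p < ((n : ℝ) * ((n : ℝ) + 2)) / ((n : ℝ) - 1) ^ 2 ∧
      AntitoneOn (fun s : ℝ => f s / s ^ p) (Ioi 0))
    (hB : (∃ m₀ m₁ : ℝ, 1 < m₀ ∧ 1 < m₁ ∧
            (∀ s : ℝ, 0 < s → Tendsto (fun lam : ℝ => f (lam * s) / f lam)
              (nhdsWithin 0 (Ioi 0)) (nhds (s ^ m₀))) ∧
            (∀ s : ℝ, 0 < s → Tendsto (fun lam : ℝ => f (lam * s) / f lam)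
              atTop (nhds (s ^ m₁)))) ∨
          (∃ q σ s₀ s₁ : ℝ, 1 < q ∧ 0 < σ ∧ 0 < s₀ ∧ 0 < s₁ ∧
            MonotoneOn f (Ici s₀) ∧
            (∀ s : ℝ, s₀ ≤ s → s ^ q ≤ f s) ∧
            MonotoneOn (fun s : ℝ => f s / s ^ σ) (Ioc 0 s₁))) :
    ∀ u : (Fin n → ℝ) → ℝ → ℝ,
      (∀ (x : Fin n → ℝ) (t : ℝ), 0 ≤ u x t) →
      IsEntireParabolicSol f u →
      ∀ (x : Fin n → ℝ) (t : ℝ), u x t = 0 := by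
  intro u hu hsol
  obtain ⟨h1, h2, h3, h4, h5, h6, h7, h8⟩ := hsol
  obtain ⟨hK, hG⟩ := LV.fcond hf_cont hf_pos hB
  let U : LV.Sol n (fun s => f (max s 0)) :=
    { u := fun z => u z.1 z.2
      ut := fun z => deriv (u z.1) z.2
      p := fun i z => deriv (fun s : ℝ => u (Function.update z.1 i s) z.2) (z.1 i)
      h := fun i z => deriv (deriv (fun s : ℝ => u (Function.update z.1 i s) z.2)) (z.1 i)
      cu := h1
      cut := h3
      cp := h5
      ch := h7
      dt := fun x t => (h2 x t).hasDerivAt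
      dp := fun i t x => (h4 x t i).hasDerivAt
      dh := fun i t x => by
        have := (h6 x t i).hasDerivAt
        refine this.congr_of_eventuallyEq (Eventually.of_forall fun s => ?_)
        simp
      pos := fun z => hu z.1 z.2
      cf := hf_cont.comp_continuous (by fun_prop) fun s => le_max_right s 0
      eq := fun z => by
        have := h8 z.1 z.2
        rw [max_eq_left (hu z.1 z.2)]
        linarith }
  intro x t
  exact LV.final hn hf_cont hf_pos hA hK hG rfl U (x, t)
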